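/- There is a constant C (depending only on b, c_+, c_- and the fixed cutoff functions) such that for all p∈(1,2], every nonempty U⊂(0,∞), and all Schwartz functions f on ℝ², ‖ sup_{u∈U} |S^{(u)} f| ‖_{L^p(ℝ²)} ≤ C (p-1)^{-7} √(log 𝔑(U)) ‖f‖_{L^p(ℝ²)}. -/

import Mathlib

open MeasureTheory Filter Set Topology
open scoped ENNReal NNReal Topology Classical

noncomputable section

/-- The homogeneous curve of degree `b`: `γ_b(t) = c₊ t^b` for `t > 0`,
`γ_b(t) = c₋ (-t)^b` for `t < 0`, `γ_b(0) = 0`. -/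
def curve (b cp cm t : ℝ) : ℝ :=
  if 0 < t then cp * t ^ b else if t < 0 then cm * (-t) ^ b else 0

/-- The maximal function along the curve `(t, u γ_b(t))`. -/
def Mu (b cp cm u : ℝ) (f : ℝ × ℝ → ℝ) (x : ℝ × ℝ) : ℝ :=
  ⨆ R : {R : ℝ // 0 < R},
    ((R : ℝ))⁻¹ * ∫ t in (0:ℝ)..(R : ℝ), |f (x - (t, u * curve b cp cm t))|

/-- The maximal function `𝓜^U f = sup_{u ∈ U} M^{(u)} f`. -/
def calM (b cp cm : ℝ) (U : Set ℝ) (f : ℝ × ℝ → ℝ) (x : ℝ × ℝ) : ℝ :=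
  ⨆ u : U, Mu b cp cm (u : ℝ) f x

/-- The Hilbert transform along the curve `(t, u γ_b(t))` (principal value). -/
def Hu (b cp cm u : ℝ) (f : ℝ × ℝ → ℝ) (x : ℝ × ℝ) : ℝ :=
  limUnder (𝓝[>] (0:ℝ)) fun ε : ℝ =>
    ∫ t in {t : ℝ | ε < |t| ∧ |t| < ε⁻¹}, f (x - (t, u * curve b cp cm t)) / t

/-- The maximal function `𝓗^U f = sup_{u ∈ U} |H^{(u)} f|`, valued in `ℝ≥0∞`. -/
def calH (b cp cm : ℝ) (U : Set ℝ) (f : ℝ × ℝ → ℝ) (x : ℝ × ℝ) : ℝ≥0∞ :=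
  ⨆ u : U, ENNReal.ofReal |Hu b cp cm (u : ℝ) f x|

/-- The `L^p` norm of an `ℝ≥0∞`-valued function on `ℝ²`. -/
def lpN (g : ℝ × ℝ → ℝ≥0∞) (p : ℝ) : ℝ≥0∞ :=
  (∫⁻ x : ℝ × ℝ, g x ^ p) ^ (1 / p)

def eN (p : ℝ) : ℝ≥0∞ := ENNReal.ofReal p

/-- `U^r = r⁻¹ U ∩ [1,2] = {ρ ∈ [1,2] : rρ ∈ U}`. -/
def UrSet (U : Set ℝ) (r : ℝ) : Set ℝ := {ρ : ℝ | ρ ∈ Icc (1:ℝ) 2 ∧ r * ρ ∈ U}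

/-- `N(A,δ)`: minimal number of intervals of length `δ` needed to cover `A`. -/
def covN (A : Set ℝ) (δ : ℝ) : ℕ :=
  sInf {n : ℕ | ∃ F : Finset ℝ, F.card = n ∧ A ⊆ ⋃ a ∈ F, Icc a (a + δ)}

/-- `𝒦_p(U,δ) = δ^{1-1/p} sup_{r>0} N(U^r,δ)^{1/p}`. -/
def Kp (U : Set ℝ) (δ p : ℝ) : ℝ :=
  δ ^ (1 - 1 / p) * ⨆ r : {r : ℝ // 0 < r}, ((covN (UrSet U (r : ℝ)) δ : ℝ)) ^ (1 / p)

/-- `p_cr(U) = 1 + limsup_{δ→0+} sup_{r>0} log N(U^r,δ) / log(1/δ)`. -/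
def pcr (U : Set ℝ) : ℝ :=
  1 + limsup (fun δ : ℝ =>
      (⨆ r : {r : ℝ // 0 < r}, Real.log (covN (UrSet U (r : ℝ)) δ)) / Real.log δ⁻¹)
    (𝓝[>] (0:ℝ))

/-- `𝔑(U) = 1 + #{n ∈ ℤ : [2ⁿ, 2ⁿ⁺¹] ∩ U ≠ ∅}`. -/
def frakN (U : Set ℝ) : ℕ∞ :=
  1 + Set.encard {n : ℤ | (Icc ((2:ℝ) ^ n) ((2:ℝ) ^ (n + 1)) ∩ U).Nonempty}

/-- `√(log 𝔑(U))`, valued in `ℝ≥0∞` (equal to `∞` if `𝔑(U) = ∞`). -/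
def sqrtLogN (U : Set ℝ) : ℝ≥0∞ :=
  if frakN U = ⊤ then ⊤
  else ENNReal.ofReal (Real.sqrt (Real.log ((frakN U).toNat : ℝ)))

/-- The `L^p → L^p` operator norm of `𝓜^U` (smallest admissible constant, possibly `∞`). -/
def opNormM (b cp cm : ℝ) (U : Set ℝ) (p : ℝ) : ℝ≥0∞ :=
  sInf {C : ℝ≥0∞ | ∀ f : SchwartzMap (ℝ × ℝ) ℝ,
    eLpNorm (calM b cp cm U ⇑f) (eN p) volume ≤ C * eLpNorm ⇑f (eN p) volume}

/-- The `L^p → L^p` operator norm of `𝓗^U` (smallest admissible constant, possibly `∞`). -/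
def opNormH (b cp cm : ℝ) (U : Set ℝ) (p : ℝ) : ℝ≥0∞ :=
  sInf {C : ℝ≥0∞ | ∀ f : SchwartzMap (ℝ × ℝ) ℝ,
    lpN (calH b cp cm U ⇑f) p ≤ C * eLpNorm ⇑f (eN p) volume}

/-- `θ_{p,ℓ}`. -/
def theta (p : ℝ) (l : ℕ) : ℝ :=
  if (l : ℝ) ≤ (p - 1)⁻¹ then (p - 1) ^ (3 - 10 / p) else (l : ℝ) ^ (7 * (2 / p - 1))

/-- `Σ_{ℓ≥1} θ_{p,ℓ} 𝒦_p(U, 2^{-ℓ})`, valued in `ℝ≥0∞`. -/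
def KpSum (U : Set ℝ) (p : ℝ) : ℝ≥0∞ :=
  ∑' l : ℕ, ENNReal.ofReal (theta p (l + 1) * Kp U ((2:ℝ) ^ (-((l : ℝ) + 1))) p)

/-- The Fourier transform on `ℝ²`. -/
def FT (f : ℝ × ℝ → ℂ) (ξ : ℝ × ℝ) : ℂ :=
  ∫ x : ℝ × ℝ,
    Complex.exp ((((-(2 * Real.pi * (x.1 * ξ.1 + x.2 * ξ.2))) : ℝ) : ℂ) * Complex.I) * f x

/-- The inverse Fourier transform on `ℝ²`. -/
def FTinv (g : ℝ × ℝ → ℂ) (x : ℝ × ℝ) : ℂ :=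
  ∫ ξ : ℝ × ℝ,
    Complex.exp (((2 * Real.pi * (x.1 * ξ.1 + x.2 * ξ.2) : ℝ) : ℂ) * Complex.I) * g ξ

/-- `τ̂₀(ξ) = ∫ e^{-2πi(ξ₁t + ξ₂γ_b(t))} χ₊(t) dt`. -/
def tauHat (b cp cm : ℝ) (χp : ℝ → ℝ) (ξ : ℝ × ℝ) : ℂ :=
  ∫ t : ℝ,
    Complex.exp ((((-(2 * Real.pi * (ξ.1 * t + ξ.2 * curve b cp cm t))) : ℝ) : ℂ) * Complex.I)
      * ((χp t : ℝ) : ℂ)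

/-- `σ̂(ξ) = ∫ e^{-2πi(ξ₁t + ξ₂γ_b(t))} χ(t) dt/t` for a cutoff `χ`. -/
def sigmaHat (b cp cm : ℝ) (χ : ℝ → ℝ) (ξ : ℝ × ℝ) : ℂ :=
  ∫ t : ℝ,
    Complex.exp ((((-(2 * Real.pi * (ξ.1 * t + ξ.2 * curve b cp cm t))) : ℝ) : ℂ) * Complex.I)
      * ((χ t / t : ℝ) : ℂ)

/-- `ρ̂₀(ξ) = (1-η₀(ξ)) ς₋(ξ₁/(c₊ξ₂)) τ̂₀(ξ)`. -/
def rhoHat (b cp cm : ℝ) (χp : ℝ → ℝ) (η : ℝ × ℝ → ℝ) (ςm : ℝ → ℝ) (ξ : ℝ × ℝ) : ℂ :=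
  (((1 - η ξ) * ςm (ξ.1 / (cp * ξ.2)) : ℝ) : ℂ) * tauHat b cp cm χp ξ

/-- `μ̂_{0,±}`; `sgn = true` is the `+` sign. -/
def muHat (b cp cm : ℝ) (χp : ℝ → ℝ) (η : ℝ × ℝ → ℝ) (ςp ςm : ℝ → ℝ) (sgn : Bool)
    (ξ : ℝ × ℝ) : ℂ :=
  if sgn then
    (((1 - η ξ) * ςm (ξ.1 / (cp * ξ.2)) : ℝ) : ℂ) * sigmaHat b cp cm χp ξ
  else
    (((1 - η ξ) * ςp (ξ.1 / (cm * ξ.2)) : ℝ) : ℂ) * sigmaHat b cp cm (fun t => χp (-t)) ξ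

/-- `ζ_ℓ(ξ) = ζ₀(2^{-ℓ}ξ) - ζ₀(2^{1-ℓ}ξ)`. -/
def zl (ζ : ℝ × ℝ → ℝ) (l : ℕ) (ξ : ℝ × ℝ) : ℝ :=
  ζ ((2:ℝ) ^ (-(l : ℝ)) • ξ) - ζ ((2:ℝ) ^ (1 - (l : ℝ)) • ξ)

/-- The anisotropic dilation `ξ ↦ (2^{-j}ξ₁, 2^{-jb} u ξ₂)`. -/
def dil (b : ℝ) (j : ℤ) (u : ℝ) (ξ : ℝ × ℝ) : ℝ × ℝ :=
  ((2:ℝ) ^ (-(j : ℝ)) * ξ.1, (2:ℝ) ^ (-((j : ℝ) * b)) * (u * ξ.2))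

/-- `A_{j,ℓ}^u`, defined via `(A_{j,ℓ}^u f)^(ξ) = ζ_ℓ(...) ρ̂₀(...) f̂(ξ)`. -/
def Ajl (b cp cm : ℝ) (χp : ℝ → ℝ) (η : ℝ × ℝ → ℝ) (ςm : ℝ → ℝ) (ζ : ℝ × ℝ → ℝ)
    (j : ℤ) (l : ℕ) (u : ℝ) (f : ℝ × ℝ → ℝ) : ℝ × ℝ → ℂ :=
  FTinv fun ξ =>
    ((zl ζ l (dil b j u ξ) : ℝ) : ℂ) * rhoHat b cp cm χp η ςm (dil b j u ξ)
      * FT (fun x => ((f x : ℝ) : ℂ)) ξ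

/-- `T_{j,ℓ,±}^u`, defined via `(T_{j,ℓ,±}^u f)^(ξ) = ζ_ℓ(...) μ̂_{0,±}(...) f̂(ξ)`. -/
def Tjl (b cp cm : ℝ) (χp : ℝ → ℝ) (η : ℝ × ℝ → ℝ) (ςp ςm : ℝ → ℝ) (ζ : ℝ × ℝ → ℝ)
    (sgn : Bool) (j : ℤ) (l : ℕ) (u : ℝ) (f : ℝ × ℝ → ℝ) : ℝ × ℝ → ℂ :=
  FTinv fun ξ =>
    ((zl ζ l (dil b j u ξ) : ℝ) : ℂ) * muHat b cp cm χp η ςp ςm sgn (dil b j u ξ)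
      * FT (fun x => ((f x : ℝ) : ℂ)) ξ

/-- `φ̂₀(ξ) = η₀(ξ)τ̂₀(ξ) + (1-η₀(ξ))(1-ς₋(ξ₁/(c₊ξ₂)))τ̂₀(ξ)` (maximal-function version). -/
def phiHatTau (b cp cm : ℝ) (χp : ℝ → ℝ) (η : ℝ × ℝ → ℝ) (ςm : ℝ → ℝ) (ξ : ℝ × ℝ) : ℂ :=
  ((η ξ + (1 - η ξ) * (1 - ςm (ξ.1 / (cp * ξ.2))) : ℝ) : ℂ) * tauHat b cp cm χp ξ

/-- `A_{j,0}^u`, defined via `(A_{j,0}^u f)^(ξ) = φ̂₀(2^{-j}ξ₁, 2^{-jb}uξ₂) f̂(ξ)`. -/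
def Aj0 (b cp cm : ℝ) (χp : ℝ → ℝ) (η : ℝ × ℝ → ℝ) (ςm : ℝ → ℝ)
    (j : ℤ) (u : ℝ) (f : ℝ × ℝ → ℝ) : ℝ × ℝ → ℂ :=
  FTinv fun ξ => phiHatTau b cp cm χp η ςm (dil b j u ξ) * FT (fun x => ((f x : ℝ) : ℂ)) ξ

/-- `φ̂₀(ξ)` (Hilbert-transform version, built from `σ̂_±`). -/
def phiHatSigma (b cp cm : ℝ) (χp : ℝ → ℝ) (η : ℝ × ℝ → ℝ) (ςp ςm : ℝ → ℝ)
    (ξ : ℝ × ℝ) : ℂ :=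
  ((η ξ : ℝ) : ℂ) * (sigmaHat b cp cm χp ξ + sigmaHat b cp cm (fun t => χp (-t)) ξ)
    + (((1 - η ξ) * (1 - ςm (ξ.1 / (cp * ξ.2))) : ℝ) : ℂ) * sigmaHat b cp cm χp ξ
    + (((1 - η ξ) * (1 - ςp (ξ.1 / (cm * ξ.2))) : ℝ) : ℂ)
        * sigmaHat b cp cm (fun t => χp (-t)) ξ

/-- `S^{(u)}`, defined via `(S^{(u)} f)^(ξ) = Σ_j φ̂₀(2^{-j}ξ₁, 2^{-jb}uξ₂) f̂(ξ)`. -/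
def Sop (b cp cm : ℝ) (χp : ℝ → ℝ) (η : ℝ × ℝ → ℝ) (ςp ςm : ℝ → ℝ)
    (u : ℝ) (f : ℝ × ℝ → ℝ) : ℝ × ℝ → ℂ :=
  FTinv fun ξ =>
    (∑' j : ℤ, phiHatSigma b cp cm χp η ςp ςm (dil b j u ξ)) * FT (fun x => ((f x : ℝ) : ℂ)) ξ

/-- The convolution `τ_j^u * f`. -/
def tauConv (b cp cm : ℝ) (χp : ℝ → ℝ) (j : ℤ) (u : ℝ) (f : ℝ × ℝ → ℝ) (x : ℝ × ℝ) : ℝ :=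
  ∫ t : ℝ, f (x - (t, u * curve b cp cm t)) * ((2:ℝ) ^ j * χp ((2:ℝ) ^ j * t))

/-- The `ℓ^p(ℕ)` norm of a sequence. -/
def wNorm (w : ℕ → ℂ) (p : ℝ) : ℝ≥0∞ :=
  (∑' i : ℕ, ENNReal.ofReal (‖w i‖ ^ p)) ^ (1 / p)

/-- The auxiliary maximal operator `𝔐_R[f,w]`. -/
def MfrakR (b cp cm : ℝ) (χp : ℝ → ℝ) (s : ℤ → ℕ → ℝ) (R : ℕ)
    (f : ℝ × ℝ → ℝ) (w : ℤ → ℕ → ℂ) (x : ℝ × ℝ) : ℝ≥0∞ :=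
  ⨆ (j : ℤ) (_ : -(R:ℤ) ≤ j ∧ j ≤ R) (n : ℤ) (_ : -(R:ℤ) ≤ n ∧ n ≤ R) (i : ℕ),
    ENNReal.ofReal
      (‖w n i‖ * |tauConv b cp cm χp j ((2:ℝ) ^ (b * (n : ℝ)) * s n i) f x|)

/-- `B_p(R)`: the best constant in `‖𝔐_R[f,w]‖_p ≤ C (sup_n ‖w_n‖_{ℓ^p}) ‖f‖_p`. -/
def BpR (b cp cm : ℝ) (χp : ℝ → ℝ) (s : ℤ → ℕ → ℝ) (p : ℝ) (R : ℕ) : ℝ≥0∞ :=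
  ⨆ (f : SchwartzMap (ℝ × ℝ) ℝ) (w : ℤ → ℕ → ℂ)
    (_ : eLpNorm ⇑f (eN p) volume ≤ 1) (_ : ∀ n : ℤ, wNorm (w n) p ≤ 1),
    lpN (MfrakR b cp cm χp s R ⇑f w) p

/-- `ℓ^q` norm (over an index type) of an `ℝ≥0∞`-valued family, `q ∈ (0,∞]`. -/
def lqS {ι : Type*} (q : ℝ≥0∞) (g : ι → ℝ≥0∞) : ℝ≥0∞ :=
  if q = ⊤ then ⨆ i, g i else (∑' i, g i ^ q.toReal) ^ (1 / q.toReal)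

/-- The quotient `p/q`, with the convention `p/∞ = 0`. -/
def pqr (p : ℝ) (q : ℝ≥0∞) : ℝ := if q = ⊤ then 0 else p / q.toReal

/-- A supermartingale on the dyadic tree has decreasing averages. -/
lemma tree_sum_le (c : ℕ → ℤ → ℝ)
    (h : ∀ k m, c (k+1) (2*m) + c (k+1) (2*m+1) ≤ 2 * c k m) (N : ℕ) (m : ℤ) :
    ∑ i ∈ Finset.range (2^N), c N (2^N * m + (i:ℤ)) ≤ 2^N * c 0 m := by
  have key : ∀ N : ℕ, ∀ k m, ∑ i ∈ Finset.range (2^N), c (k+N) (2^N * m + (i:ℤ)) ≤ 2^N * c k m := by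
    intro N
    induction N with
    | zero => intro k m; simp
    | succ N ih =>
      intro k m
      have h1 := ih (k+1) (2*m)
      have h2 := ih (k+1) (2*m+1)
      have h3 := h k m
      have e : k + (N+1) = k+1+N := by ring
      rw [e, pow_succ, mul_two, Finset.sum_range_add]
      have e1 : ∀ i : ℕ, (2^N * 2 * m + (i:ℤ)) = 2^N * (2*m) + (i:ℤ) := fun i => by ring
      have e2 : ∀ i : ℕ, (2^N * 2 * m + ((2^N + i : ℕ):ℤ)) = 2^N * (2*m+1) + (i:ℤ) :=
        fun i => by push_cast; ring
      simp only [e2, pow_succ, e1]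
      have h4 : (2:ℝ)^N * (c (k+1) (2*m) + c (k+1) (2*m+1)) ≤ 2^N * (2 * c k m) := by gcongr
      nlinarith
  simpa using key N 0 m

/-- Telescoping comparison of integrals of functions constant on dyadic cells. -/
lemma lintegral_floor (h : ℝ) (hh : 0 < h) (φ : ℤ → ℝ≥0∞) :
    ∫⁻ x : ℝ, φ ⌊x / h⌋ = ENNReal.ofReal h * ∑' m, φ m := by
  have hU : (⋃ m : ℤ, {x : ℝ | ⌊x / h⌋ = m}) = univ := by ext; simp
  have hm : ∀ m : ℤ, {x : ℝ | ⌊x / h⌋ = m} = Ico (h * m) (h * m + h) := by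
    intro m; ext x
    simp only [mem_ofPred_eq, Int.floor_eq_iff, mem_Ico]
    rw [le_div_iff₀ hh, div_lt_iff₀ hh]
    constructor <;> rintro ⟨a, b⟩ <;> constructor <;> nlinarith
  rw [← setLIntegral_univ, ← hU, lintegral_iUnion, ← ENNReal.tsum_mul_left]
  · congr 1; ext m
    rw [setLIntegral_congr_fun (g := fun _ => φ m)]
    · rw [setLIntegral_const, hm, Real.volume_Ico]; simp [mul_comm]
    · rw [hm]; exact measurableSet_Ico
    · intro x hx; simp only [mem_ofPred_eq] at hx; simp [hx]
  · intro m; rw [hm]; exact measurableSet_Ico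
  · intro m n hmn
    refine Set.disjoint_left.2 fun x hx hy => hmn ?_
    simp only [mem_ofPred_eq] at hx hy; rw [← hx, hy]

lemma tsum_int_eq_blocks (n : ℕ) (hn : 0 < n) (φ : ℤ → ℝ≥0∞) :
    ∑' m, φ m = ∑' m : ℤ, ∑ i ∈ Finset.range n, φ (n * m + i) := by
  have : NeZero n := ⟨hn.ne'⟩
  rw [← (Int.divModEquiv n).symm.tsum_eq,
    ENNReal.tsum_prod (f := fun m i => φ ((Int.divModEquiv n).symm (m, i)))]
  congr 1; ext m
  rw [tsum_fintype, Finset.sum_range]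
  refine Finset.sum_congr rfl fun i _ => ?_
  simp [Int.divModEquiv, mul_comm]

/-- Integral comparison from a supermartingale. -/
lemma lintegral_tree_le (a b : ℕ → ℤ → ℝ) (ha : ∀ k m, 0 ≤ a k m)
    (hb : ∀ k m, 0 ≤ b k m) (h0 : ∀ m, a 0 m ≤ b 0 m)
    (h : ∀ k m, (a (k+1) (2*m) - b (k+1) (2*m)) + (a (k+1) (2*m+1) - b (k+1) (2*m+1))
      ≤ 2 * (a k m - b k m)) (N : ℕ) (r : ℝ) (hr : 0 < r) :
    ∫⁻ x : ℝ, ENNReal.ofReal (a N ⌊x / r⌋) ≤ ∫⁻ x : ℝ, ENNReal.ofReal (b N ⌊x / r⌋) := by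
  rw [lintegral_floor r hr (fun m => ENNReal.ofReal (a N m)),
    lintegral_floor r hr (fun m => ENNReal.ofReal (b N m))]
  rw [tsum_int_eq_blocks (2^N) (by positivity) (fun m => ENNReal.ofReal (a N m)),
    tsum_int_eq_blocks (2^N) (by positivity) (fun m => ENNReal.ofReal (b N m))]
  refine mul_le_mul le_rfl (ENNReal.tsum_le_tsum fun m => ?_) (by simp) (by simp)
  rw [← ENNReal.ofReal_sum_of_nonneg (fun _ _ => ha _ _),
    ← ENNReal.ofReal_sum_of_nonneg (fun _ _ => hb _ _)]
  apply ENNReal.ofReal_le_ofReal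
  have := tree_sum_le (fun k m => a k m - b k m) h N m
  rw [Finset.sum_sub_distrib] at this
  have h2 : (2:ℝ)^N * (a 0 m - b 0 m) ≤ 0 :=
    mul_nonpos_of_nonneg_of_nonpos (by positivity) (by linarith [h0 m])
  push_cast
  linarith

/-- The running maximum along the dyadic tree. -/
def runMax (y : ℕ → ℤ → ℝ) : ℕ → ℤ → ℝ
  | 0, m => y 0 m
  | k+1, m => max (runMax y k (m/2)) (y (k+1) m)

lemma two_mul_ediv_two (m : ℤ) : 2 * m / 2 = m := by omega
lemma two_mul_add_one_ediv_two (m : ℤ) : (2 * m + 1) / 2 = m := by omega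

lemma le_runMax (y : ℕ → ℤ → ℝ) (k : ℕ) (m : ℤ) : y k m ≤ runMax y k m := by
  cases k with
  | zero => exact le_rfl
  | succ k => exact le_max_right _ _

lemma young_pow (p : ℝ) (hp : 1 < p) (m z : ℝ) (hm : 0 ≤ m) (hz : 0 ≤ z) :
    p * m^(p-1) * z ≤ (p-1) * m^p + z^p := by
  have hpq : p.HolderConjugate (p/(p-1)) := by
    rw [Real.holderConjugate_iff]; refine ⟨hp, ?_⟩
    have : p - 1 ≠ 0 := by linarith
    have : p ≠ 0 := by linarith
    field_simp; ring
  have h := Real.young_inequality_of_nonneg hz (Real.rpow_nonneg hm (p-1)) hpq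
  rw [← Real.rpow_mul hm] at h
  have h1 : p - 1 ≠ 0 := by linarith
  have e : (p-1) * (p/(p-1)) = p := by field_simp
  rw [e] at h
  have e2 : m^p / (p/(p-1)) = (p-1) * m^p / p := by
    have : p ≠ 0 := by linarith
    field_simp
  rw [e2, ← add_div, le_div_iff₀ (by linarith)] at h
  linarith

lemma doob_step (p : ℝ) (hp : 1 < p) (m y : ℝ) (hm : 0 ≤ m) (hy : 0 ≤ y) :
    p * (max m y)^p - p * (p/(p-1)) * (max m y)^(p-1) * y
      ≤ p * m^p - p * (p/(p-1)) * m^(p-1) * y := by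
  rcases le_total y m with h | h
  · rw [max_eq_left h]
  · rw [max_eq_right h]
    have hY := young_pow p hp m y hm hy
    have e : y^(p-1) * y = y^p := by
      rcases hy.eq_or_lt with h0 | h0
      · subst h0; rw [mul_zero, Real.zero_rpow (by linarith)]
      · rw [← Real.rpow_add_one h0.ne']; ring_nf
    have hp1 : 0 < p - 1 := by linarith
    rw [mul_assoc _ (y^(p-1)), e]
    have e1 : p * y^p - p * (p/(p-1)) * y^p = (p/(p-1)) * (- y^p) := by
      field_simp; ring
    have e2 : p * m^p - p * (p/(p-1)) * m^(p-1) * y = (p/(p-1)) * ((p-1)*m^p - p * m^(p-1)*y) := by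
      field_simp
    rw [e1, e2]
    have : 0 ≤ p/(p-1) := by positivity
    apply mul_le_mul_of_nonneg_left _ this
    linarith

lemma runMax_nonneg (y : ℕ → ℤ → ℝ) (hy : ∀ k m, 0 ≤ y k m) (k : ℕ) (m : ℤ) : 0 ≤ runMax y k m :=
  (hy k m).trans (le_runMax y k m)

/-- Doob's maximal inequality for dyadic martingales. -/
lemma doob_lintegral (p : ℝ) (hp : 1 < p) (y : ℕ → ℤ → ℝ) (hy : ∀ k m, 0 ≤ y k m)
    (hmart : ∀ k m, y (k+1) (2*m) + y (k+1) (2*m+1) = 2 * y k m) (N : ℕ) (r : ℝ) (hr : 0 < r) :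
    ∫⁻ x : ℝ, ENNReal.ofReal (runMax y N ⌊x / r⌋ ^ p) ≤
      ∫⁻ x : ℝ, ENNReal.ofReal ((p/(p-1)) ^ p * y N ⌊x / r⌋ ^ p) := by
  have hp1 : 0 < p - 1 := by linarith
  have hq : 0 ≤ p/(p-1) := by positivity
  have hM := runMax_nonneg y hy
  have hlow : ∀ k m, runMax y k m ^ p ≤ p * runMax y k m ^ p
      - p * (p/(p-1)) * runMax y k m ^ (p-1) * y k m + (p/(p-1))^p * y k m ^ p := by
    intro k m
    have := young_pow p hp (runMax y k m) ((p/(p-1)) * y k m) (hM k m) (mul_nonneg hq (hy k m))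
    rw [Real.mul_rpow hq (hy k m)] at this
    nlinarith
  refine le_trans (lintegral_mono fun x => ENNReal.ofReal_le_ofReal (hlow N _)) ?_
  refine lintegral_tree_le (fun k m => p * runMax y k m ^ p
      - p * (p/(p-1)) * runMax y k m ^ (p-1) * y k m + (p/(p-1))^p * y k m ^ p)
    (fun k m => (p/(p-1))^p * y k m ^ p)
    (fun k m => (Real.rpow_nonneg (hM k m) p).trans (hlow k m))
    (fun k m => mul_nonneg (Real.rpow_nonneg hq _) (Real.rpow_nonneg (hy k m) _)) ?_ ?_ N r hr
  · intro m
    have e : runMax y 0 m = y 0 m := rfl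
    have h := doob_step p hp 0 (y 0 m) le_rfl (hy 0 m)
    rw [max_eq_right (hy 0 m), Real.zero_rpow (by linarith), Real.zero_rpow (by linarith)] at h
    simp only [e]
    linarith
  · intro k m
    have h1 := doob_step p hp (runMax y k m) (y (k+1) (2*m)) (hM k m) (hy _ _)
    have h2 := doob_step p hp (runMax y k m) (y (k+1) (2*m+1)) (hM k m) (hy _ _)
    have h3 := hmart k m
    simp only [runMax, two_mul_ediv_two, two_mul_add_one_ediv_two]
    have h4 : p * (p/(p-1)) * runMax y k m ^ (p-1) * y (k+1) (2*m) +
      p * (p/(p-1)) * runMax y k m ^ (p-1) * y (k+1) (2*m+1) =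
      p * (p/(p-1)) * runMax y k m ^ (p-1) * (2 * y k m) := by rw [← h3]; ring
    linarith

lemma rpow_two_sub_le (p r : ℝ) (hp : 1 ≤ p) (hr : 1 ≤ r) (hr2 : r ≤ 2) :
    r^2 - r^p ≤ 2 * (r^p - 1) := by
  have : r ≤ r^p := Real.self_le_rpow_of_one_le hr hp
  nlinarith

lemma psi_step (p : ℝ) (hp : 1 ≤ p) (hp2 : p ≤ 2) (M M' Q' : ℝ) (hM : 0 < M) (h1 : M ≤ M') (h2 : M' ≤ 2 * M)
    (hQ : Q' ≤ M'^2) :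
    Q' * M^(p-2) ≤ Q' * M'^(p-2) + 2 * (M'^p - M^p) := by
  have hM' : 0 < M' := by linarith
  have e1 : M'^2 * M'^(p-2) = M'^p := by
    rw [← Real.rpow_natCast, ← Real.rpow_add hM']; congr 1; push_cast; ring
  have e2 : M'^2 * M^(p-2) = M^p * (M'/M)^2 := by
    rw [div_pow, Real.rpow_sub hM]; norm_num; field_simp
  have e3 : M'^p = M^p * (M'/M)^p := by
    rw [Real.div_rpow hM'.le hM.le]; field_simp
  have hr := rpow_two_sub_le p (M'/M) hp ((one_le_div hM).2 h1) ((div_le_iff₀ hM).2 h2)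
  have hmono : M'^(p-2) ≤ M^(p-2) := Real.rpow_le_rpow_of_nonpos hM h1 (by linarith)
  have h3 : Q' * (M^(p-2) - M'^(p-2)) ≤ M'^2 * (M^(p-2) - M'^(p-2)) := by
    apply mul_le_mul_of_nonneg_right hQ; linarith
  have h4 : M^p * ((M'/M)^2 - (M'/M)^p) ≤ M^p * (2 * ((M'/M)^p - 1)) := by
    gcongr
  nlinarith

section

variable {ι : Type*} [Fintype ι]

/-- Hypotheses for a dyadic vector-valued martingale dominated by a maximal function. -/
structure DomMart (X : ι → ℕ → ℤ → ℝ) (y : ℕ → ℤ → ℝ) : Prop where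
  mart : ∀ i k m, X i (k+1) (2*m) + X i (k+1) (2*m+1) = 2 * X i k m
  ymart : ∀ k m, y (k+1) (2*m) + y (k+1) (2*m+1) = 2 * y k m
  nonneg : ∀ k m, 0 ≤ y k m
  dom : ∀ k m, ∑ i, X i k m ^ 2 ≤ y k m ^ 2

/-- The weighted potential. -/
def psiPot (p : ℝ) (X : ι → ℕ → ℤ → ℝ) (y : ℕ → ℤ → ℝ) (k : ℕ) (m : ℤ) : ℝ :=
  (∑ i, X i k m ^ 2) * runMax y k m ^ (p-2) + 2 * runMax y k m ^ p

namespace DomMart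
variable {X : ι → ℕ → ℤ → ℝ} {y : ℕ → ℤ → ℝ}

lemma sq_le_runMax (H : DomMart X y) (k m) : ∑ i, X i k m ^ 2 ≤ runMax y k m ^ 2 := by
  refine (H.dom k m).trans ?_
  have := H.nonneg k m
  have := le_runMax y k m
  gcongr

lemma child_le (H : DomMart X y) (k : ℕ) (m m' : ℤ) (hm : m' = 2*m ∨ m' = 2*m+1) :
    runMax y k m ≤ runMax y (k+1) m' ∧ runMax y (k+1) m' ≤ 2 * runMax y k m := by
  have h0 := runMax_nonneg y H.nonneg k m
  have h1 := le_runMax y k m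
  have h2 := H.ymart k m
  have h3 := H.nonneg (k+1) (2*m)
  have h4 := H.nonneg (k+1) (2*m+1)
  rcases hm with rfl | rfl <;>
    simp only [runMax, two_mul_ediv_two, two_mul_add_one_ediv_two] <;>
    exact ⟨le_max_left _ _, max_le (by linarith) (by linarith)⟩

/-- Squared increment. -/
lemma incr (H : DomMart X y) (k : ℕ) (m : ℤ) :
    (∑ i, X i (k+1) (2*m)^2) + ∑ i, X i (k+1) (2*m+1)^2 =
      2 * (∑ i, X i k m^2) + 2 * ∑ i, (X i (k+1) (2*m) - X i k m)^2 := by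
  rw [← Finset.sum_add_distrib, Finset.mul_sum, Finset.mul_sum, ← Finset.sum_add_distrib]
  refine Finset.sum_congr rfl fun i _ => ?_
  have := H.mart i k m
  have e : X i (k+1) (2*m+1) = 2 * X i k m - X i (k+1) (2*m) := by linarith
  rw [e]; ring

lemma psi_le (H : DomMart X y) (p : ℝ) (hp : 1 < p) (hp2 : p ≤ 2) (k : ℕ) (m : ℤ) :
    2 * psiPot p X y k m + 2 * (∑ i, (X i (k+1) (2*m) - X i k m)^2) * runMax y k m ^ (p-2)
      ≤ psiPot p X y (k+1) (2*m) + psiPot p X y (k+1) (2*m+1) := by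
  obtain ⟨a1, a2⟩ := H.child_le k m (2*m) (Or.inl rfl)
  obtain ⟨b1, b2⟩ := H.child_le k m (2*m+1) (Or.inr rfl)
  have hi := H.incr k m
  have q1 := H.sq_le_runMax (k+1) (2*m)
  have q2 := H.sq_le_runMax (k+1) (2*m+1)
  have q0 := H.sq_le_runMax k m
  have n1 : 0 ≤ ∑ i, X i (k+1) (2*m)^2 := Finset.sum_nonneg fun _ _ => sq_nonneg _
  have n2 : 0 ≤ ∑ i, X i (k+1) (2*m+1)^2 := Finset.sum_nonneg fun _ _ => sq_nonneg _
  have n0 : 0 ≤ ∑ i, X i k m^2 := Finset.sum_nonneg fun _ _ => sq_nonneg _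
  unfold psiPot
  rcases (runMax_nonneg y H.nonneg k m).eq_or_lt with h0 | h0
  · rw [← h0] at a1 a2 b1 b2 q0 ⊢
    have e1 : runMax y (k+1) (2*m) = 0 := by linarith
    have e2 : runMax y (k+1) (2*m+1) = 0 := by linarith
    rw [e1] at q1; rw [e2] at q2; rw [e1, e2]
    have z0 : ∑ i, X i k m^2 = 0 := by nlinarith
    have z1 : ∑ i, X i (k+1) (2*m)^2 = 0 := by nlinarith
    have z2 : ∑ i, X i (k+1) (2*m+1)^2 = 0 := by nlinarith
    have z3 : ∑ i, (X i (k+1) (2*m) - X i k m)^2 = 0 := by nlinarith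
    rw [z0, z1, z2, z3]; linarith
  · have s1 := psi_step p hp.le hp2 _ _ _ h0 a1 a2 q1
    have s2 := psi_step p hp.le hp2 _ _ _ h0 b1 b2 q2
    set w := runMax y k m ^ (p-2)
    have : (∑ i, X i (k+1) (2*m)^2) * w + (∑ i, X i (k+1) (2*m+1)^2) * w =
      2 * (∑ i, X i k m^2) * w + 2 * (∑ i, (X i (k+1) (2*m) - X i k m)^2) * w := by
      rw [← add_mul, hi]; ring
    linarith

lemma psi_nonneg (H : DomMart X y) (p : ℝ) (k : ℕ) (m : ℤ) : 0 ≤ psiPot p X y k m := by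
  have := runMax_nonneg y H.nonneg k m
  unfold psiPot
  have : 0 ≤ ∑ i, X i k m^2 := Finset.sum_nonneg fun _ _ => sq_nonneg _
  positivity

lemma sq_mul_le (H : DomMart X y) (p : ℝ) (hp : 1 < p) (k : ℕ) (m : ℤ) :
    (∑ i, X i k m ^ 2) * runMax y k m ^ (p-2) ≤ runMax y k m ^ p := by
  have h := runMax_nonneg y H.nonneg k m
  have q := H.sq_le_runMax k m
  have n0 : 0 ≤ ∑ i, X i k m^2 := Finset.sum_nonneg fun _ _ => sq_nonneg _
  rcases h.eq_or_lt with h0 | h0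
  · rw [← h0] at q ⊢
    have : ∑ i, X i k m^2 = 0 := by nlinarith
    rw [this, zero_mul, Real.zero_rpow (by linarith)]
  · have e1 : runMax y k m^2 * runMax y k m^(p-2) = runMax y k m^p := by
      rw [← Real.rpow_natCast, ← Real.rpow_add h0]; congr 1; push_cast; ring
    rw [← e1]; gcongr

lemma psi_le_max (H : DomMart X y) (p : ℝ) (hp : 1 < p) (k : ℕ) (m : ℤ) :
    psiPot p X y k m ≤ 3 * runMax y k m ^ p := by
  have := H.sq_mul_le p hp k m
  unfold psiPot; linarith

end DomMart

/-- Weighted square function. -/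
def sqW (p : ℝ) (X : ι → ℕ → ℤ → ℝ) (y : ℕ → ℤ → ℝ) : ℕ → ℤ → ℝ
  | 0, _ => 0
  | k+1, m => sqW p X y k (m/2) +
      (∑ i, (X i (k+1) m - X i k (m/2))^2) * runMax y k (m/2) ^ (p-2)

/-- Square function. -/
def sqF (X : ι → ℕ → ℤ → ℝ) : ℕ → ℤ → ℝ
  | 0, _ => 0
  | k+1, m => sqF X k (m/2) + ∑ i, (X i (k+1) m - X i k (m/2))^2

lemma pow_half_le (p A M : ℝ) (hp : 1 < p) (hp2 : p ≤ 2) (hA : 0 ≤ A) (hM : 0 ≤ M) (h0 : M = 0 → A = 0) :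
    A^(p/2) ≤ A * M^(p-2) + M^p := by
  rcases hM.eq_or_lt with h | h
  · rw [h0 h.symm, ← h, Real.zero_rpow (by linarith), zero_mul, zero_add]; positivity
  · rcases le_or_gt A (M^2) with h1 | h1
    · have : A^(p/2) ≤ (M^2)^(p/2) := by gcongr
      rw [← Real.rpow_natCast, ← Real.rpow_mul hM] at this
      have e : ((2:ℕ):ℝ) * (p/2) = p := by push_cast; ring
      rw [e] at this
      have : 0 ≤ A * M^(p-2) := by positivity
      linarith
    · have hA0 : 0 < A := lt_of_le_of_lt (by positivity) h1
      have e : A^(p/2) = A * A^(p/2-1) := by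
        rw [mul_comm, ← Real.rpow_add_one hA0.ne']; ring_nf
      have e2 : A^(p/2-1) ≤ (M^2)^(p/2-1) :=
        Real.rpow_le_rpow_of_nonpos (by positivity) h1.le (by linarith)
      rw [← Real.rpow_natCast, ← Real.rpow_mul hM] at e2
      have e3 : ((2:ℕ):ℝ) * (p/2-1) = p-2 := by push_cast; ring
      rw [e3] at e2
      have : 0 ≤ M^p := by positivity
      have : A * A^(p/2-1) ≤ A * M^(p-2) := by gcongr
      linarith

namespace DomMart
variable {X : ι → ℕ → ℤ → ℝ} {y : ℕ → ℤ → ℝ}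

lemma sqF_nonneg_and (H : DomMart X y) (p : ℝ) (hp2 : p ≤ 2) (k m) : 0 ≤ sqF X k m ∧ 0 ≤ sqW p X y k m ∧
    sqF X k m * runMax y k m ^ (p-2) ≤ sqW p X y k m ∧ (runMax y k m = 0 → sqF X k m = 0) := by
  induction k generalizing m with
  | zero => simp [sqF, sqW]
  | succ k ih =>
    obtain ⟨i1, i2, i3, i4⟩ := ih (m/2)
    have hm : m = 2*(m/2) ∨ m = 2*(m/2)+1 := by omega
    obtain ⟨a1, a2⟩ := H.child_le k (m/2) m hm
    have hM := runMax_nonneg y H.nonneg k (m/2)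
    have n : 0 ≤ ∑ i, (X i (k+1) m - X i k (m/2))^2 := Finset.sum_nonneg fun _ _ => sq_nonneg _
    have hz : runMax y (k+1) m = 0 → sqF X (k+1) m = 0 := by
      intro h
      have h' : runMax y k (m/2) = 0 := by linarith
      have q1 := H.sq_le_runMax (k+1) m
      have q2 := H.sq_le_runMax k (m/2)
      rw [h] at q1; rw [h'] at q2
      have q3 : ∀ i, X i (k+1) m = 0 := fun i => by
        have := Finset.single_le_sum (f := fun i => X i (k+1) m ^2) (fun _ _ => sq_nonneg _) (Finset.mem_univ i)
        nlinarith
      have q4 : ∀ i, X i k (m/2) = 0 := fun i => by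
        have := Finset.single_le_sum (f := fun i => X i k (m/2) ^2) (fun _ _ => sq_nonneg _) (Finset.mem_univ i)
        nlinarith
      simp only [sqF, i4 h', q3, q4]; simp
    refine ⟨by simp only [sqF]; positivity, by simp only [sqW]; positivity, ?_, hz⟩
    rcases hM.eq_or_lt with h | h
    · have : runMax y (k+1) m = 0 := by linarith
      rw [hz this, zero_mul]; simp only [sqW]; positivity
    · have hmono : runMax y (k+1) m^(p-2) ≤ runMax y k (m/2)^(p-2) :=
        Real.rpow_le_rpow_of_nonpos h a1 (by linarith)
      simp only [sqF, sqW, add_mul]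
      refine add_le_add (le_trans ?_ i3) ?_ <;> gcongr

/-- The square function estimate for dyadic martingales, `1 < p ≤ 2`. -/
lemma square_le (H : DomMart X y) (p : ℝ) (hp : 1 < p) (hp2 : p ≤ 2) (N : ℕ) (r : ℝ) (hr : 0 < r) :
    ∫⁻ x : ℝ, ENNReal.ofReal (sqF X N ⌊x / r⌋ ^ (p/2)) ≤
      4 * ∫⁻ x : ℝ, ENNReal.ofReal (runMax y N ⌊x / r⌋ ^ p) := by
  have hM := runMax_nonneg y H.nonneg
  have h1 : ∫⁻ x : ℝ, ENNReal.ofReal (sqW p X y N ⌊x / r⌋) ≤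
      ∫⁻ x : ℝ, ENNReal.ofReal (psiPot p X y N ⌊x / r⌋) := by
    refine lintegral_tree_le (sqW p X y) (psiPot p X y) (fun k m => (H.sqF_nonneg_and p hp2 k m).2.1)
      (fun k m => H.psi_nonneg p k m) (fun m => H.psi_nonneg p 0 m) ?_ N r hr
    intro k m
    have := H.psi_le p hp hp2 k m
    simp only [sqW, two_mul_ediv_two, two_mul_add_one_ediv_two]
    have e : ∑ i, (X i (k+1) (2*m+1) - X i k m)^2 = ∑ i, (X i (k+1) (2*m) - X i k m)^2 := by
      refine Finset.sum_congr rfl fun i _ => ?_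
      have := H.mart i k m
      have e : X i (k+1) (2*m+1) = 2 * X i k m - X i (k+1) (2*m) := by linarith
      rw [e]; ring
    rw [e]; linarith
  have h2 : ∀ k m, sqF X k m ^ (p/2) ≤ sqW p X y k m + runMax y k m ^ p := by
    intro k m
    obtain ⟨i1, i2, i3, i4⟩ := H.sqF_nonneg_and p hp2 k m
    have := pow_half_le p _ _ hp hp2 i1 (hM k m) i4
    linarith
  calc _ ≤ ∫⁻ x : ℝ, (ENNReal.ofReal (sqW p X y N ⌊x / r⌋) + ENNReal.ofReal (runMax y N ⌊x / r⌋ ^ p)) := by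
        refine lintegral_mono fun x => ?_
        rw [← ENNReal.ofReal_add ((H.sqF_nonneg_and p hp2 N _).2.1) (Real.rpow_nonneg (hM _ _) _)]
        exact ENNReal.ofReal_le_ofReal (h2 N _)
    _ = (∫⁻ x : ℝ, ENNReal.ofReal (sqW p X y N ⌊x / r⌋)) + ∫⁻ x : ℝ, ENNReal.ofReal (runMax y N ⌊x / r⌋ ^ p) := by
        rw [lintegral_add_left]
        exact (measurable_of_countable (fun m : ℤ => ENNReal.ofReal (sqW p X y N m))).comp
          (Int.measurable_floor.comp (measurable_id.div_const r))
    _ ≤ (∫⁻ x : ℝ, 3 * ENNReal.ofReal (runMax y N ⌊x / r⌋ ^ p)) + ∫⁻ x : ℝ, ENNReal.ofReal (runMax y N ⌊x / r⌋ ^ p) := by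
        refine add_le_add (h1.trans (lintegral_mono fun x => ?_)) le_rfl
        have := ENNReal.ofReal_le_ofReal (H.psi_le_max p hp N ⌊x/r⌋)
        rwa [ENNReal.ofReal_mul (by norm_num), show ENNReal.ofReal 3 = 3 by norm_num] at this
    _ = _ := by
        rw [lintegral_const_mul' _ _ (by norm_num)]; ring

end DomMart

/-- Fefferman–Stein weighted functional. -/
def fsW (p : ℝ) (X : ι → ℕ → ℤ → ℝ) (y : ℕ → ℤ → ℝ) (k : ℕ) (m : ℤ) : ℝ :=
  (∑ i, (runMax (X i) k m - X i k m)^2) * runMax y k m ^ (p-2)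

namespace DomMart
variable {X : ι → ℕ → ℤ → ℝ} {y : ℕ → ℤ → ℝ}

lemma fsW_nonneg (H : DomMart X y) (p : ℝ) (k m) : 0 ≤ fsW p X y k m :=
  mul_nonneg (Finset.sum_nonneg fun _ _ => sq_nonneg _) (Real.rpow_nonneg (runMax_nonneg y H.nonneg k m) _)

lemma runMax_comp_zero (H : DomMart X y) (k m) (h : runMax y k m = 0) : ∀ i, runMax (X i) k m = 0 ∧ X i k m = 0 := by
  induction k generalizing m with
  | zero =>
    intro i
    have q := H.sq_le_runMax 0 m
    rw [h] at q
    have := Finset.single_le_sum (f := fun i => X i 0 m ^2) (fun _ _ => sq_nonneg _) (Finset.mem_univ i)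
    have : X i 0 m = 0 := by nlinarith
    exact ⟨this, this⟩
  | succ k ih =>
    intro i
    have hm : m = 2*(m/2) ∨ m = 2*(m/2)+1 := by omega
    obtain ⟨a1, a2⟩ := H.child_le k (m/2) m hm
    have hM := runMax_nonneg y H.nonneg k (m/2)
    have q := H.sq_le_runMax (k+1) m
    rw [h] at q
    have := Finset.single_le_sum (f := fun i => X i (k+1) m ^2) (fun _ _ => sq_nonneg _) (Finset.mem_univ i)
    have e : X i (k+1) m = 0 := by nlinarith
    refine ⟨?_, e⟩
    simp only [runMax]; rw [(ih (m/2) (by linarith) i).1, e]; simp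

/-- The vector-valued maximal inequality for dyadic martingales, `1 < p ≤ 2`. -/
lemma fs_le (H : DomMart X y) (p : ℝ) (hp : 1 < p) (hp2 : p ≤ 2) (N : ℕ) (r : ℝ) (hr : 0 < r) :
    ∫⁻ x : ℝ, ENNReal.ofReal ((∑ i, runMax (X i) N ⌊x / r⌋ ^ 2) ^ (p/2)) ≤
      9 * ∫⁻ x : ℝ, ENNReal.ofReal (runMax y N ⌊x / r⌋ ^ p) := by
  have hM := runMax_nonneg y H.nonneg
  have h1 : ∫⁻ x : ℝ, ENNReal.ofReal (fsW p X y N ⌊x / r⌋) ≤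
      ∫⁻ x : ℝ, ENNReal.ofReal (psiPot p X y N ⌊x / r⌋) := by
    refine lintegral_tree_le (fsW p X y) (psiPot p X y) (H.fsW_nonneg p)
      (fun k m => H.psi_nonneg p k m) ?_ ?_ N r hr
    · intro m
      have : fsW p X y 0 m = 0 := by simp [fsW, runMax]
      rw [this]; exact H.psi_nonneg p 0 m
    intro k m
    have hpsi := H.psi_le p hp hp2 k m
    obtain ⟨a1, a2⟩ := H.child_le k m (2*m) (Or.inl rfl)
    obtain ⟨b1, b2⟩ := H.child_le k m (2*m+1) (Or.inr rfl)
    have hstep : ∀ m', (m' = 2*m ∨ m' = 2*m+1) → fsW p X y (k+1) m' ≤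
        (∑ i, (runMax (X i) k m - X i (k+1) m')^2) * runMax y k m ^ (p-2) := by
      intro m' hm'
      obtain ⟨c1, c2⟩ := H.child_le k m m' hm'
      have e : m' / 2 = m := by omega
      have hs : ∑ i, (runMax (X i) (k+1) m' - X i (k+1) m')^2 ≤
          ∑ i, (runMax (X i) k m - X i (k+1) m')^2 := by
        refine Finset.sum_le_sum fun i _ => ?_
        simp only [runMax, e]
        rcases le_total (runMax (X i) k m) (X i (k+1) m') with h | h
        · rw [max_eq_right h]; simp; positivity
        · rw [max_eq_left h]
      rcases (hM k m).eq_or_lt with h | h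
      · have h' : runMax y (k+1) m' = 0 := by linarith
        have : fsW p X y (k+1) m' = 0 := by
          unfold fsW
          rw [Finset.sum_eq_zero, zero_mul]
          intro i _
          obtain ⟨u, v⟩ := H.runMax_comp_zero _ _ h' i
          rw [u, v]; simp
        rw [this]
        exact mul_nonneg (Finset.sum_nonneg fun _ _ => sq_nonneg _) (Real.rpow_nonneg (hM _ _) _)
      · have hmono : runMax y (k+1) m'^(p-2) ≤ runMax y k m^(p-2) :=
          Real.rpow_le_rpow_of_nonpos h c1 (by linarith)
        unfold fsW
        gcongr
        exact Real.rpow_nonneg (hM _ _) _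
    have s1 := hstep (2*m) (Or.inl rfl)
    have s2 := hstep (2*m+1) (Or.inr rfl)
    have e : (∑ i, (runMax (X i) k m - X i (k+1) (2*m))^2) +
        (∑ i, (runMax (X i) k m - X i (k+1) (2*m+1))^2) =
        2 * (∑ i, (runMax (X i) k m - X i k m)^2) + 2 * ∑ i, (X i (k+1) (2*m) - X i k m)^2 := by
      rw [← Finset.sum_add_distrib, Finset.mul_sum, Finset.mul_sum, ← Finset.sum_add_distrib]
      refine Finset.sum_congr rfl fun i _ => ?_
      have := H.mart i k m
      have e : X i (k+1) (2*m+1) = 2 * X i k m - X i (k+1) (2*m) := by linarith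
      rw [e]; ring
    have e' := congrArg (fun z => z * runMax y k m ^ (p-2)) e
    simp only [add_mul] at e'
    have : fsW p X y k m = (∑ i, (runMax (X i) k m - X i k m)^2) * runMax y k m ^ (p-2) := rfl
    linarith
  have h2 : ∀ k m, (∑ i, runMax (X i) k m ^ 2) ^ (p/2) ≤ 2 * fsW p X y k m + 3 * runMax y k m ^ p := by
    intro k m
    have h3 := pow_half_le p (∑ i, runMax (X i) k m ^ 2) _ hp hp2
      (Finset.sum_nonneg fun _ _ => sq_nonneg _) (hM k m) (by
        intro h
        refine Finset.sum_eq_zero fun i _ => ?_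
        rw [(H.runMax_comp_zero _ _ h i).1]; simp)
    have h4 : ∑ i, runMax (X i) k m ^ 2 ≤ 2 * (∑ i, (runMax (X i) k m - X i k m)^2) + 2 * ∑ i, X i k m^2 := by
      rw [Finset.mul_sum, Finset.mul_sum, ← Finset.sum_add_distrib]
      refine Finset.sum_le_sum fun i _ => ?_
      nlinarith [sq_nonneg (runMax (X i) k m - 2 * X i k m)]
    have h5 := mul_le_mul_of_nonneg_right h4 (Real.rpow_nonneg (hM k m) (p-2))
    have h6 := H.sq_mul_le p hp k m
    unfold fsW
    nlinarith
  have hmeas : Measurable fun x : ℝ => 2 * ENNReal.ofReal (fsW p X y N ⌊x / r⌋) :=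
    (measurable_of_countable (fun m : ℤ => 2 * ENNReal.ofReal (fsW p X y N m))).comp
          (Int.measurable_floor.comp (measurable_id.div_const r))
  calc _ ≤ ∫⁻ x : ℝ, (2 * ENNReal.ofReal (fsW p X y N ⌊x / r⌋) + 3 * ENNReal.ofReal (runMax y N ⌊x / r⌋ ^ p)) := by
        refine lintegral_mono fun x => ?_
        refine (ENNReal.ofReal_le_ofReal (h2 N _)).trans (le_of_eq ?_)
        rw [ENNReal.ofReal_add (mul_nonneg (by norm_num) (H.fsW_nonneg p _ _))
          (mul_nonneg (by norm_num) (Real.rpow_nonneg (hM _ _) _)), ENNReal.ofReal_mul (by norm_num),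
          ENNReal.ofReal_mul (by norm_num)]
        norm_num
    _ = 2 * (∫⁻ x : ℝ, ENNReal.ofReal (fsW p X y N ⌊x / r⌋)) + 3 * ∫⁻ x : ℝ, ENNReal.ofReal (runMax y N ⌊x / r⌋ ^ p) := by
        rw [lintegral_add_left hmeas, lintegral_const_mul' _ _ (by norm_num), lintegral_const_mul' _ _ (by norm_num)]
    _ ≤ 2 * (∫⁻ x : ℝ, 3 * ENNReal.ofReal (runMax y N ⌊x / r⌋ ^ p)) + 3 * ∫⁻ x : ℝ, ENNReal.ofReal (runMax y N ⌊x / r⌋ ^ p) := by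
        refine add_le_add (mul_le_mul le_rfl (h1.trans (lintegral_mono fun x => ?_)) (by simp) (by simp)) le_rfl
        have := ENNReal.ofReal_le_ofReal (H.psi_le_max p hp N ⌊x/r⌋)
        rwa [ENNReal.ofReal_mul (by norm_num), show ENNReal.ofReal 3 = 3 by norm_num] at this
    _ = _ := by
        rw [lintegral_const_mul' _ _ (by norm_num)]; ring

end DomMart

end

/-- The exponential-square potential. -/
def cwwU (α x s : ℝ) : ℝ := s ^ α * Real.exp (x^2 / (4*s))

lemma cww_scalar (B l : ℝ) (hB : 0 ≤ B) (hl : 0 < l) (hl1 : l ≤ 1) :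
    Real.exp (B*l*(1+(1-l)/2) + (1-l)/4) ≤ l * Real.exp B + 2*Real.exp 5*(1-l) := by
  have h1l : 0 ≤ 1 - l := by linarith
  rcases le_or_gt B 5 with h | h
  · have h1 : B*l*(1+(1-l)/2) + (1-l)/4 ≤ B + (1-l)/4 := by
      have : l*(1+(1-l)/2) ≤ 1 := by nlinarith
      nlinarith
    have h2 : Real.exp ((1-l)/4) ≤ 1 + (1-l) := by
      have := Real.abs_exp_sub_one_sub_id_le (x := (1-l)/4) (by rw [abs_le]; constructor <;> linarith)
      have := (abs_le.1 this).2
      nlinarith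
    calc _ ≤ Real.exp (B + (1-l)/4) := Real.exp_le_exp.2 h1
      _ = Real.exp B * Real.exp ((1-l)/4) := Real.exp_add _ _
      _ ≤ Real.exp B * (1 + (1-l)) := by gcongr
      _ = l * Real.exp B + 2 * Real.exp B * (1-l) := by ring
      _ ≤ _ := by gcongr
  · have hK : 0 < B/2-1/4 := by linarith
    rcases le_or_gt 1 (l * (B/2-1/4)) with h2 | h2
    · have h3 : B*l*(1+(1-l)/2) + (1-l)/4 ≤ B + Real.log l := by
        have h4 := Real.one_sub_inv_le_log_of_pos hl
        have h5 : l⁻¹ ≤ B/2-1/4 := by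
          rw [inv_le_iff_one_le_mul₀ hl]; linarith
        have h6 : l⁻¹ - 1 ≤ (1-l)*(B/2-1/4) := by
          have : l⁻¹ - 1 = (1-l) * l⁻¹ := by field_simp
          rw [this]; gcongr
        nlinarith [mul_nonneg hB (mul_nonneg h1l h1l)]
      have := Real.exp_le_exp.2 h3
      rw [Real.exp_add B, Real.exp_log hl] at this
      have : 0 ≤ 2*Real.exp 5*(1-l) := by positivity
      linarith
    · have h3 : B*l*(1+(1-l)/2) + (1-l)/4 ≤ 5 := by nlinarith
      have h4 : Real.exp (B*l*(1+(1-l)/2) + (1-l)/4) ≤ Real.exp 5 := Real.exp_le_exp.2 h3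
      have h5 : l ≤ 1/2 := by nlinarith
      have : 0 ≤ l * Real.exp B := by positivity
      nlinarith [Real.exp_pos 5]

lemma cww_step (α x s d : ℝ) (hα : 1/2 ≤ α) (hα1 : α ≤ 1) (hs : 0 ≤ s) (h0 : s = 0 → x = 0) :
    cwwU α (x+d) (s+d^2) + cwwU α (x-d) (s+d^2) ≤
      2 * cwwU α x s + 2 * (4*Real.exp 5 * ((s+d^2)^α - s^α)) := by
  rcases eq_or_ne d 0 with rfl | hd
  · simp [cwwU]; linarith
  have hd2 : 0 < d^2 := by positivity
  rcases hs.eq_or_lt with hs0 | hs0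
  · have hx := h0 hs0.symm
    subst hx; subst hs0
    have e : d^2/(4*d^2) = 1/4 := by field_simp
    simp only [cwwU, zero_add, zero_sub, neg_sq, e]
    rw [Real.zero_rpow (by linarith)]
    have : Real.exp (1/4) ≤ Real.exp 5 := Real.exp_le_exp.2 (by norm_num)
    have h3 : 0 ≤ (d^2)^α := by positivity
    nlinarith [mul_le_mul_of_nonneg_left this h3, mul_nonneg h3 (Real.exp_pos 5).le]
  · set s' := s + d^2 with hs'
    have hs'0 : 0 < s' := by positivity
    set l := s/s' with hl
    have hl0 : 0 < l := by positivity
    have hl1 : l ≤ 1 := by rw [hl, div_le_one hs'0]; linarith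
    set B := x^2/(4*s) with hB
    have hB0 : 0 ≤ B := by positivity
    have hsc := cww_scalar B l hB0 hl0 hl1
    have e1 : Real.exp ((x+d)^2/(4*s')) + Real.exp ((x-d)^2/(4*s')) =
       2 * (Real.exp ((x^2+d^2)/(4*s')) * Real.cosh (x*d/(2*s'))) := by
      rw [Real.cosh_eq, show (x+d)^2/(4*s') = (x^2+d^2)/(4*s') + x*d/(2*s') by field_simp; ring,
        show (x-d)^2/(4*s') = (x^2+d^2)/(4*s') + -(x*d/(2*s')) by field_simp; ring, Real.exp_add, Real.exp_add]
      ring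
    have e2 : (x^2+d^2)/(4*s') + (x*d/(2*s'))^2/2 = B*l*(1+(1-l)/2) + (1-l)/4 := by
      have : d^2 = s' - s := by rw [hs']; ring
      rw [hB, hl, div_pow, mul_pow, this]; field_simp; ring
    have e3 : Real.exp ((x+d)^2/(4*s')) + Real.exp ((x-d)^2/(4*s')) ≤
        2 * (l * Real.exp B + 2*Real.exp 5*(1-l)) := by
      rw [e1]
      refine mul_le_mul_of_nonneg_left (le_trans ?_ hsc) (by norm_num)
      rw [← e2, Real.exp_add]
      gcongr
      exact Real.cosh_le_exp_half_sq _
    have hsl : s = s' * l := by rw [hl]; field_simp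
    have e4 : s^α = s'^α * l^α := by rw [hsl, Real.mul_rpow hs'0.le hl0.le]
    have hP : 0 < s'^α := by positivity
    have e5 : l ≤ l^α := by
      have := Real.rpow_le_rpow_of_exponent_ge hl0 hl1 hα1
      rwa [Real.rpow_one] at this
    have e6 : l^α ≤ (1+l)/2 := by
      have h := Real.rpow_le_rpow_of_exponent_ge hl0 hl1 hα
      rw [← Real.sqrt_eq_rpow] at h
      have : Real.sqrt l ≤ (1+l)/2 := by
        rw [Real.sqrt_le_left (by linarith)]; nlinarith [sq_nonneg (1-l)]
      linarith
    unfold cwwU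
    rw [← mul_add]
    calc s'^α * _ ≤ s'^α * (2 * (l * Real.exp B + 2*Real.exp 5*(1-l))) := by gcongr
      _ ≤ s'^α * (2 * (l^α * Real.exp B + 4*Real.exp 5*(1-l^α))) := by
        gcongr ?_ * (2 * ?_)
        refine add_le_add (by gcongr) ?_
        nlinarith [Real.exp_pos 5]
      _ = _ := by rw [e4]; ring

/-- Martingale transform with increments `±δ`. -/
def trX (δ : ℕ → ℤ → ℝ) : ℕ → ℤ → ℝ
  | 0, _ => 0
  | k+1, m => trX δ k (m/2) + (if m % 2 = 0 then δ k (m/2) else - δ k (m/2))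

/-- Its square function. -/
def trS (δ : ℕ → ℤ → ℝ) : ℕ → ℤ → ℝ
  | 0, _ => 0
  | k+1, m => trS δ k (m/2) + δ k (m/2) ^ 2

lemma trS_nonneg (δ : ℕ → ℤ → ℝ) (k m) : 0 ≤ trS δ k m ∧ (trS δ k m = 0 → trX δ k m = 0) := by
  induction k generalizing m with
  | zero => simp [trS, trX]
  | succ k ih =>
    obtain ⟨i1, i2⟩ := ih (m/2)
    simp only [trS, trX]
    refine ⟨by positivity, fun h => ?_⟩
    have h1 : δ k (m/2) = 0 := by nlinarith [sq_nonneg (δ k (m/2))]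
    have h2 : trS δ k (m/2) = 0 := by nlinarith [sq_nonneg (δ k (m/2))]
    rw [i2 h2, h1]; simp

lemma cwwU_nonneg (α x s : ℝ) (hs : 0 ≤ s) : 0 ≤ cwwU α x s := by unfold cwwU; positivity

lemma cww_lintegral (α : ℝ) (hα : 1/2 ≤ α) (hα1 : α ≤ 1) (δ : ℕ → ℤ → ℝ) (N : ℕ) (r : ℝ) (hr : 0 < r) :
    ∫⁻ x : ℝ, ENNReal.ofReal (cwwU α (trX δ N ⌊x / r⌋) (trS δ N ⌊x / r⌋)) ≤
      ∫⁻ x : ℝ, ENNReal.ofReal (4 * Real.exp 5 * trS δ N ⌊x / r⌋ ^ α) := by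
  refine lintegral_tree_le (fun k m => cwwU α (trX δ k m) (trS δ k m))
    (fun k m => 4 * Real.exp 5 * trS δ k m ^ α) (fun k m => cwwU_nonneg _ _ _ (trS_nonneg δ k m).1) ?_ ?_ ?_ N r hr
  · intro k m
    have := (trS_nonneg δ k m).1
    positivity
  · intro m
    simp only [trS, trX, cwwU]
    rw [Real.zero_rpow (by linarith)]; simp
  · intro k m
    have := cww_step α (trX δ k m) (trS δ k m) (δ k m) hα hα1 (trS_nonneg δ k m).1 (trS_nonneg δ k m).2
    simp only [trS, trX, two_mul_ediv_two, two_mul_add_one_ediv_two]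
    have e1 : (2*m) % 2 = 0 := by omega
    have e2 : ¬ (2*m+1) % 2 = 0 := by omega
    rw [if_pos e1, if_neg e2, ← sub_eq_add_neg]
    linarith

lemma cww_pointwise (p L X S Γ : ℝ) (hp : 1 < p) (hp2 : p ≤ 2) (hL : 0 ≤ L) (hS : 0 ≤ S) (h0 : S = 0 → X = 0)
    (hSΓ : S ≤ Γ) :
    |X|^p ≤ (8*L*Γ)^(p/2) + 8 * Real.exp (-L) * cwwU (p/2) X S := by
  have hΓ : 0 ≤ Γ := hS.trans hSΓ
  have hX : |X|^p = (X^2)^(p/2) := by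
    rw [← sq_abs, ← Real.rpow_natCast, ← Real.rpow_mul (abs_nonneg _)]; congr 1; push_cast; ring
  rw [hX]
  rcases le_or_gt (X^2) (8*L*Γ) with h | h
  · have : (X^2)^(p/2) ≤ (8*L*Γ)^(p/2) := by gcongr
    have := cwwU_nonneg (p/2) X S hS
    have : 0 ≤ 8 * Real.exp (-L) * cwwU (p/2) X S := by positivity
    linarith
  · have hS0 : 0 < S := by
      rcases hS.eq_or_lt with h1 | h1
      · have := h0 h1.symm
        rw [this] at h
        have : 0 ≤ 8*L*Γ := by positivity
        norm_num at h; linarith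
      · exact h1
    set z := X^2/S with hz
    have hXz : X^2 = S * z := by rw [hz]; field_simp
    have hz0 : 0 ≤ z := by positivity
    have hzL : 8*L ≤ z := by
      rw [hz, le_div_iff₀ hS0]
      have : 8*L*S ≤ 8*L*Γ := by gcongr
      linarith
    have h1 : z^(p/2) ≤ 1 + z := by
      rcases le_total z 1 with h | h
      · have := Real.rpow_le_one hz0 h (by linarith : 0 ≤ p/2); linarith
      · have := Real.rpow_le_rpow_of_exponent_le h (by linarith : p/2 ≤ 1)
        rw [Real.rpow_one] at this; linarith
    have h2 : 1 + z ≤ 8 * Real.exp (z/8) := by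
      have := Real.add_one_le_exp (z/8); linarith
    have h3 : Real.exp (z/8) ≤ Real.exp (-L) * Real.exp (X^2/(4*S)) := by
      rw [← Real.exp_add]; apply Real.exp_le_exp.2
      have : X^2/(4*S) = z/4 := by rw [hz]; field_simp
      rw [this]; linarith
    have h4 : 0 ≤ (8*L*Γ)^(p/2) := by positivity
    have h5 : 0 ≤ S^(p/2) := by positivity
    have hm : (X^2)^(p/2) = S^(p/2) * z^(p/2) := by rw [hXz, Real.mul_rpow hS hz0]
    rw [hm]
    unfold cwwU
    calc S^(p/2) * z^(p/2) ≤ S^(p/2) * (8 * (Real.exp (-L) * Real.exp (X^2/(4*S)))) := by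
          gcongr; linarith
      _ = 8 * Real.exp (-L) * (S^(p/2) * Real.exp (X^2/(4*S))) := by ring
      _ ≤ _ := by linarith

lemma measurable_floor_comp {β : Type*} [MeasurableSpace β] (r : ℝ) (φ : ℤ → β) : Measurable fun x : ℝ => φ ⌊x/r⌋ :=
  (measurable_of_countable φ).comp (Int.measurable_floor.comp (measurable_id.div_const r))

/-- Chang–Wilson–Wolff maximal estimate for finitely many dyadic martingales. -/
lemma cww_max {ν : Type*} [Fintype ν] [Nonempty ν] (p : ℝ) (hp : 1 < p) (hp2 : p ≤ 2)
    (δ : ν → ℕ → ℤ → ℝ) (N : ℕ) (Γ : ℤ → ℝ)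
    (hΓ : ∀ u m, trS (δ u) N m ≤ Γ m) (r : ℝ) (hr : 0 < r) :
    ∫⁻ x : ℝ, ⨆ u, ENNReal.ofReal (|trX (δ u) N ⌊x / r⌋| ^ p) ≤
      ENNReal.ofReal (72 * Real.exp 5 * Real.log (1 + Fintype.card ν) ^ (p/2)) *
        ∫⁻ x : ℝ, ENNReal.ofReal (Γ ⌊x / r⌋ ^ (p/2)) := by
  set n : ℝ := (Fintype.card ν : ℝ) with hn
  have hn1 : 1 ≤ n := by
    rw [hn]; exact_mod_cast Fintype.card_pos
  set L := Real.log (1+n) with hL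
  have hL2 : 1/2 ≤ L := by
    have : Real.log 2 ≤ L := Real.log_le_log (by norm_num) (by linarith)
    have := Real.log_two_gt_d9
    linarith
  have heL : Real.exp (-L) = 1/(1+n) := by
    rw [Real.exp_neg, Real.exp_log (by linarith)]; simp
  have hΓ0 : ∀ m, 0 ≤ Γ m := fun m => (trS_nonneg _ N m).1.trans (hΓ (Classical.arbitrary ν) m)
  have hpt : ∀ u m, ENNReal.ofReal (|trX (δ u) N m| ^ p) ≤ ENNReal.ofReal ((8*L*Γ m)^(p/2)) +
      ENNReal.ofReal (8 * Real.exp (-L)) * ENNReal.ofReal (cwwU (p/2) (trX (δ u) N m) (trS (δ u) N m)) := by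
    intro u m
    have hs := trS_nonneg (δ u) N m
    have h := cww_pointwise p L (trX (δ u) N m) (trS (δ u) N m) (Γ m) hp hp2 (by linarith) hs.1 hs.2 (hΓ u m)
    rw [← ENNReal.ofReal_mul (by positivity), ← ENNReal.ofReal_add]
    · exact ENNReal.ofReal_le_ofReal h
    · have := hΓ0 m; positivity
    · have := cwwU_nonneg (p/2) (trX (δ u) N m) _ hs.1; positivity
  have hsum : ∀ m, ⨆ u, ENNReal.ofReal (|trX (δ u) N m| ^ p) ≤ ENNReal.ofReal ((8*L*Γ m)^(p/2)) +
      ENNReal.ofReal (8 * Real.exp (-L)) * ∑ u, ENNReal.ofReal (cwwU (p/2) (trX (δ u) N m) (trS (δ u) N m)) := by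
    intro m
    refine iSup_le fun u => (hpt u m).trans ?_
    gcongr
    exact Finset.single_le_sum (f := fun u => ENNReal.ofReal (cwwU (p/2) (trX (δ u) N m) (trS (δ u) N m)))
      (fun _ _ => by simp) (Finset.mem_univ u)
  set I := ∫⁻ x : ℝ, ENNReal.ofReal (Γ ⌊x / r⌋ ^ (p/2)) with hI
  have hone : ∀ u, ∫⁻ x : ℝ, ENNReal.ofReal (cwwU (p/2) (trX (δ u) N ⌊x / r⌋) (trS (δ u) N ⌊x / r⌋)) ≤
      ENNReal.ofReal (4 * Real.exp 5) * I := by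
    intro u
    refine (cww_lintegral (p/2) (by linarith) (by linarith) (δ u) N r hr).trans ?_
    rw [hI, ← lintegral_const_mul' _ _ ENNReal.ofReal_ne_top]
    refine lintegral_mono fun x => ?_
    rw [← ENNReal.ofReal_mul (by positivity)]
    apply ENNReal.ofReal_le_ofReal
    have := (trS_nonneg (δ u) N ⌊x/r⌋).1
    gcongr
    exact hΓ u _
  calc _ ≤ ∫⁻ x : ℝ, (ENNReal.ofReal ((8*L*Γ ⌊x/r⌋)^(p/2)) +
      ENNReal.ofReal (8 * Real.exp (-L)) * ∑ u, ENNReal.ofReal (cwwU (p/2) (trX (δ u) N ⌊x/r⌋) (trS (δ u) N ⌊x/r⌋))) :=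
        lintegral_mono fun x => hsum _
    _ = ENNReal.ofReal ((8*L)^(p/2)) * I + ENNReal.ofReal (8 * Real.exp (-L)) *
        ∑ u, ∫⁻ x : ℝ, ENNReal.ofReal (cwwU (p/2) (trX (δ u) N ⌊x/r⌋) (trS (δ u) N ⌊x/r⌋)) := by
      rw [lintegral_add_left (measurable_floor_comp r fun m => ENNReal.ofReal ((8*L*Γ m)^(p/2)))]
      congr 1
      · rw [hI, ← lintegral_const_mul' _ _ ENNReal.ofReal_ne_top]
        refine lintegral_congr fun x => ?_
        rw [← ENNReal.ofReal_mul (by positivity), ← Real.mul_rpow (by positivity) (hΓ0 _)]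
      · rw [lintegral_const_mul' _ _ ENNReal.ofReal_ne_top, lintegral_finsetSum]
        intro u _
        exact measurable_floor_comp r fun m => ENNReal.ofReal (cwwU (p/2) (trX (δ u) N m) (trS (δ u) N m))
    _ ≤ ENNReal.ofReal ((8*L)^(p/2)) * I + ENNReal.ofReal (8 * Real.exp (-L)) *
        ∑ u : ν, ENNReal.ofReal (4 * Real.exp 5) * I := by
      gcongr with u
      exact hone u
    _ = ENNReal.ofReal ((8*L)^(p/2) + 8 * Real.exp (-L) * (n * (4 * Real.exp 5))) * I := by
      rw [Finset.sum_const, Finset.card_univ, nsmul_eq_mul, ENNReal.ofReal_add (by positivity) (by positivity),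
        ENNReal.ofReal_mul (p := 8 * Real.exp (-L)) (by positivity), ENNReal.ofReal_mul (p := n) (by positivity), hn, ENNReal.ofReal_natCast]
      ring
    _ ≤ _ := by
      gcongr
      rw [heL]
      have h1 : (8*L)^(p/2) ≤ 8 * L^(p/2) := by
        rw [Real.mul_rpow (by norm_num) (by linarith)]
        gcongr
        have := Real.rpow_le_rpow_of_exponent_le (by norm_num : (1:ℝ) ≤ 8) (by linarith : p/2 ≤ 1)
        rwa [Real.rpow_one] at this
      have h2 : 1/2 ≤ L^(p/2) := by
        have a1 : (1/2:ℝ)^(p/2) ≤ L^(p/2) := by gcongr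
        have a2 := Real.rpow_le_rpow_of_exponent_ge (by norm_num : (0:ℝ) < 1/2) (by norm_num) (by linarith : p/2 ≤ 1)
        rw [Real.rpow_one] at a2
        linarith
      have h3 : 8 * (1/(1+n)) * (n * (4 * Real.exp 5)) ≤ 32 * Real.exp 5 := by
        have : 1/(1+n) * n ≤ 1 := by
          rw [one_div, inv_mul_le_iff₀ (by linarith)]; linarith
        nlinarith [Real.exp_pos 5]
      have h4 : 1 ≤ Real.exp 5 := Real.one_le_exp (by norm_num)
      nlinarith [mul_le_mul h4 h2 (by norm_num) (by positivity)]

/-- Average over `[a, a+h]`. -/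
def avgI (g : ℝ → ℝ) (a h : ℝ) : ℝ := h⁻¹ * ∫ x in a..a+h, g x

/-- The twice iterated average at scale `r`. -/
def Lam (r : ℝ) (g : ℝ → ℝ) (x : ℝ) : ℝ := avgI (fun a => avgI g a r) (x - r) r

/-- Averages over the cells of a translated dyadic grid. -/
def cellAvg (l t : ℝ) (g : ℝ → ℝ) (k : ℕ) (m : ℤ) : ℝ := avgI g (t + l/2^k*m) (l/2^k)

/-- Conditional expectation on a translated dyadic grid. -/
def EE (l : ℝ) (k : ℕ) (g : ℝ → ℝ) (x t : ℝ) : ℝ := cellAvg l t g k ⌊(x-t)/(l/2^k)⌋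

/-- Normalised Lebesgue measure on `(0, l]`. -/
def tauM (l : ℝ) : Measure ℝ := (ENNReal.ofReal l)⁻¹ • volume.restrict (Ioc 0 l)

lemma tauM_prob (l : ℝ) (hl : 0 < l) : IsProbabilityMeasure (tauM l) := by
  constructor
  simp only [tauM, Measure.smul_apply, Measure.restrict_apply MeasurableSet.univ, univ_inter, smul_eq_mul,
    Real.volume_Ioc, sub_zero]
  exact ENNReal.inv_mul_cancel (by simpa using hl) (by simp)

lemma continuous_avgI (g : ℝ → ℝ) (hg : Continuous g) (h : ℝ) : Continuous fun a => avgI g a h := by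
  have e : (fun a => avgI g a h) = fun a => h⁻¹ * ∫ x in (0:ℝ)..h, g (x + a) := by
    ext a; unfold avgI
    rw [intervalIntegral.integral_comp_add_right (fun x => g x) a, zero_add, add_comm h a]
  rw [e]
  refine continuous_const.mul (intervalIntegral.continuous_parametric_intervalIntegral_of_continuous' ?_ _ _)
  exact hg.comp (by fun_prop)

lemma avgI_split (g : ℝ → ℝ) (hg : Continuous g) (a h : ℝ) (hh : 0 < h) :
    avgI g a h + avgI g (a+h) h = 2 * avgI g a (2*h) := by
  unfold avgI
  have := intervalIntegral.integral_add_adjacent_intervals (μ := volume) (hg.intervalIntegrable a (a+h))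
    (hg.intervalIntegrable (a+h) (a+h+h))
  rw [show a + 2*h = a+h+h by ring, ← this]
  field_simp

lemma avgI_mono (f g : ℝ → ℝ) (hf : Continuous f) (hg : Continuous g) (a h : ℝ) (hh : 0 < h) (hfg : ∀ x, f x ≤ g x) :
    avgI f a h ≤ avgI g a h := by
  unfold avgI
  gcongr
  exact intervalIntegral.integral_mono (by linarith) (hf.intervalIntegrable _ _) (hg.intervalIntegrable _ _) hfg

lemma avgI_nonneg (f : ℝ → ℝ) (a h : ℝ) (hh : 0 < h) (hf : ∀ x, 0 ≤ f x) :
    0 ≤ avgI f a h := by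
  unfold avgI
  have := intervalIntegral.integral_nonneg_of_forall (μ := volume) (by linarith : a ≤ a+h) hf
  positivity

lemma abs_avgI_le (f : ℝ → ℝ) (a h : ℝ) (hh : 0 < h) : |avgI f a h| ≤ avgI (fun x => |f x|) a h := by
  unfold avgI
  rw [abs_mul, abs_of_pos (by positivity : 0 < h⁻¹)]
  gcongr
  exact intervalIntegral.abs_integral_le_integral_abs (by linarith)

lemma cellAvg_mart (l t : ℝ) (hl : 0 < l) (g : ℝ → ℝ) (hg : Continuous g) (k : ℕ) (m : ℤ) :
    cellAvg l t g (k+1) (2*m) + cellAvg l t g (k+1) (2*m+1) = 2 * cellAvg l t g k m := by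
  have := avgI_split g hg (t + l/2^k*m) (l/2^(k+1)) (by positivity)
  unfold cellAvg
  convert this using 3 <;> push_cast <;> rw [pow_succ] <;> field_simp <;> try ring

lemma cidx_half (l y : ℝ) (k : ℕ) : ⌊y/(l/2^(k+1))⌋ / 2 = ⌊y/(l/2^k)⌋ := by
  have := Int.floor_div_natCast (y/(l/2^(k+1))) 2
  push_cast at this
  rw [← this]; congr 1
  rw [pow_succ]
  rcases eq_or_ne l 0 with rfl | h
  · simp
  · field_simp

lemma measurable_EE2 (l : ℝ) (k : ℕ) (g : ℝ → ℝ) (hg : Continuous g) :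
    Measurable fun z : ℝ × ℝ => EE l k g z.1 z.2 := by
  unfold EE cellAvg
  refine (continuous_avgI g hg _).measurable.comp ?_
  have h1 : Measurable fun z : ℝ × ℝ => ⌊(z.1 - z.2)/(l/2^k)⌋ :=
    Int.measurable_floor.comp ((measurable_fst.sub measurable_snd).div_const _)
  have h2 : Measurable fun z : ℝ × ℝ => ((⌊(z.1 - z.2)/(l/2^k)⌋ : ℤ):ℝ) :=
    (measurable_of_countable (fun m : ℤ => (m:ℝ))).comp h1
  exact measurable_snd.add (h2.const_mul _)

lemma cell_mem (t r x : ℝ) (hr : 0 < r) :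
    t + r*⌊(x-t)/r⌋ ≤ x ∧ x ≤ t + r*⌊(x-t)/r⌋ + r := by
  have h1 := Int.floor_le ((x-t)/r)
  have h2 := (Int.lt_floor_add_one ((x-t)/r)).le
  rw [le_div_iff₀ hr] at h1
  rw [div_le_iff₀ hr] at h2
  constructor <;> nlinarith

lemma EE_bounded (l : ℝ) (hl : 0 < l) (k : ℕ) (g : ℝ → ℝ) (hg : Continuous g) (x : ℝ) :
    ∃ C, ∀ t, |EE l k g x t| ≤ C := by
  obtain ⟨C, hC⟩ := (isCompact_Icc (a := x - l/2^k) (b := x)).exists_bound_of_continuousOn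
    (continuous_avgI g hg (l/2^k)).continuousOn
  refine ⟨C, fun t => hC _ ?_⟩
  have := cell_mem t (l/2^k) x (by positivity)
  exact ⟨by linarith, this.1⟩

lemma integrable_EE (l : ℝ) (hl : 0 < l) (k : ℕ) (g : ℝ → ℝ) (hg : Continuous g) (x : ℝ) :
    Integrable (EE l k g x) (tauM l) := by
  have := tauM_prob l hl
  obtain ⟨C, hC⟩ := EE_bounded l hl k g hg x
  refine Integrable.of_bound (C := C) ?_ (ae_of_all _ hC)
  exact ((measurable_EE2 l k g hg).comp (measurable_const.prodMk measurable_id : Measurable fun t : ℝ => (x, t))).aestronglyMeasurable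

/-- Averaging the conditional expectations over translations of the grid. -/
lemma integral_EE (l : ℝ) (hl : 0 < l) (k : ℕ) (g : ℝ → ℝ) (hg : Continuous g) (x : ℝ) :
    ∫ t, EE l k g x t ∂tauM l = Lam (l/2^k) g x := by
  set r := l/2^k with hr
  have hr0 : 0 < r := by positivity
  have hper : Function.Periodic (EE l k g x) r := by
    intro t
    unfold EE cellAvg
    rw [← hr, show (x - (t+r))/r = (x-t)/r - 1 by field_simp; ring, Int.floor_sub_one]
    push_cast; congr 1; ring
  have hint : ∀ a b, IntervalIntegrable (EE l k g x) volume a b := by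
    intro a b
    obtain ⟨C, hC⟩ := EE_bounded l hl k g hg x
    rw [intervalIntegrable_iff]
    refine Measure.integrableOn_of_bounded (M := C) (by simp) ?_ (ae_of_all _ hC)
    exact ((measurable_EE2 l k g hg).comp (measurable_const.prodMk measurable_id : Measurable fun t : ℝ => (x, t))).aestronglyMeasurable
  have h1 := hper.intervalIntegral_add_zsmul_eq (2^k) 0 hint
  have h2 := hper.intervalIntegral_add_eq 0 (x-r)
  have h3 : ∫ t in (x-r)..(x-r+r), EE l k g x t = ∫ t in (x-r)..(x-r+r), avgI g t r := by
    rw [intervalIntegral.integral_of_le (by linarith), intervalIntegral.integral_of_le (by linarith)]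
    refine setIntegral_congr_fun measurableSet_Ioc fun t ht => ?_
    have : ⌊(x-t)/r⌋ = 0 := by
      rw [Int.floor_eq_zero_iff]
      constructor
      · apply div_nonneg _ hr0.le; linarith [ht.2]
      · rw [div_lt_one hr0]; linarith [ht.1]
    unfold EE cellAvg
    simp only [← hr, this]; simp
  unfold tauM Lam
  rw [integral_smul_measure, ← intervalIntegral.integral_of_le hl.le]
  have e : (0:ℝ) + (2^k:ℤ) • r = l := by rw [zsmul_eq_mul, hr]; push_cast; field_simp; ring
  rw [e, h2, h3] at h1
  rw [h1]
  unfold avgI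
  rw [ENNReal.toReal_inv, ENNReal.toReal_ofReal hl.le, zsmul_eq_mul, smul_eq_mul, ← mul_assoc]
  congr 1
  rw [hr]; push_cast; field_simp

/-- Jensen's inequality for powers on a probability space. -/
lemma lintegral_rpow_le_of_prob {Ω : Type*} [MeasurableSpace Ω] (μ : Measure Ω) [IsProbabilityMeasure μ] (p : ℝ) (hp : 1 ≤ p)
    (f : Ω → ℝ≥0∞) (hf : AEMeasurable f μ) : (∫⁻ t, f t ∂μ) ^ p ≤ ∫⁻ t, f t ^ p ∂μ := by
  have hp0 : 0 < p := by linarith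
  rcases hp.eq_or_lt with h | h
  · rw [← h]; simp
  · have := ENNReal.lintegral_mul_le_Lp_mul_Lq μ (Real.HolderConjugate.conjExponent h) hf (g := fun _ => 1) aemeasurable_const
    simp only [Pi.mul_apply, mul_one, ENNReal.one_rpow, lintegral_const, measure_univ, Real.conjExponent] at this
    calc _ ≤ ((∫⁻ t, f t ^ p ∂μ)^(1/p))^p := by gcongr
      _ = _ := by rw [← ENNReal.rpow_mul]; field_simp; simp

/-- Minkowski's inequality in `ℓ²`. -/
lemma sqrt_sum_lintegral_le {Ω κ : Type*} [MeasurableSpace Ω] (μ : Measure Ω) (s : Finset κ)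
    (Z : κ → Ω → ℝ≥0∞) (hZ : ∀ i, AEMeasurable (Z i) μ) :
    (∑ i ∈ s, (∫⁻ t, Z i t ∂μ)^2)^(1/2:ℝ) ≤ ∫⁻ t, (∑ i ∈ s, (Z i t)^2)^(1/2:ℝ) ∂μ := by
  set a := fun i => ∫⁻ t, Z i t ∂μ with ha
  set A := (∑ i ∈ s, (a i)^2)^(1/2:ℝ) with hA
  have hone : ∀ i ∈ s, a i ≤ ∫⁻ t, (∑ i ∈ s, (Z i t)^2)^(1/2:ℝ) ∂μ := by
    intro i hi
    refine lintegral_mono fun t => ?_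
    have : Z i t = ((Z i t)^2)^(1/2:ℝ) := by
      rw [← ENNReal.rpow_natCast, ← ENNReal.rpow_mul]; norm_num
    rw [this]
    gcongr
    exact Finset.single_le_sum (f := fun i => (Z i t)^2) (fun _ _ => by simp) hi
  by_cases htop : ∃ i ∈ s, a i = ⊤
  · obtain ⟨i, hi, h⟩ := htop
    have := hone i hi
    rw [h, top_le_iff] at this
    rw [this]; exact le_top
  push Not at htop
  have hA2 : A * A = ∑ i ∈ s, (a i)^2 := by
    rw [hA, ← ENNReal.rpow_add_of_nonneg _ _ (by norm_num) (by norm_num)]; norm_num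
  have hAtop : A ≠ ⊤ := by
    rw [hA]; refine ENNReal.rpow_ne_top_of_nonneg (by norm_num) ?_
    rw [ENNReal.sum_ne_top]
    exact fun i hi => ENNReal.pow_ne_top (htop i hi)
  rcases eq_or_ne A 0 with h0 | h0
  · change A ≤ _
    rw [h0]; simp
  have hcs : ∀ t, ∑ i ∈ s, a i * Z i t ≤ A * (∑ i ∈ s, (Z i t)^2)^(1/2:ℝ) := by
    intro t
    have := ENNReal.inner_le_Lp_mul_Lq s a (fun i => Z i t) (p := 2) (q := 2) (by rw [Real.holderConjugate_iff]; norm_num)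
    simpa [hA] using this
  have h1 : A * A ≤ A * ∫⁻ t, (∑ i ∈ s, (Z i t)^2)^(1/2:ℝ) ∂μ := by
    rw [hA2, ← lintegral_const_mul' _ _ hAtop]
    refine le_trans (le_of_eq ?_) (lintegral_mono hcs)
    rw [lintegral_finsetSum']
    · refine Finset.sum_congr rfl fun i hi => ?_
      rw [lintegral_const_mul' _ _ (htop i hi), sq]
    · exact fun i _ => (hZ i).const_mul _
  exact (ENNReal.mul_le_mul_iff_right h0 hAtop).1 h1

lemma sum_lintegral_rpow_le {Ω κ : Type*} [MeasurableSpace Ω] (μ : Measure Ω) [IsProbabilityMeasure μ] (s : Finset κ)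
    (Z : κ → Ω → ℝ≥0∞) (hZ : ∀ i, AEMeasurable (Z i) μ) (p : ℝ) (hp : 1 ≤ p) :
    (∑ i ∈ s, (∫⁻ t, Z i t ∂μ)^2)^(p/2) ≤ ∫⁻ t, (∑ i ∈ s, (Z i t)^2)^(p/2) ∂μ := by
  have e : ∀ x : ℝ≥0∞, x^(p/2) = (x^(1/2:ℝ))^p := by
    intro x; rw [← ENNReal.rpow_mul]; congr 1; ring
  simp only [e]
  refine le_trans ?_ (lintegral_rpow_le_of_prob μ p hp _ ?_)
  · have := sqrt_sum_lintegral_le μ s Z hZ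
    gcongr
  · exact (Finset.aemeasurable_fun_sum s fun i _ => (hZ i).pow_const 2).pow_const _

lemma measurable_cell {β : Type*} [MeasurableSpace β] (r : ℝ) (φ : ℝ → ℤ → β) (hφ : ∀ m, Measurable fun t => φ t m) :
    Measurable fun z : ℝ × ℝ => φ z.2 ⌊(z.1-z.2)/r⌋ := by
  have h1 : Measurable fun z : ℝ × ℤ => φ z.1 z.2 := measurable_from_prod_countable_left hφ
  exact h1.comp (measurable_snd.prodMk
    (Int.measurable_floor.comp ((measurable_fst.sub measurable_snd).div_const _)))

lemma measurable_cellAvg (l : ℝ) (g : ℝ → ℝ) (hg : Continuous g) (k : ℕ) (m : ℤ) :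
    Measurable fun t => cellAvg l t g k m :=
  (continuous_avgI g hg _).measurable.comp (measurable_id.add_const _)

lemma measurable_runMax (y : ℝ → ℕ → ℤ → ℝ) (hy : ∀ k m, Measurable fun t => y t k m) (k : ℕ) (m : ℤ) :
    Measurable fun t => runMax (y t) k m := by
  induction k generalizing m with
  | zero => exact hy 0 m
  | succ k ih => exact (ih _).max (hy _ _)

/-- Averaging an estimate over translated grids. -/
lemma transfer_le (l r : ℝ) (hl : 0 < l) (φ : ℝ → ℤ → ℝ≥0∞) (hφ : ∀ m, Measurable fun t => φ t m)
    (B : ℝ≥0∞) (h : ∀ t, ∫⁻ x, φ t ⌊(x-t)/r⌋ ≤ B) :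
    ∫⁻ x, ∫⁻ t, φ t ⌊(x-t)/r⌋ ∂tauM l ≤ B := by
  have := tauM_prob l hl
  rw [lintegral_lintegral_swap (measurable_cell r φ hφ).aemeasurable]
  calc _ ≤ ∫⁻ t, B ∂tauM l := lintegral_mono h
    _ = B := by simp

lemma lintegral_shift (t r : ℝ) (φ : ℤ → ℝ≥0∞) : ∫⁻ x, φ ⌊(x-t)/r⌋ = ∫⁻ x, φ ⌊x/r⌋ :=
  lintegral_sub_right_eq_self (fun x => φ ⌊x/r⌋) t

lemma EE_succ (l : ℝ) (k : ℕ) (g : ℝ → ℝ) (x t : ℝ) :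
    EE l k g x t = cellAvg l t g k (⌊(x-t)/(l/2^(k+1))⌋ / 2) := by
  rw [cidx_half]; rfl

lemma EE_le_runMax (l : ℝ) (g : ℝ → ℝ) (x t : ℝ) (N k : ℕ) (hk : k ≤ N) :
    EE l k g x t ≤ runMax (cellAvg l t g) N ⌊(x-t)/(l/2^N)⌋ := by
  induction N with
  | zero => obtain rfl : k = 0 := by omega
            exact le_rfl
  | succ N ih =>
    rcases Nat.lt_or_ge k (N+1) with h | h
    · refine (ih (by omega)).trans ?_
      rw [← cidx_half]; exact le_max_left _ _
    · obtain rfl : k = N+1 := by omega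
      exact le_runMax _ _ _

lemma sqF_cellAvg (l : ℝ) (g : ℝ → ℝ) (x t : ℝ) (N : ℕ) :
    sqF (fun _ : Unit => cellAvg l t g) N ⌊(x-t)/(l/2^N)⌋ =
      ∑ k ∈ Finset.range N, (EE l (k+1) g x t - EE l k g x t)^2 := by
  induction N with
  | zero => simp [sqF]
  | succ N ih =>
    rw [Finset.sum_range_succ, ← ih, sqF, cidx_half, EE_succ l N, cidx_half]
    simp [EE]

lemma tsum_cells (t r : ℝ) (hr : 0 < r) (f : ℝ → ℝ≥0∞) :
    ∑' m : ℤ, ∫⁻ x in Ioc (t + r*m) (t + r*m + r), f x = ∫⁻ x, f x := by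
  have h1 := iUnion_Ioc_add_zsmul hr t
  have h2 := pairwise_disjoint_Ioc_add_zsmul t r
  rw [← setLIntegral_univ f, ← h1, lintegral_iUnion (fun _ => measurableSet_Ioc) h2]
  refine tsum_congr fun m => ?_
  congr 3
  · simp [mul_comm]
  · simp; ring

/-- Jensen's inequality on an interval. -/
lemma ofReal_avgI_rpow_le (p : ℝ) (hp : 1 ≤ p) (g : ℝ → ℝ) (hg : Continuous g) (h0 : ∀ x, 0 ≤ g x) (a h : ℝ) (hh : 0 < h) :
    ENNReal.ofReal h * ENNReal.ofReal (avgI g a h ^ p) ≤ ∫⁻ x in Ioc a (a+h), ENNReal.ofReal (g x ^ p) := by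
  have hnn := avgI_nonneg g a h hh h0
  have e1 : ENNReal.ofReal (avgI g a h) = ∫⁻ x, ENNReal.ofReal (g x) ∂((ENNReal.ofReal h)⁻¹ • volume.restrict (Ioc a (a+h))) := by
    rw [lintegral_smul_measure, ← ofReal_integral_eq_lintegral_ofReal, avgI, ENNReal.ofReal_mul (by positivity),
      ENNReal.ofReal_inv_of_pos hh, intervalIntegral.integral_of_le (by linarith), smul_eq_mul]
    · exact (hg.intervalIntegrable a (a+h)).1
    · exact ae_of_all _ h0
  have hP : IsProbabilityMeasure ((ENNReal.ofReal h)⁻¹ • volume.restrict (Ioc a (a+h))) := by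
    constructor
    simp only [Measure.smul_apply, Measure.restrict_apply MeasurableSet.univ, univ_inter, smul_eq_mul,
      Real.volume_Ioc]
    rw [add_sub_cancel_left]
    exact ENNReal.inv_mul_cancel (by simpa using hh) (by simp)
  have := lintegral_rpow_le_of_prob (p := p) (hp := hp) (f := fun x => ENNReal.ofReal (g x)) (μ := (ENNReal.ofReal h)⁻¹ • volume.restrict (Ioc a (a+h)))
    hg.measurable.ennreal_ofReal.aemeasurable
  rw [← e1, lintegral_smul_measure, smul_eq_mul] at this
  rw [← ENNReal.ofReal_rpow_of_nonneg hnn (by linarith)]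
  simp only [ENNReal.ofReal_rpow_of_nonneg (h0 _) (by linarith : 0 ≤ p)] at this
  calc _ ≤ ENNReal.ofReal h * ((ENNReal.ofReal h)⁻¹ * ∫⁻ x in Ioc a (a+h), ENNReal.ofReal (g x ^ p)) := by gcongr
    _ = _ := by rw [← mul_assoc, ENNReal.mul_inv_cancel (by simpa using hh) (by simp), one_mul]

lemma lintegral_cellAvg_rpow_le (p : ℝ) (hp : 1 ≤ p) (g : ℝ → ℝ) (hg : Continuous g) (h0 : ∀ x, 0 ≤ g x) (l t : ℝ) (hl : 0 < l) (N : ℕ) :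
    ∫⁻ x : ℝ, ENNReal.ofReal (cellAvg l t g N ⌊x/(l/2^N)⌋ ^ p) ≤ ∫⁻ x, ENNReal.ofReal (g x ^ p) := by
  have hr : 0 < l/2^N := by positivity
  rw [lintegral_floor _ hr (fun m => ENNReal.ofReal (cellAvg l t g N m ^ p)), ← ENNReal.tsum_mul_left,
    ← tsum_cells t _ hr]
  exact ENNReal.tsum_le_tsum fun m => ofReal_avgI_rpow_le p hp g hg h0 _ _ hr

lemma lintegral_runMax_cellAvg_le (p : ℝ) (hp : 1 < p) (g : ℝ → ℝ) (hg : Continuous g) (h0 : ∀ x, 0 ≤ g x) (l t : ℝ) (hl : 0 < l) (N : ℕ) :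
    ∫⁻ x : ℝ, ENNReal.ofReal (runMax (cellAvg l t g) N ⌊x/(l/2^N)⌋ ^ p) ≤
      ENNReal.ofReal ((p/(p-1))^p) * ∫⁻ x, ENNReal.ofReal (g x ^ p) := by
  have hc : 0 ≤ (p/(p-1))^p := Real.rpow_nonneg (div_nonneg (by linarith) (by linarith)) _
  refine (doob_lintegral p hp (cellAvg l t g) (fun k m => avgI_nonneg g _ _ (by positivity) h0)
    (cellAvg_mart l t hl g hg) N _ (by positivity)).trans ?_
  simp only [ENNReal.ofReal_mul hc]
  rw [lintegral_const_mul' _ _ ENNReal.ofReal_ne_top]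
  exact mul_le_mul le_rfl (lintegral_cellAvg_rpow_le p hp.le g hg h0 l t hl N) (by simp) (by simp)

lemma ofReal_sq_rpow (s : Finset ℕ) (d : ℕ → ℝ) (p : ℝ) (hp : 0 ≤ p) :
    (∑ k ∈ s, ENNReal.ofReal |d k| ^ 2) ^ p = ENNReal.ofReal ((∑ k ∈ s, d k ^ 2) ^ p) := by
  rw [← ENNReal.ofReal_rpow_of_nonneg (Finset.sum_nonneg fun _ _ => sq_nonneg _) hp,
    ENNReal.ofReal_sum_of_nonneg (fun _ _ => sq_nonneg _)]
  congr 2; ext k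
  rw [← ENNReal.ofReal_pow (abs_nonneg _), sq_abs]

/-- Square function estimate for differences of averages. -/
lemma square_Lam (p : ℝ) (hp : 1 < p) (hp2 : p ≤ 2) (l : ℝ) (hl : 0 < l) (N : ℕ) (f : ℝ → ℝ) (hf : Continuous f) :
    ∫⁻ x, (∑ k ∈ Finset.range N, ENNReal.ofReal |Lam (l/2^(k+1)) f x - Lam (l/2^k) f x|^2)^(p/2) ≤
      4 * (ENNReal.ofReal ((p/(p-1))^p) * ∫⁻ x, ENNReal.ofReal (|f x| ^ p)) := by
  have hτ := tauM_prob l hl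
  have h1 : ∀ x, (∑ k ∈ Finset.range N, ENNReal.ofReal |Lam (l/2^(k+1)) f x - Lam (l/2^k) f x|^2)^(p/2) ≤
      ∫⁻ t, ENNReal.ofReal (sqF (fun _ : Unit => cellAvg l t f) N ⌊(x-t)/(l/2^N)⌋ ^ (p/2)) ∂tauM l := by
    intro x
    have hm : ∀ k, AEMeasurable (fun t => ENNReal.ofReal |EE l (k+1) f x t - EE l k f x t|) (tauM l) := fun k =>
      ((integrable_EE l hl (k+1) f hf x).sub (integrable_EE l hl k f hf x)).abs.aestronglyMeasurable.aemeasurable.ennreal_ofReal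
    have := sum_lintegral_rpow_le (tauM l) (Finset.range N) (fun k t => ENNReal.ofReal |EE l (k+1) f x t - EE l k f x t|)
      hm p hp.le
    refine le_trans ?_ (this.trans (le_of_eq ?_))
    · gcongr with k hk
      rw [← integral_EE l hl (k+1) f hf x, ← integral_EE l hl k f hf x,
        ← integral_sub (integrable_EE l hl (k+1) f hf x) (integrable_EE l hl k f hf x)]
      rw [← Real.norm_eq_abs, ofReal_norm]
      refine (enorm_integral_le_lintegral_enorm _).trans (le_of_eq ?_)
      congr 1; ext t
      rw [← Real.norm_eq_abs, ofReal_norm]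
    · congr 1; ext t
      rw [ofReal_sq_rpow _ _ _ (by linarith), sqF_cellAvg]
  refine (lintegral_mono h1).trans ?_
  refine transfer_le l (l/2^N) hl (fun t m => ENNReal.ofReal (sqF (fun _ : Unit => cellAvg l t f) N m ^ (p/2))) ?_ _ ?_
  · intro m
    refine Measurable.ennreal_ofReal (Measurable.pow_const ?_ _)
    have : ∀ k m, Measurable fun t => sqF (fun _ : Unit => cellAvg l t f) k m := by
      intro k
      induction k with
      | zero => intro m; simp only [sqF]; fun_prop
      | succ k ih =>
        intro m; simp only [sqF]
        refine (ih _).add (Finset.measurable_fun_sum _ fun _ _ => Measurable.pow_const ?_ _)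
        exact (measurable_cellAvg l f hf _ _).sub (measurable_cellAvg l f hf _ _)
    exact this N m
  · intro t
    rw [lintegral_shift t (l/2^N) (fun m => ENNReal.ofReal (sqF (fun _ : Unit => cellAvg l t f) N m ^ (p/2)))]
    have H : DomMart (fun _ : Unit => cellAvg l t f) (cellAvg l t (fun x => |f x|)) := by
      refine ⟨fun _ => cellAvg_mart l t hl f hf, cellAvg_mart l t hl _ hf.abs, fun k m => avgI_nonneg _ _ _ (by positivity) (fun _ => abs_nonneg _), ?_⟩
      intro k m
      simp only [Finset.univ_unique, Finset.sum_const, Finset.card_singleton, one_smul]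
      exact sq_le_sq.2 (by
        exact (abs_avgI_le f _ _ (by positivity)).trans (le_abs_self _))
    refine (H.square_le p hp hp2 N _ (by positivity)).trans ?_
    exact mul_le_mul le_rfl (lintegral_runMax_cellAvg_le p hp _ hf.abs (fun _ => abs_nonneg _) l t hl N) (by simp) (by simp)

lemma sum_avgI_sq_le {ι : Type*} [Fintype ι] (h : ι → ℝ → ℝ) (hc : ∀ i, Continuous (h i)) (a r : ℝ) (hr : 0 < r) :
    ∑ i, avgI (h i) a r ^ 2 ≤ avgI (fun x => √(∑ i, h i x ^ 2)) a r ^ 2 := by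
  set c := fun i => avgI (h i) a r with hcdef
  set A := √(∑ i, c i ^ 2) with hA
  have hHc : Continuous (fun x => √(∑ i, h i x ^ 2)) := by fun_prop
  have hHn := avgI_nonneg _ a r hr (fun x => Real.sqrt_nonneg (∑ i, h i x ^ 2))
  have hA2 : A^2 = ∑ i, c i ^ 2 := Real.sq_sqrt (Finset.sum_nonneg fun _ _ => sq_nonneg _)
  have h1 : ∑ i, c i ^ 2 = avgI (fun x => ∑ i, c i * h i x) a r := by
    unfold avgI
    rw [intervalIntegral.integral_finsetSum (fun i _ => ((hc i).const_mul _).intervalIntegrable _ _), Finset.mul_sum]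
    refine Finset.sum_congr rfl fun i _ => ?_
    rw [intervalIntegral.integral_const_mul, sq]
    simp only [hcdef, avgI]; ring
  have h2 : avgI (fun x => ∑ i, c i * h i x) a r ≤ avgI (fun x => A * √(∑ i, h i x ^ 2)) a r :=
    avgI_mono _ _ (by fun_prop) (by fun_prop) a r hr fun x =>
      Real.sum_mul_le_sqrt_mul_sqrt _ _ _
  have h3 : avgI (fun x => A * √(∑ i, h i x ^ 2)) a r = A * avgI (fun x => √(∑ i, h i x ^ 2)) a r := by
    unfold avgI; rw [intervalIntegral.integral_const_mul]; ring
  rw [h3] at h2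
  change ∑ i, c i ^ 2 ≤ _
  rw [← h1, ← hA2] at h2
  rw [← hA2]
  have hA0 : 0 ≤ A := Real.sqrt_nonneg _
  rcases hA0.eq_or_lt with h0 | h0
  · rw [← h0]; nlinarith
  · have : A ≤ avgI (fun x => √(∑ i, h i x ^ 2)) a r := by nlinarith
    nlinarith

/-- Chang–Wilson–Wolff estimate for sums of differences of averages. -/
lemma cww_Lam {ν : Type*} [Fintype ν] [Nonempty ν] (p : ℝ) (hp : 1 < p) (hp2 : p ≤ 2) (l : ℝ) (hl : 0 < l) (N : ℕ)
    (g : ν → ℕ → ℝ → ℝ) (hg : ∀ u k, Continuous (g u k)) (G : ℕ → ℝ → ℝ≥0∞)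
    (hG : ∀ u k a x, |a - x| ≤ l/2^k → ENNReal.ofReal |g u k a| ≤ G k x) :
    ∫⁻ x, ⨆ u, ENNReal.ofReal (|∑ k ∈ Finset.range N, (Lam (l/2^(k+1)) (g u k) x - Lam (l/2^k) (g u k) x)| ^ p) ≤
      ENNReal.ofReal (72 * Real.exp 5 * Real.log (1 + Fintype.card ν) ^ (p/2)) *
        ∫⁻ x, (∑ k ∈ Finset.range N, G k x ^ 2)^(p/2) := by
  have hτ := tauM_prob l hl
  set δ : ℝ → ν → ℕ → ℤ → ℝ := fun t u k m =>
    (cellAvg l t (g u k) (k+1) (2*m) - cellAvg l t (g u k) (k+1) (2*m+1))/2 with hδ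
  have htrX : ∀ u x t M, trX (δ t u) M ⌊(x-t)/(l/2^M)⌋ = ∑ k ∈ Finset.range M, (EE l (k+1) (g u k) x t - EE l k (g u k) x t) := by
    intro u x t M
    induction M with
    | zero => simp [trX]
    | succ M ih =>
      rw [Finset.sum_range_succ, ← ih, trX, cidx_half]
      congr 1
      rw [EE_succ l M, EE]
      have h := cellAvg_mart l t hl (g u M) (hg u M) M (⌊(x-t)/(l/2^(M+1))⌋ / 2)
      rw [← cidx_half l (x-t) M]
      set m := ⌊(x-t)/(l/2^(M+1))⌋
      simp only [hδ]
      split_ifs with h2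
      · have : 2 * (m/2) = m := by omega
        rw [this] at h ⊢; linarith
      · have : 2 * (m/2) + 1 = m := by omega
        rw [this] at h ⊢; linarith
  have htrS : ∀ u x t M, trS (δ t u) M ⌊(x-t)/(l/2^M)⌋ = ∑ k ∈ Finset.range M, δ t u k ⌊(x-t)/(l/2^k)⌋ ^ 2 := by
    intro u x t M
    induction M with
    | zero => simp [trS]
    | succ M ih => rw [Finset.sum_range_succ, ← ih, trS, cidx_half]
  have hδG : ∀ u x t k, ENNReal.ofReal |δ t u k ⌊(x-t)/(l/2^k)⌋| ≤ G k x := by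
    intro u x t k
    rcases eq_or_ne (G k x) ⊤ with h | h
    · rw [h]; exact le_top
    have hr : 0 < l/2^(k+1) := by positivity
    have hr2 : l/2^k = 2 * (l/2^(k+1)) := by rw [pow_succ]; field_simp
    have hcell := cell_mem t (l/2^k) x (by positivity)
    set m := ⌊(x-t)/(l/2^k)⌋
    have key : ∀ a, t + l/2^k*m ≤ a → a + l/2^(k+1) ≤ t + l/2^k*m+l/2^k → |avgI (g u k) a (l/2^(k+1))| ≤ (G k x).toReal := by
      intro a h1 h2
      have := intervalIntegral.norm_integral_le_of_norm_le_const (f := g u k) (a := a) (b := a + l/2^(k+1)) (C := (G k x).toReal) (by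
        intro y hy
        rw [uIoc_of_le (by linarith)] at hy
        rw [Real.norm_eq_abs, ← ENNReal.ofReal_le_iff_le_toReal h]
        refine hG u k y x ?_
        rw [abs_le]; constructor <;> linarith [hy.1, hy.2, hcell.1, hcell.2])
      rw [add_sub_cancel_left, abs_of_pos hr] at this
      unfold avgI
      rw [abs_mul, abs_of_pos (by positivity), inv_mul_le_iff₀ hr, mul_comm]
      exact this
    rw [ENNReal.ofReal_le_iff_le_toReal h]
    have k1 := key (t + l/2^(k+1)*((2*m:ℤ):ℝ)) (by push_cast; rw [hr2]; linarith) (by push_cast; rw [hr2]; linarith)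
    have k2 := key (t + l/2^(k+1)*((2*m+1:ℤ):ℝ)) (by push_cast; rw [hr2]; linarith) (by push_cast; rw [hr2]; linarith)
    simp only [hδ, cellAvg]
    rw [abs_le] at *
    constructor <;> linarith [k1.1, k1.2, k2.1, k2.2]
  have h1 : ∀ x, ⨆ u, ENNReal.ofReal (|∑ k ∈ Finset.range N, (Lam (l/2^(k+1)) (g u k) x - Lam (l/2^k) (g u k) x)| ^ p) ≤
      ∫⁻ t, ⨆ u, ENNReal.ofReal (|trX (δ t u) N ⌊(x-t)/(l/2^N)⌋| ^ p) ∂tauM l := by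
    intro x
    refine iSup_le fun u => ?_
    have hi : ∀ k, Integrable (fun t => EE l (k+1) (g u k) x t - EE l k (g u k) x t) (tauM l) := fun k =>
      (integrable_EE l hl (k+1) _ (hg u k) x).sub (integrable_EE l hl k _ (hg u k) x)
    have e : ∑ k ∈ Finset.range N, (Lam (l/2^(k+1)) (g u k) x - Lam (l/2^k) (g u k) x) =
        ∫ t, trX (δ t u) N ⌊(x-t)/(l/2^N)⌋ ∂tauM l := by
      simp only [htrX]
      rw [integral_finsetSum _ (fun k _ => hi k)]
      refine Finset.sum_congr rfl fun k _ => ?_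
      rw [integral_sub (integrable_EE l hl (k+1) _ (hg u k) x) (integrable_EE l hl k _ (hg u k) x), integral_EE l hl _ _ (hg u k), integral_EE l hl _ _ (hg u k)]
    have hi2 : Integrable (fun t => trX (δ t u) N ⌊(x-t)/(l/2^N)⌋) (tauM l) := by
      simp only [htrX]; exact integrable_finsetSum _ fun k _ => hi k
    rw [e, ← ENNReal.ofReal_rpow_of_nonneg (abs_nonneg _) (by linarith), ← Real.norm_eq_abs, ofReal_norm]
    calc _ ≤ (∫⁻ t, ‖trX (δ t u) N ⌊(x-t)/(l/2^N)⌋‖ₑ ∂tauM l)^p := by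
          gcongr; exact enorm_integral_le_lintegral_enorm _
      _ ≤ ∫⁻ t, ‖trX (δ t u) N ⌊(x-t)/(l/2^N)⌋‖ₑ ^ p ∂tauM l :=
          lintegral_rpow_le_of_prob _ p hp.le _ hi2.aestronglyMeasurable.enorm
      _ ≤ _ := by
          refine lintegral_mono fun t => ?_
          refine le_trans (le_of_eq ?_) (le_iSup _ u)
          rw [← ofReal_norm, Real.norm_eq_abs, ENNReal.ofReal_rpow_of_nonneg (abs_nonneg _) (by linarith)]
  refine (lintegral_mono h1).trans ?_
  have hmδ : ∀ u k m, Measurable fun t => δ t u k m := fun u k m =>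
    ((measurable_cellAvg l _ (hg u k) _ _).sub (measurable_cellAvg l _ (hg u k) _ _)).div_const _
  refine transfer_le l (l/2^N) hl (fun t m => ⨆ u, ENNReal.ofReal (|trX (δ t u) N m| ^ p)) ?_ _ ?_
  · intro m
    refine Measurable.iSup fun u => Measurable.ennreal_ofReal (Measurable.pow_const (Measurable.abs ?_) _)
    have : ∀ k m, Measurable fun t => trX (δ t u) k m := by
      intro k
      induction k with
      | zero => intro m; simp only [trX]; fun_prop
      | succ k ih =>
        intro m; simp only [trX]
        refine (ih _).add ?_
        split_ifs
        · exact hmδ u k _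
        · exact (hmδ u k _).neg
    exact this N m
  · intro t
    rw [lintegral_shift t (l/2^N) (fun m => ⨆ u, ENNReal.ofReal (|trX (δ t u) N m| ^ p))]
    refine (cww_max p hp hp2 (δ t) N (fun m => Finset.univ.sup' Finset.univ_nonempty fun u => trS (δ t u) N m)
      (fun u m => Finset.le_sup' (fun u => trS (δ t u) N m) (Finset.mem_univ u)) _ (by positivity)).trans ?_
    refine mul_le_mul le_rfl ?_ (by simp) (by simp)
    rw [← lintegral_shift t (l/2^N) (fun m => ENNReal.ofReal ((Finset.univ.sup' Finset.univ_nonempty fun u => trS (δ t u) N m)^(p/2)))]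
    refine lintegral_mono fun x => ?_
    obtain ⟨u, -, hu⟩ := Finset.exists_mem_eq_sup' (Finset.univ_nonempty (α := ν)) fun u => trS (δ t u) N ⌊(x-t)/(l/2^N)⌋
    simp only
    rw [hu, htrS, ← ofReal_sq_rpow _ _ _ (by linarith)]
    gcongr with k hk
    exact hδG u x t k

lemma fs_Lam {ι : Type*} [Fintype ι] (p : ℝ) (hp : 1 < p) (hp2 : p ≤ 2) (l : ℝ) (hl : 0 < l) (N : ℕ)
    (h : ι → ℝ → ℝ) (hc : ∀ i, Continuous (h i)) (h0 : ∀ i x, 0 ≤ h i x) :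
    ∫⁻ x, (∑ i, (⨆ k : Fin (N+1), ENNReal.ofReal (Lam (l/2^(k:ℕ)) (h i) x))^2)^(p/2) ≤
      9 * (ENNReal.ofReal ((p/(p-1))^p) * ∫⁻ x, (∑ i, ENNReal.ofReal (h i x)^2)^(p/2)) := by
  have hτ := tauM_prob l hl
  have hnn : ∀ i k t m, 0 ≤ cellAvg l t (h i) k m := fun i k t m => avgI_nonneg _ _ _ (by positivity) (h0 i)
  have hrn : ∀ i k t m, 0 ≤ runMax (cellAvg l t (h i)) k m := fun i k t m => runMax_nonneg _ (fun k m => hnn i k t m) k m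
  have hmr : ∀ i k m, Measurable fun t => runMax (cellAvg l t (h i)) k m := fun i k m =>
    measurable_runMax _ (fun k m => measurable_cellAvg l _ (hc i) k m) k m
  have h1 : ∀ x, (∑ i, (⨆ k : Fin (N+1), ENNReal.ofReal (Lam (l/2^(k:ℕ)) (h i) x))^2)^(p/2) ≤
      ∫⁻ t, ENNReal.ofReal ((∑ i, runMax (cellAvg l t (h i)) N ⌊(x-t)/(l/2^N)⌋ ^ 2) ^ (p/2)) ∂tauM l := by
    intro x
    have hm : ∀ i, AEMeasurable (fun t => ENNReal.ofReal (runMax (cellAvg l t (h i)) N ⌊(x-t)/(l/2^N)⌋)) (tauM l) := fun i =>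
      ((measurable_cell (l/2^N) (fun t m => runMax (cellAvg l t (h i)) N m) (hmr i N)).comp
        (measurable_const.prodMk measurable_id : Measurable fun t : ℝ => (x, t))).ennreal_ofReal.aemeasurable
    have := sum_lintegral_rpow_le (tauM l) Finset.univ (fun i t => ENNReal.ofReal (runMax (cellAvg l t (h i)) N ⌊(x-t)/(l/2^N)⌋))
      hm p hp.le
    refine le_trans ?_ (this.trans (le_of_eq ?_))
    · gcongr with i hi
      refine iSup_le fun k => ?_
      rw [← integral_EE l hl k (h i) (hc i) x, ofReal_integral_eq_lintegral_ofReal (integrable_EE l hl k _ (hc i) x) (ae_of_all _ fun t => hnn i k t _)]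
      exact lintegral_mono fun t => ENNReal.ofReal_le_ofReal (EE_le_runMax l (h i) x t N k (by omega))
    · congr 1; ext t
      rw [← ENNReal.ofReal_rpow_of_nonneg (Finset.sum_nonneg fun _ _ => sq_nonneg _) (by linarith),
        ENNReal.ofReal_sum_of_nonneg (fun _ _ => sq_nonneg _)]
      congr 2; ext i
      rw [ENNReal.ofReal_pow (hrn _ _ _ _)]
  refine (lintegral_mono h1).trans ?_
  refine transfer_le l (l/2^N) hl (fun t m => ENNReal.ofReal ((∑ i, runMax (cellAvg l t (h i)) N m ^ 2) ^ (p/2))) ?_ _ ?_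
  · intro m
    exact Measurable.ennreal_ofReal (Measurable.pow_const (Finset.measurable_fun_sum _ fun i _ => (hmr i N m).pow_const 2) _)
  · intro t
    rw [lintegral_shift t (l/2^N) (fun m => ENNReal.ofReal ((∑ i, runMax (cellAvg l t (h i)) N m ^ 2) ^ (p/2)))]
    have hHc : Continuous (fun x => √(∑ i, h i x ^ 2)) := by fun_prop
    have H : DomMart (fun i => cellAvg l t (h i)) (cellAvg l t (fun x => √(∑ i, h i x ^ 2))) :=
      ⟨fun i => cellAvg_mart l t hl _ (hc i), cellAvg_mart l t hl _ hHc,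
        fun k m => avgI_nonneg _ _ _ (by positivity) (fun _ => Real.sqrt_nonneg _),
        fun k m => sum_avgI_sq_le h hc _ _ (by positivity)⟩
    refine (H.fs_le p hp hp2 N _ (by positivity)).trans ?_
    refine mul_le_mul le_rfl ((lintegral_runMax_cellAvg_le p hp _ hHc (fun _ => Real.sqrt_nonneg _) l t hl N).trans (le_of_eq ?_)) (by simp) (by simp)
    congr 2; ext x
    rw [Real.sqrt_eq_rpow, ← Real.rpow_mul (Finset.sum_nonneg fun _ _ => sq_nonneg _),
      ← ENNReal.ofReal_rpow_of_nonneg (Finset.sum_nonneg fun _ _ => sq_nonneg _) (by linarith),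
      ENNReal.ofReal_sum_of_nonneg (fun _ _ => sq_nonneg _), show 1/2*p = p/2 by ring]
    congr 2; ext i
    rw [ENNReal.ofReal_pow (h0 i x)]

/-- A convenient form of Fatou's lemma. -/
lemma lintegral_le_of_tendsto {α : Type*} [MeasurableSpace α] {μ : Measure α} (F : ℕ → α → ℝ≥0∞) (f : α → ℝ≥0∞)
    (hF : ∀ n, Measurable (F n)) (h : ∀ x, Tendsto (fun n => F n x) atTop (𝓝 (f x))) (B : ℝ≥0∞)
    (hB : ∀ n, ∫⁻ x, F n x ∂μ ≤ B) : ∫⁻ x, f x ∂μ ≤ B := by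
  calc ∫⁻ x, f x ∂μ = ∫⁻ x, liminf (fun n => F n x) atTop ∂μ := by
        congr 1; ext x; exact (h x).liminf_eq.symm
    _ ≤ liminf (fun n => ∫⁻ x, F n x ∂μ) atTop := lintegral_liminf_le hF
    _ ≤ B := liminf_le_of_le (by isBoundedDefault) (fun b hb => by
        obtain ⟨n, hn⟩ := hb.exists
        exact hn.trans (hB n))

lemma continuous_Lam (r : ℝ) (g : ℝ → ℝ) (hg : Continuous g) : Continuous (Lam r g) :=
  (continuous_avgI _ (continuous_avgI g hg r) r).comp (continuous_id.sub continuous_const)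

/-- The dyadic maximal function. -/
def Mmax (h : ℝ → ℝ) (x : ℝ) : ℝ≥0∞ := ⨆ j : ℤ, ENNReal.ofReal (Lam ((2:ℝ)^j) h x)

/-- The Fefferman–Stein inequality. -/
lemma fs_Mmax {ι : Type*} [Fintype ι] (p : ℝ) (hp : 1 < p) (hp2 : p ≤ 2)
    (h : ι → ℝ → ℝ) (hc : ∀ i, Continuous (h i)) (h0 : ∀ i x, 0 ≤ h i x) :
    ∫⁻ x, (∑ i, (Mmax (h i) x)^2)^(p/2) ≤
      9 * (ENNReal.ofReal ((p/(p-1))^p) * ∫⁻ x, (∑ i, ENNReal.ofReal (h i x)^2)^(p/2)) := by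
  refine lintegral_le_of_tendsto (fun R x => (∑ i, (⨆ k : Fin (2*R+1), ENNReal.ofReal (Lam (2^R/2^(k:ℕ)) (h i) x))^2)^(p/2)) _ ?_ ?_ _ ?_
  · intro R
    refine Measurable.pow_const (Finset.measurable_fun_sum _ fun i _ => Measurable.pow_const (Measurable.iSup fun k => ?_) _) _
    exact (continuous_Lam _ _ (hc i)).measurable.ennreal_ofReal
  · intro x
    have h1 : ∀ i, Tendsto (fun R : ℕ => ⨆ k : Fin (2*R+1), ENNReal.ofReal (Lam (2^R/2^(k:ℕ)) (h i) x)) atTop (𝓝 (Mmax (h i) x)) := by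
      intro i
      have mono : Monotone (fun R : ℕ => ⨆ k : Fin (2*R+1), ENNReal.ofReal (Lam (2^R/2^(k:ℕ)) (h i) x)) := by
        refine monotone_nat_of_le_succ fun R => iSup_le fun k => ?_
        refine le_trans (le_of_eq ?_) (le_iSup _ (⟨k+1, by omega⟩ : Fin (2*(R+1)+1)))
        congr 2; simp only; rw [pow_succ, pow_succ]; field_simp
      have e : Mmax (h i) x = ⨆ R : ℕ, ⨆ k : Fin (2*R+1), ENNReal.ofReal (Lam (2^R/2^(k:ℕ)) (h i) x) := by
        apply le_antisymm
        · refine iSup_le fun j => ?_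
          refine le_trans ?_ (le_iSup _ j.natAbs)
          refine le_trans (le_of_eq ?_) (le_iSup _ (⟨((j.natAbs:ℤ) - j).toNat, by omega⟩ : Fin (2*j.natAbs+1)))
          congr 2
          simp only
          rw [← zpow_natCast, ← zpow_natCast, ← zpow_sub₀ (by norm_num)]
          congr 1; omega
        · refine iSup_le fun R => iSup_le fun k => ?_
          refine le_trans (le_of_eq ?_) (le_iSup _ ((R:ℤ) - (k:ℕ)))
          rw [zpow_sub₀ (by norm_num), zpow_natCast, zpow_natCast]
      rw [e]; exact tendsto_atTop_iSup mono
    have hcont : Continuous fun y : ℝ≥0∞ => y^(p/2) := ENNReal.continuous_rpow_const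
    refine (hcont.tendsto _).comp (tendsto_finsetSum _ fun i _ => ?_)
    exact ((ENNReal.continuous_pow 2).tendsto _).comp (h1 i)
  · intro R
    exact fs_Lam p hp hp2 (2^R) (by positivity) (2*R) h hc h0

lemma integral_le_Lam (h : ℝ → ℝ) (hc : Continuous h) (h0 : ∀ x, 0 ≤ h x) (x ρ : ℝ) (hρ : 0 < ρ) :
    ∫ z in (x-ρ)..(x+ρ), h z ≤ 8 * ρ * Lam (4*ρ) h x := by
  set I := ∫ z in (x-ρ)..(x+ρ), h z with hI
  have hA : Continuous fun a => avgI h a (4*ρ) := continuous_avgI h hc _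
  have hA0 : ∀ a, 0 ≤ avgI h a (4*ρ) := fun a => avgI_nonneg h a _ (by positivity) h0
  have h1 : ∫ a in (x-3*ρ)..(x-ρ), (4*ρ)⁻¹ * I ≤ ∫ a in (x-3*ρ)..(x-ρ), avgI h a (4*ρ) := by
    refine intervalIntegral.integral_mono_on (by linarith) (by simp) (hA.intervalIntegrable _ _) fun a ha => ?_
    unfold avgI
    gcongr
    exact intervalIntegral.integral_mono_interval (by linarith [ha.2]) (by linarith) (by linarith [ha.1])
      (ae_of_all _ h0) (hc.intervalIntegrable _ _)
  have h2 : ∫ a in (x-3*ρ)..(x-ρ), avgI h a (4*ρ) ≤ ∫ a in (x-4*ρ)..(x-4*ρ+4*ρ), avgI h a (4*ρ) :=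
    intervalIntegral.integral_mono_interval (by linarith) (by linarith) (by linarith)
      (ae_of_all _ hA0) (hA.intervalIntegrable _ _)
  rw [intervalIntegral.integral_const, smul_eq_mul] at h1
  have h3 : Lam (4*ρ) h x = (4*ρ)⁻¹ * ∫ a in (x-4*ρ)..(x-4*ρ+4*ρ), avgI h a (4*ρ) := rfl
  rw [h3]
  calc I = 8*ρ*((4*ρ)⁻¹ * ((x - ρ - (x - 3 * ρ)) * ((4*ρ)⁻¹ * I))) := by field_simp; ring
    _ ≤ _ := by gcongr; exact h1.trans h2

lemma integral_le_Mmax (h : ℝ → ℝ) (hc : Continuous h) (h0 : ∀ x, 0 ≤ h x) (x ρ : ℝ) (hρ : 0 < ρ) :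
    ENNReal.ofReal (∫ z in (x-ρ)..(x+ρ), h z) ≤ ENNReal.ofReal (16 * ρ) * Mmax h x := by
  obtain ⟨j, hj1, hj2⟩ := exists_mem_Ioc_zpow hρ (by norm_num : (1:ℝ) < 2)
  rw [zpow_add_one₀ (by norm_num)] at hj2
  have e : (4:ℝ) * (2^j*2) = 2^(j+3) := by rw [zpow_add₀ (by norm_num)]; norm_num; ring
  have h1 := integral_le_Lam h hc h0 x (2^j*2) (by positivity)
  rw [e] at h1
  have h2 : ∫ z in (x-ρ)..(x+ρ), h z ≤ ∫ z in (x-2^j*2)..(x+2^j*2), h z :=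
    intervalIntegral.integral_mono_interval (by linarith) (by linarith) (by linarith)
      (ae_of_all _ h0) (hc.intervalIntegrable _ _)
  calc _ ≤ ENNReal.ofReal (8*(2^j*2) * Lam (2^(j+3)) h x) := ENNReal.ofReal_le_ofReal (h2.trans h1)
    _ = ENNReal.ofReal (8*(2^j*2)) * ENNReal.ofReal (Lam (2^(j+3)) h x) := ENNReal.ofReal_mul (by positivity)
    _ ≤ _ := by
      refine mul_le_mul (ENNReal.ofReal_le_ofReal (by linarith)) ?_ (by simp) (by simp)
      · exact le_iSup (fun j : ℤ => ENNReal.ofReal (Lam ((2:ℝ)^j) h x)) _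

/-- Averages with a Cauchy kernel. -/
def Pois (r : ℝ) (h : ℝ → ℝ) (x : ℝ) : ℝ≥0∞ := ∫⁻ y, ENNReal.ofReal (1+y^2)⁻¹ * ENNReal.ofReal (h (x - r*y))

lemma cauchy_le_tsum (y : ℝ) : ENNReal.ofReal (1+y^2)⁻¹ ≤
    ∑' i : ℕ, ENNReal.ofReal (4 * (4:ℝ)⁻¹^i) * (Icc (-2^i:ℝ) (2^i)).indicator 1 y := by
  have hex : ∃ i : ℕ, |y| ≤ 2^i := by
    obtain ⟨i, hi⟩ := pow_unbounded_of_one_lt |y| (by norm_num : (1:ℝ) < 2)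
    exact ⟨i, hi.le⟩
  refine le_trans ?_ (ENNReal.le_tsum (Nat.find hex))
  have h1 := Nat.find_spec hex
  rw [indicator_of_mem (by rw [mem_Icc, ← abs_le]; exact h1), Pi.one_apply, mul_one]
  apply ENNReal.ofReal_le_ofReal
  rcases h : Nat.find hex with _ | i
  · have : (1+y^2)⁻¹ ≤ 1 := inv_le_one_of_one_le₀ (by nlinarith)
    simp; linarith
  · have h2 := Nat.find_min hex (m := i) (by omega)
    push Not at h2
    rw [inv_pow, pow_succ (4:ℝ), ← div_eq_mul_inv, inv_eq_one_div, div_le_div_iff₀ (by positivity) (by positivity)]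
    have : (4:ℝ)^i = 2^i*2^i := by rw [← mul_pow]; norm_num
    have h3 : (2:ℝ)^i*2^i ≤ |y| * |y| := mul_self_le_mul_self (by positivity) h2.le
    rw [abs_mul_abs_self] at h3
    nlinarith

lemma Pois_le_Mmax (r : ℝ) (hr : 0 < r) (h : ℝ → ℝ) (hc : Continuous h) (h0 : ∀ x, 0 ≤ h x) (x : ℝ) :
    Pois r h x ≤ 128 * Mmax h x := by
  have hm : Measurable fun y => ENNReal.ofReal (h (x - r*y)) := by fun_prop
  have hone : ∀ i : ℕ, ∫⁻ y, ENNReal.ofReal (4 * (4:ℝ)⁻¹^i) * (Icc (-2^i:ℝ) (2^i)).indicator 1 y * ENNReal.ofReal (h (x - r*y)) ≤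
      ENNReal.ofReal (64 * (2:ℝ)⁻¹^i) * Mmax h x := by
    intro i
    simp only [mul_assoc]
    rw [lintegral_const_mul' _ _ ENNReal.ofReal_ne_top]
    have e : ∫⁻ y, (Icc (-2^i:ℝ) (2^i)).indicator 1 y * ENNReal.ofReal (h (x - r*y)) = ENNReal.ofReal (r⁻¹ * ∫ z in (x-r*2^i)..(x+r*2^i), h z) := by
      rw [show (fun y => (Icc (-2^i:ℝ) (2^i)).indicator (1 : ℝ → ℝ≥0∞) y * ENNReal.ofReal (h (x - r*y))) =
        (Icc (-2^i:ℝ) (2^i)).indicator fun y => ENNReal.ofReal (h (x - r*y)) by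
          ext y; by_cases hy : y ∈ Icc (-2^i:ℝ) (2^i) <;> simp [hy]]
      rw [lintegral_indicator measurableSet_Icc, ← restrict_Ioc_eq_restrict_Icc, ← ofReal_integral_eq_lintegral_ofReal,
        ← intervalIntegral.integral_of_le (by linarith [show (0:ℝ) < 2^i by positivity])]
      · congr 1
        have := intervalIntegral.integral_comp_sub_mul (a := -2^i) (b := 2^i) (fun z => h z) hr.ne' x
        rw [this, smul_eq_mul]; congr 2; ring
      · exact ((hc.comp (by fun_prop : Continuous fun y => x - r*y)).intervalIntegrable (-2^i) (2^i)).1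
      · exact ae_of_all _ fun y => h0 _
    rw [e]
    calc _ ≤ ENNReal.ofReal (4 * (4:ℝ)⁻¹^i) * (ENNReal.ofReal r⁻¹ * (ENNReal.ofReal (16*(r*2^i)) * Mmax h x)) := by
          rw [ENNReal.ofReal_mul (by positivity : 0 ≤ r⁻¹)]
          refine mul_le_mul le_rfl (mul_le_mul le_rfl ?_ (by simp) (by simp)) (by simp) (by simp)
          exact integral_le_Mmax h hc h0 x _ (by positivity)
      _ = _ := by
        rw [← mul_assoc, ← mul_assoc, ← ENNReal.ofReal_mul (by positivity), ← ENNReal.ofReal_mul (by positivity)]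
        congr 2
        rw [show (4:ℝ)⁻¹ = 2⁻¹*2⁻¹ by norm_num, mul_pow]
        have : (2:ℝ)⁻¹^i*2^i = 1 := by rw [← mul_pow]; norm_num
        field_simp
        rw [one_div]
        linear_combination 64 * this
  calc Pois r h x ≤ ∫⁻ y, ∑' i : ℕ, ENNReal.ofReal (4 * (4:ℝ)⁻¹^i) * (Icc (-2^i:ℝ) (2^i)).indicator 1 y * ENNReal.ofReal (h (x - r*y)) := by
        refine lintegral_mono fun y => ?_
        rw [ENNReal.tsum_mul_right]
        exact mul_le_mul (cauchy_le_tsum y) le_rfl (by simp) (by simp)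
    _ = ∑' i : ℕ, ∫⁻ y, ENNReal.ofReal (4 * (4:ℝ)⁻¹^i) * (Icc (-2^i:ℝ) (2^i)).indicator 1 y * ENNReal.ofReal (h (x - r*y)) := by
        refine lintegral_tsum fun i => Measurable.aemeasurable ?_
        exact ((measurable_one.indicator measurableSet_Icc).const_mul _).mul hm
    _ ≤ ∑' i : ℕ, ENNReal.ofReal (64 * (2:ℝ)⁻¹^i) * Mmax h x := ENNReal.tsum_le_tsum hone
    _ = _ := by
        rw [ENNReal.tsum_mul_right, ← ENNReal.ofReal_tsum_of_nonneg (fun i => by positivity)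
          ((summable_geometric_of_lt_one (by norm_num) (by norm_num)).mul_left _), tsum_mul_left, tsum_geometric_of_lt_one (by norm_num) (by norm_num)]
        congr 1; norm_num

lemma Pois_shift_le (r : ℝ) (hr : 0 < r) (h : ℝ → ℝ) (a x : ℝ) (hax : |a - x| ≤ r) :
    Pois r h a ≤ 4 * Pois r h x := by
  unfold Pois
  set s := (a-x)/r with hs
  have hs1 : s^2 ≤ 1 := by
    rw [hs, div_pow, div_le_one (by positivity), ← sq_abs]; gcongr
  rw [← lintegral_add_right_eq_self _ s, ← lintegral_const_mul' _ _ (by simp)]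
  refine lintegral_mono fun y => ?_
  simp only
  rw [← mul_assoc]
  refine mul_le_mul ?_ (le_of_eq ?_) (by simp) (by simp)
  · rw [show (4:ℝ≥0∞) = ENNReal.ofReal 4 by norm_num, ← ENNReal.ofReal_mul (by norm_num)]
    apply ENNReal.ofReal_le_ofReal
    rw [← div_eq_mul_inv, inv_eq_one_div, div_le_div_iff₀ (by positivity) (by positivity)]
    nlinarith [sq_nonneg (y+2*s), sq_nonneg (y+s)]
  · congr 2; rw [hs]; field_simp; ring

/-- The character `t ↦ e^{2πit}`. -/
def ch (t : ℝ) : ℂ := Complex.exp (((2 * Real.pi * t : ℝ) : ℂ) * Complex.I)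

lemma norm_ch (t : ℝ) : ‖ch t‖ = 1 := Complex.norm_exp_ofReal_mul_I _

lemma ch_add (s t : ℝ) : ch (s + t) = ch s * ch t := by
  unfold ch; rw [← Complex.exp_add]; congr 1; push_cast; ring

lemma ch_zero : ch 0 = 1 := by simp [ch]

lemma continuous_ch : Continuous ch := by unfold ch; fun_prop

lemma FTinv_eq (g : ℝ × ℝ → ℂ) (x : ℝ × ℝ) : FTinv g x = ∫ ξ : ℝ × ℝ, ch (x.1*ξ.1+x.2*ξ.2) * g ξ := rfl

lemma FT_eq (g : ℝ × ℝ → ℂ) (ξ : ℝ × ℝ) : FT g ξ = ∫ x : ℝ × ℝ, ch (-(x.1*ξ.1+x.2*ξ.2)) * g x := by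
  unfold FT ch; congr 1; ext x; congr 3; push_cast; ring

lemma FTinv_integrable (g : ℝ × ℝ → ℂ) (hg : Integrable g) (x : ℝ × ℝ) :
    Integrable fun ξ : ℝ × ℝ => ch (x.1*ξ.1+x.2*ξ.2) * g ξ := by
  refine hg.bdd_mul (c := 1) ?_ (ae_of_all _ fun ξ => (norm_ch _).le)
  exact (continuous_ch.comp (by fun_prop)).aestronglyMeasurable

lemma continuous_FTinv (g : ℝ × ℝ → ℂ) (hg : Integrable g) : Continuous (FTinv g) := by
  refine continuous_of_dominated (bound := fun ξ => ‖g ξ‖) (F := fun (x ξ : ℝ × ℝ) => ch (x.1*ξ.1+x.2*ξ.2) * g ξ) ?_ ?_ hg.norm ?_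
  · intro x; exact (FTinv_integrable g hg x).aestronglyMeasurable
  · intro x; refine ae_of_all _ fun ξ => ?_
    rw [norm_mul, norm_ch, one_mul]
  · refine ae_of_all _ fun ξ => ?_
    exact (continuous_ch.comp (by fun_prop)).mul continuous_const

lemma norm_FTinv_le (g : ℝ × ℝ → ℂ) (x : ℝ × ℝ) : ‖FTinv g x‖ ≤ ∫ ξ, ‖g ξ‖ := by
  rw [FTinv_eq]
  refine (norm_integral_le_integral_norm _).trans (le_of_eq ?_)
  congr 1; ext ξ; rw [norm_mul, norm_ch, one_mul]

/-- Superpositions of translates of an inverse Fourier transform are given by multipliers. -/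
lemma FTinv_superpose {Y : Type*} [MeasurableSpace Y] (μ : Measure Y) [SFinite μ] (c : Y → ℂ) (hc : Integrable c μ)
    (v : Y → ℝ × ℝ) (hv : Measurable v) (H : ℝ × ℝ → ℂ) (hH : Integrable H) (x : ℝ × ℝ) :
    ∫ y, c y * FTinv H (x - v y) ∂μ
      = FTinv (fun ξ => (∫ y, c y * ch (-((v y).1*ξ.1+(v y).2*ξ.2)) ∂μ) * H ξ) x := by
  simp only [FTinv_eq]
  calc _ = ∫ y, (∫ ξ : ℝ × ℝ, c y * (ch ((x - v y).1*ξ.1+(x - v y).2*ξ.2) * H ξ)) ∂μ := by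
        simp_rw [integral_const_mul]
    _ = ∫ ξ : ℝ × ℝ, (∫ y, c y * (ch ((x - v y).1*ξ.1+(x - v y).2*ξ.2) * H ξ) ∂μ) := by
        refine integral_integral_swap ?_
        have h1 : Integrable (fun z : Y × (ℝ × ℝ) => c z.1 * H z.2) (μ.prod volume) := hc.mul_prod hH
        have h2 := h1.bdd_mul (c := 1) (f := fun z : Y × (ℝ × ℝ) => ch ((x - v z.1).1*z.2.1+(x - v z.1).2*z.2.2))
          ?_ (ae_of_all _ fun ξ => (norm_ch _).le)
        · refine h2.congr (ae_of_all _ fun z => ?_)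
          simp only [Function.uncurry]; ring
        · refine (continuous_ch.measurable.comp ?_).aestronglyMeasurable
          have h3 : Measurable fun z : Y × (ℝ × ℝ) => v z.1 := hv.comp measurable_fst
          fun_prop
    _ = _ := by
        congr 1; ext ξ
        rw [← integral_mul_const, ← integral_const_mul]
        congr 1; ext y
        have : (x - v y).1*ξ.1+(x - v y).2*ξ.2 = (x.1*ξ.1+x.2*ξ.2) + -((v y).1*ξ.1+(v y).2*ξ.2) := by
          simp only [Prod.fst_sub, Prod.snd_sub]; ring
        rw [this, ch_add]; ring

lemma integral_WithLp (f : ℝ × ℝ → ℂ) : ∫ v : WithLp 2 (ℝ × ℝ), f (WithLp.ofLp v) = ∫ x, f x :=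
  (WithLp.volume_preserving_ofLp ℝ ℝ).integral_comp (MeasurableEquiv.toLp 2 (ℝ × ℝ)).symm.measurableEmbedding f

section

open scoped FourierTransform SchwartzMap

lemma fourier_WithLp (f : SchwartzMap (WithLp 2 (ℝ × ℝ)) ℂ) (ξ : ℝ × ℝ) :
    FT (fun x => f (WithLp.toLp 2 x)) ξ = (𝓕 f) (WithLp.toLp 2 ξ) := by
  rw [SchwartzMap.fourier_coe, Real.fourier_eq', FT_eq, ← integral_WithLp]
  congr 1; ext v
  simp only [smul_eq_mul, WithLp.toLp_ofLp, WithLp.prod_inner_apply, ch]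
  congr 3; simp; ring

lemma fourierInv_WithLp (f : SchwartzMap (WithLp 2 (ℝ × ℝ)) ℂ) (ξ : ℝ × ℝ) :
    FTinv (fun x => f (WithLp.toLp 2 x)) ξ = (𝓕⁻ f) (WithLp.toLp 2 ξ) := by
  rw [SchwartzMap.fourierInv_coe, Real.fourierInv_eq', FTinv_eq, ← integral_WithLp]
  congr 1

def eLp : WithLp 2 (ℝ × ℝ) ≃L[ℝ] ℝ × ℝ := WithLp.prodContinuousLinearEquiv 2 ℝ ℝ ℝ

lemma exists_FT_eq (a : SchwartzMap (ℝ × ℝ) ℂ) : ∃ Φ : SchwartzMap (ℝ × ℝ) ℂ, FT Φ = a := by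
  let A : SchwartzMap (WithLp 2 (ℝ × ℝ)) ℂ := SchwartzMap.compCLMOfContinuousLinearEquiv ℂ eLp a
  refine ⟨SchwartzMap.compCLMOfContinuousLinearEquiv ℂ eLp.symm (𝓕⁻ A), ?_⟩
  ext ξ
  have : 𝓕 (𝓕⁻ A) = A := FourierTransform.fourier_fourierInv_eq A
  have h := fourier_WithLp (𝓕⁻ A) ξ
  rw [this] at h
  exact h

lemma exists_FTinv_eq (f : SchwartzMap (ℝ × ℝ) ℂ) : ∃ F : SchwartzMap (ℝ × ℝ) ℂ, FT f = F ∧ FTinv F = f := by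
  let A : SchwartzMap (WithLp 2 (ℝ × ℝ)) ℂ := SchwartzMap.compCLMOfContinuousLinearEquiv ℂ eLp f
  refine ⟨SchwartzMap.compCLMOfContinuousLinearEquiv ℂ eLp.symm (𝓕 A), ?_, ?_⟩
  · ext ξ; exact fourier_WithLp A ξ
  · ext ξ
    have : 𝓕⁻ (𝓕 A) = A := FourierTransform.fourierInv_fourier_eq A
    have h := fourierInv_WithLp (𝓕 A) ξ
    rw [this] at h
    exact h

lemma exists_FT1_eq (a : SchwartzMap ℝ ℂ) : ∃ φ : SchwartzMap ℝ ℂ, ∀ s, ∫ t, ch (-(t*s)) * φ t = a s := by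
  refine ⟨𝓕⁻ a, fun s => ?_⟩
  have h : 𝓕 (𝓕⁻ a) = a := FourierTransform.fourier_fourierInv_eq a
  conv_rhs => rw [← h]
  rw [SchwartzMap.fourier_coe, Real.fourier_eq']
  congr 1; ext v
  simp only [smul_eq_mul, ch]
  congr 3; simp; ring

lemma decay1 (φ : SchwartzMap ℝ ℂ) : ∃ C : ℝ, 0 < C ∧ ∀ t, ‖φ t‖ ≤ C * (1+t^2)⁻¹ := by
  obtain ⟨C0, h0⟩ := φ.decay 0 0
  obtain ⟨C2, h2⟩ := φ.decay 2 0
  refine ⟨C0 + C2, by linarith [h0.1, h2.1], fun t => ?_⟩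
  have a0 := h0.2 t
  have a2 := h2.2 t
  simp at a0 a2
  rw [← div_eq_mul_inv, le_div_iff₀ (by positivity)]
  nlinarith

lemma decay2 (Φ : SchwartzMap (ℝ × ℝ) ℂ) :
    ∃ C : ℝ, 0 < C ∧ ∀ y, ‖Φ y‖ ≤ C * ((1+y.1^2)⁻¹ * ((1+y.2^2)⁻¹)^3) := by
  obtain ⟨C0, h0⟩ := Φ.decay 0 0
  obtain ⟨C8, h8⟩ := Φ.decay 8 0
  refine ⟨16*(C0 + C8), by linarith [h0.1, h8.1], fun y => ?_⟩
  have a0 := h0.2 y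
  have a8 := h8.2 y
  simp only [norm_iteratedFDeriv_zero, pow_zero, one_mul] at a0 a8
  rw [inv_pow, ← mul_inv, ← div_eq_mul_inv, le_div_iff₀ (by positivity)]
  set N := ‖y‖
  have h1 : y.1^2 ≤ N^2 := by rw [← sq_abs]; exact pow_le_pow_left₀ (abs_nonneg _) (norm_fst_le y) 2
  have h2 : y.2^2 ≤ N^2 := by rw [← sq_abs]; exact pow_le_pow_left₀ (abs_nonneg _) (norm_snd_le y) 2
  have h3 : (1+y.1^2)*(1+y.2^2)^3 ≤ (1+N^2)^4 := by
    calc _ ≤ (1+N^2)*(1+N^2)^3 := by gcongr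
      _ = _ := by ring
  have h4 : (1+N^2)^4 ≤ 16*(1 + N^8) := by
    have : (1+N^2)^2 ≤ 2*(1+(N^2)^2) := by nlinarith [sq_nonneg (N^2-1)]
    have h5 : ((1+N^2)^2)^2 ≤ (2*(1+(N^2)^2))^2 := by gcongr
    nlinarith [sq_nonneg ((N^2)^2-1)]
  calc ‖Φ y‖ * ((1+y.1^2)*(1+y.2^2)^3) ≤ ‖Φ y‖ * (16*(1 + N^8)) := by
        exact mul_le_mul_of_nonneg_left (h3.trans h4) (norm_nonneg _)
    _ ≤ _ := by nlinarith

end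

lemma avgI_eq (g : ℝ → ℝ) (a h : ℝ) (hh : h ≠ 0) : avgI g a h = ∫ θ in (0:ℝ)..1, g (a + h*θ) := by
  have := intervalIntegral.integral_comp_add_mul (a := 0) (b := 1) g hh a
  simp only [mul_zero, mul_one, add_zero, smul_eq_mul] at this
  rw [this, avgI]

/-- Averages of complex functions. -/
def avgC (g : ℝ → ℂ) (a h : ℝ) : ℂ := ∫ θ in (0:ℝ)..1, g (a + h*θ)

lemma avgI_re (g : ℝ → ℂ) (hg : Continuous g) (a h : ℝ) (hh : h ≠ 0) :
    avgI (fun x => (g x).re) a h = (avgC g a h).re := by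
  rw [avgI_eq _ _ _ hh, avgC]
  exact Complex.reCLM.intervalIntegral_comp_comm (Continuous.intervalIntegrable (by fun_prop) _ _)

lemma avgI_im (g : ℝ → ℂ) (hg : Continuous g) (a h : ℝ) (hh : h ≠ 0) :
    avgI (fun x => (g x).im) a h = (avgC g a h).im := by
  rw [avgI_eq _ _ _ hh, avgC]
  exact Complex.imCLM.intervalIntegral_comp_comm (Continuous.intervalIntegrable (by fun_prop) _ _)

lemma integral_ch (s : ℝ) : ∫ θ in (0:ℝ)..1, ch (s*θ) = ch (s/2) * (Real.sinc (Real.pi*s) : ℝ) := by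
  rcases eq_or_ne s 0 with rfl | hs
  · simp [ch_zero]
  have hpi := Real.pi_ne_zero
  have hc : (2*Real.pi*s*Complex.I : ℂ) ≠ 0 := by
    simp [hs, hpi]
  have h1 : ∀ θ : ℝ, ch (s*θ) = Complex.exp ((2*Real.pi*s*Complex.I : ℂ) * θ) := by
    intro θ; unfold ch; congr 1; push_cast; ring
  simp_rw [h1]
  rw [integral_exp_mul_complex hc, Real.sinc_of_ne_zero (mul_ne_zero hpi hs)]
  push_cast
  rw [Complex.sin, ch]
  have e1 : Complex.exp (2*Real.pi*s*Complex.I * 1) = Complex.exp (((2*Real.pi*(s/2) : ℝ):ℂ)*Complex.I) * Complex.exp (Real.pi*s*Complex.I) := by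
    rw [← Complex.exp_add]; congr 1; push_cast; ring
  have e2 : (1:ℂ) = Complex.exp (((2*Real.pi*(s/2) : ℝ):ℂ)*Complex.I) * Complex.exp (-(Real.pi*s)*Complex.I) := by
    rw [← Complex.exp_add]; rw [← Complex.exp_zero]; congr 1; push_cast; ring
  rw [mul_zero, Complex.exp_zero, e1]
  have hs' : (s:ℂ) ≠ 0 := by exact_mod_cast hs
  have hp' : (Real.pi:ℂ) ≠ 0 := by exact_mod_cast hpi
  generalize Complex.exp (((2*Real.pi*(s/2) : ℝ):ℂ)*Complex.I) = E at *
  generalize Complex.exp (Real.pi*s*Complex.I) = P at *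
  generalize Complex.exp (-(Real.pi*s)*Complex.I) = Q at *
  have e3 : E * P - 1 = E * (P - Q) := by rw [mul_sub, ← e2]
  rw [e3]
  field_simp
  simp only [Complex.I_sq]; ring

lemma avgC_FTinv (H : ℝ × ℝ → ℂ) (hH : Integrable H) (x1 a h : ℝ) :
    avgC (fun t => FTinv H (x1, t)) a h
      = FTinv (fun ξ => (ch (h*ξ.2/2) * (Real.sinc (Real.pi*(h*ξ.2)) : ℝ)) * H ξ) (x1, a) := by
  have := FTinv_superpose (volume.restrict (Ioc (0:ℝ) 1)) (fun _ => (1:ℂ)) (integrable_const _)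
    (fun θ => ((0:ℝ), -(h*θ))) (by fun_prop) H hH (x1, a)
  simp only [one_mul, Prod.mk_sub_mk, sub_zero, sub_neg_eq_add, zero_mul, zero_add] at this
  rw [avgC, intervalIntegral.integral_of_le zero_le_one, this]
  congr 1; ext ξ
  congr 1
  rw [← integral_ch, intervalIntegral.integral_of_le zero_le_one]
  congr 1; ext θ
  congr 1; ring

lemma FTinv_shift2 (H : ℝ × ℝ → ℂ) (x1 x2 r : ℝ) :
    FTinv H (x1, x2 - r) = FTinv (fun ξ => ch (-(r*ξ.2)) * H ξ) (x1, x2) := by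
  rw [FTinv_eq, FTinv_eq]; congr 1; ext ξ
  rw [← mul_assoc, ← ch_add]; congr 2; simp only; ring

lemma integrable_mult (m : ℝ × ℝ → ℂ) (hm : Continuous m) (B : ℝ) (hB : ∀ ξ, ‖m ξ‖ ≤ B) (H : ℝ × ℝ → ℂ) (hH : Integrable H) :
    Integrable fun ξ => m ξ * H ξ :=
  hH.bdd_mul hm.aestronglyMeasurable (ae_of_all _ hB)

/-- The multiplier of the smooth averages `Lam`. -/
def scM (s : ℝ) : ℝ := Real.sinc (Real.pi*s)^2

lemma continuous_scM : Continuous scM := by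
  unfold scM; exact (Real.continuous_sinc.comp (by fun_prop)).pow 2

lemma scM_le (s : ℝ) : |scM s| ≤ 1 := by
  unfold scM; rw [abs_pow]; exact pow_le_one₀ (abs_nonneg _) (Real.abs_sinc_le_one _)

lemma Lam_re_im (H : ℝ × ℝ → ℂ) (hH : Integrable H) (r : ℝ) (hr : r ≠ 0) (x : ℝ × ℝ) :
    Lam r (fun t => (FTinv H (x.1, t)).re) x.2 = (FTinv (fun ξ => (scM (r*ξ.2) : ℂ) * H ξ) x).re ∧
    Lam r (fun t => (FTinv H (x.1, t)).im) x.2 = (FTinv (fun ξ => (scM (r*ξ.2) : ℂ) * H ξ) x).im := by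
  obtain ⟨x1, x2⟩ := x
  set m : ℝ × ℝ → ℂ := fun ξ => ch (r*ξ.2/2) * (Real.sinc (Real.pi*(r*ξ.2)) : ℝ) with hm
  have hmc : Continuous m := by
    have := Real.continuous_sinc.comp (show Continuous fun ξ : ℝ × ℝ => Real.pi*(r*ξ.2) by fun_prop)
    exact (continuous_ch.comp (by fun_prop)).mul (Complex.continuous_ofReal.comp this)
  have hmb : ∀ ξ, ‖m ξ‖ ≤ 1 := by
    intro ξ
    simp only [hm, norm_mul, norm_ch, one_mul, Complex.norm_real, Real.norm_eq_abs]
    exact Real.abs_sinc_le_one _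
  have hH1 := integrable_mult m hmc 1 hmb H hH
  have hc : Continuous fun t => FTinv H (x1, t) := (continuous_FTinv H hH).comp (by fun_prop)
  have hc1 : Continuous fun t => FTinv (fun ξ => m ξ * H ξ) (x1, t) := (continuous_FTinv _ hH1).comp (by fun_prop)
  have key : avgC (fun a => avgC (fun t => FTinv H (x1, t)) a r) (x2 - r) r
      = FTinv (fun ξ => (scM (r*ξ.2) : ℂ) * H ξ) (x1, x2) := by
    simp_rw [avgC_FTinv H hH]
    rw [avgC_FTinv _ hH1, FTinv_shift2]
    congr 1; ext ξ
    have : ch (-(r*ξ.2)) * (ch (r*ξ.2/2) * ch (r*ξ.2/2)) = 1 := by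
      rw [← ch_add, ← ch_add, ← ch_zero]; congr 1; ring
    simp only [hm, scM]
    push_cast
    linear_combination ((Real.sinc (Real.pi*(r*ξ.2)) : ℝ):ℂ)^2 * H ξ * this
  have hc2 : Continuous fun a => avgC (fun t => FTinv H (x1, t)) a r := by
    simp_rw [avgC_FTinv H hH]; exact hc1
  constructor
  · unfold Lam
    simp_rw [avgI_re _ hc _ _ hr]
    rw [avgI_re _ hc2 _ _ hr, key]
  · unfold Lam
    simp_rw [avgI_im _ hc _ _ hr]
    rw [avgI_im _ hc2 _ _ hr, key]

/-- The multiplier of `Lam (c/2) - Lam c`. -/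
def kapM (s : ℝ) : ℝ := scM (s/2) - scM s

lemma kapM_eq (s : ℝ) (hs : s ≠ 0) : kapM s = Real.sin (Real.pi*s/2)^4 / (Real.pi*s/2)^2 := by
  have hpi := Real.pi_ne_zero
  unfold kapM scM
  rw [Real.sinc_of_ne_zero (by positivity), Real.sinc_of_ne_zero (by positivity)]
  have h2 : Real.sin (Real.pi*s) = 2*Real.sin (Real.pi*s/2)*Real.cos (Real.pi*s/2) := by
    rw [← Real.sin_two_mul]; congr 1; ring
  rw [h2, show Real.pi*(s/2) = Real.pi*s/2 by ring]
  have := Real.sin_sq_add_cos_sq (Real.pi*s/2)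
  field_simp
  have h3 : Real.cos (Real.pi*s/2)^2 = 1 - Real.sin (Real.pi*s/2)^2 := by linarith
  rw [h3]; ring

lemma continuous_kapM : Continuous kapM :=
  (continuous_scM.comp (by fun_prop)).sub continuous_scM

lemma kapM_le (s : ℝ) : |kapM s| ≤ 2 := by
  unfold kapM; have := abs_sub (scM (s/2)) (scM s); have := scM_le (s/2); have := scM_le s; linarith

lemma integrable_scM (H : ℝ × ℝ → ℂ) (hH : Integrable H) (r : ℝ) : Integrable fun ξ : ℝ × ℝ => (scM (r*ξ.2) : ℂ) * H ξ :=
  integrable_mult _ (Complex.continuous_ofReal.comp (continuous_scM.comp (by fun_prop))) 1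
    (fun ξ => by simpa using scM_le _) H hH

lemma FTinv_sub (G H : ℝ × ℝ → ℂ) (hG : Integrable G) (hH : Integrable H) (x : ℝ × ℝ) :
    FTinv (fun ξ => G ξ - H ξ) x = FTinv G x - FTinv H x := by
  simp only [FTinv_eq, mul_sub]
  exact integral_sub (FTinv_integrable G hG x) (FTinv_integrable H hH x)

lemma FTinv_sum {κ : Type*} (s : Finset κ) (G : κ → ℝ × ℝ → ℂ) (hG : ∀ i ∈ s, Integrable (G i)) (x : ℝ × ℝ) :
    FTinv (fun ξ => ∑ i ∈ s, G i ξ) x = ∑ i ∈ s, FTinv (G i) x := by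
  simp only [FTinv_eq, Finset.mul_sum]
  exact integral_finsetSum _ fun i hi => FTinv_integrable _ (hG i hi) x

lemma LamDiff_re_im (H : ℝ × ℝ → ℂ) (hH : Integrable H) (c : ℝ) (hc : c ≠ 0) (x : ℝ × ℝ) :
    Lam (c/2) (fun t => (FTinv H (x.1, t)).re) x.2 - Lam c (fun t => (FTinv H (x.1, t)).re) x.2
      = (FTinv (fun ξ => (kapM (c*ξ.2) : ℂ) * H ξ) x).re ∧
    Lam (c/2) (fun t => (FTinv H (x.1, t)).im) x.2 - Lam c (fun t => (FTinv H (x.1, t)).im) x.2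
      = (FTinv (fun ξ => (kapM (c*ξ.2) : ℂ) * H ξ) x).im := by
  have h1 := Lam_re_im H hH (c/2) (by positivity) x
  have h2 := Lam_re_im H hH c hc x
  have h3 : FTinv (fun ξ => (kapM (c*ξ.2) : ℂ) * H ξ) x
      = FTinv (fun ξ => (scM (c/2*ξ.2) : ℂ) * H ξ) x - FTinv (fun ξ => (scM (c*ξ.2) : ℂ) * H ξ) x := by
    rw [← FTinv_sub _ _ (integrable_scM H hH _) (integrable_scM H hH _)]
    congr 1; ext ξ
    simp only [kapM]; rw [show c/2*ξ.2 = c*ξ.2/2 by ring]; push_cast; ring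
  rw [h3, h1.1, h1.2, h2.1, h2.2]
  simp

/-- A smooth bump, equal to one on `[-1/2,1/2]` and supported in `[-1,1]`. -/
def thB : ContDiffBump (0:ℝ) := ⟨1/2, 1, by norm_num, by norm_num⟩

lemma thB_one (s : ℝ) (hs : |s| ≤ 1/2) : thB s = 1 :=
  thB.one_of_mem_closedBall (by simpa [thB] using hs)

lemma thB_zero (s : ℝ) (hs : 1 ≤ |s|) : thB s = 0 :=
  thB.zero_of_le_dist (by simpa [thB] using hs)

def psB (s : ℝ) : ℝ := thB s - thB (2*s)

lemma psB_zero (s : ℝ) (h : psB s ≠ 0) : 1/4 ≤ |s| ∧ |s| ≤ 1 := by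
  unfold psB at h
  constructor
  · by_contra! hc
    rw [thB_one s (by linarith), thB_one (2*s) (by rw [abs_mul]; norm_num; linarith)] at h
    simp at h
  · by_contra! hc
    rw [thB_zero s hc.le, thB_zero (2*s) (by rw [abs_mul]; norm_num; linarith)] at h
    simp at h

section

open scoped ContDiff

lemma contDiff_psB : ContDiff ℝ ∞ psB :=
  thB.contDiff.sub (thB.contDiff.comp (contDiff_const.mul contDiff_id))

lemma tsupport_psB : tsupport psB ⊆ {s | 1/4 ≤ |s| ∧ |s| ≤ 1} := by
  refine closure_minimal (fun s hs => psB_zero s hs) ?_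
  exact (isClosed_le continuous_const continuous_abs).inter (isClosed_le continuous_abs continuous_const)

lemma sin_ne (s : ℝ) (h : 1/4 ≤ |s| ∧ |s| ≤ 1) : Real.sin (Real.pi*s/2) ≠ 0 := by
  have hpi := Real.pi_pos
  rcases le_or_gt 0 s with h0 | h0
  · rw [abs_of_nonneg h0] at h
    exact (Real.sin_pos_of_pos_of_lt_pi (by nlinarith) (by nlinarith)).ne'
  · rw [abs_of_neg h0] at h
    exact (Real.sin_neg_of_neg_of_neg_pi_lt (by nlinarith) (by nlinarith)).ne

def lhat (e : ℕ) (s : ℝ) : ℝ := psB s * ((Real.pi/2)^4 * s^e / Real.sin (Real.pi*s/2)^8)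

lemma contDiff_lhat (e : ℕ) : ContDiff ℝ ∞ (lhat e) := by
  rw [contDiff_iff_contDiffAt]
  intro s
  by_cases hs : s ∈ tsupport psB
  · refine contDiff_psB.contDiffAt.mul (ContDiffAt.div ?_ ?_ ?_)
    · fun_prop
    · have : ContDiff ℝ ∞ fun s : ℝ => Real.sin (Real.pi*s/2)^8 := by fun_prop
      exact this.contDiffAt
    · exact pow_ne_zero _ (sin_ne s (tsupport_psB hs))
  · have := notMem_tsupport_iff_eventuallyEq.1 hs
    refine (contDiffAt_const (c := (0:ℝ))).congr_of_eventuallyEq ?_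
    filter_upwards [this] with t ht
    simp [lhat, ht]

lemma lhat_supp (e : ℕ) : HasCompactSupport (lhat e) := by
  refine HasCompactSupport.intro (K := Icc (-1) 1) isCompact_Icc fun s hs => ?_
  have : psB s = 0 := by
    by_contra h
    exact hs (abs_le.1 (psB_zero s h).2)
  simp [lhat, this]

lemma lhat_four (s : ℝ) : lhat 4 s = s^3 * lhat 1 s := by unfold lhat; ring

lemma lhat_kapM (s : ℝ) : lhat 4 s * kapM s^2 = psB s := by
  by_cases h : psB s = 0
  · simp [lhat, h]
  have h1 := psB_zero s h
  have hs : s ≠ 0 := by rintro rfl; norm_num at h1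
  have h2 := sin_ne s h1
  rw [kapM_eq s hs, lhat]
  have hpi := Real.pi_ne_zero
  field_simp

lemma exists_lker (e : ℕ) : ∃ φ : SchwartzMap ℝ ℂ, ∀ s, ∫ t, ch (-(t*s)) * φ t = (lhat e s : ℂ) := by
  have hs : HasCompactSupport fun s => (lhat e s : ℂ) := (lhat_supp e).comp_left (g := fun x : ℝ => (x:ℂ)) rfl
  have hd : ContDiff ℝ ∞ fun s => (lhat e s : ℂ) := Complex.ofRealCLM.contDiff.comp (contDiff_lhat e)
  exact exists_FT1_eq (hs.toSchwartzMap hd)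

lemma lhat_bdd (e : ℕ) : ∃ B : ℝ, ∀ s, |lhat e s| ≤ B := by
  obtain ⟨B, hB⟩ := (lhat_supp e).exists_bound_of_continuous (contDiff_lhat e).continuous
  exact ⟨B, hB⟩

lemma lintegral_cauchy : ∫⁻ y : ℝ, ENNReal.ofReal (1+y^2)⁻¹ = ENNReal.ofReal Real.pi := by
  rw [← ofReal_integral_eq_lintegral_ofReal integrable_inv_one_add_sq (ae_of_all _ fun y => by positivity),
    integral_univ_inv_one_add_sq]

/-- A product Poisson-type average. -/
def Pois2 (r c : ℝ) (h : ℝ × ℝ → ℝ≥0∞) (x : ℝ × ℝ) : ℝ≥0∞ :=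
  ∫⁻ y, ENNReal.ofReal (1+y^2)⁻¹ * ∫⁻ t, ENNReal.ofReal (1+t^2)⁻¹ * h (x.1 - r*y, x.2 - c*t)

lemma double_kernel_le (Φ : ℝ × ℝ → ℂ) (M : ℝ × ℝ → ℝ → ℂ) (D : ℝ) (hD : 0 ≤ D)
    (hM : ∀ y t, ‖Φ y‖ * ‖M y t‖ ≤ D * ((1+y.1^2)⁻¹ * (1+y.2^2)⁻¹ * (1+t^2)⁻¹))
    (h : ℝ × ℝ → ℂ) (hh : Continuous h) (r c : ℝ) (x : ℝ × ℝ) :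
    ‖∫ y, Φ y * ∫ t, M y t * h (x.1 - r*y.1, x.2 - c*t)‖ₑ
      ≤ ENNReal.ofReal (D*Real.pi) * Pois2 r c (fun z => ‖h z‖ₑ) x := by
  have hm2 : Measurable fun y1 : ℝ => ∫⁻ t, ENNReal.ofReal (1+t^2)⁻¹ * ‖h (x.1 - r*y1, x.2 - c*t)‖ₑ := by
    refine Measurable.lintegral_prod_right' (f := fun z : ℝ × ℝ => ENNReal.ofReal (1+z.2^2)⁻¹ * ‖h (x.1 - r*z.1, x.2 - c*z.2)‖ₑ) ?_
    have : Continuous fun z : ℝ × ℝ => h (x.1 - r*z.1, x.2 - c*z.2) := hh.comp (by fun_prop)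
    exact Measurable.mul (by fun_prop) this.measurable.enorm
  calc _ ≤ ∫⁻ y, ‖Φ y * ∫ t, M y t * h (x.1 - r*y.1, x.2 - c*t)‖ₑ := enorm_integral_le_lintegral_enorm _
    _ ≤ ∫⁻ y : ℝ × ℝ, (ENNReal.ofReal (D * (1+y.2^2)⁻¹)) * (ENNReal.ofReal (1+y.1^2)⁻¹ * ∫⁻ t, ENNReal.ofReal (1+t^2)⁻¹ * ‖h (x.1 - r*y.1, x.2 - c*t)‖ₑ) := by
        refine lintegral_mono fun y => ?_
        rw [enorm_mul, ← mul_assoc, ← ENNReal.ofReal_mul (by positivity), ← lintegral_const_mul' _ _ ENNReal.ofReal_ne_top]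
        refine (mul_le_mul le_rfl (enorm_integral_le_lintegral_enorm _) (by simp) (by simp)).trans ?_
        rw [← lintegral_const_mul' _ _ (by simp)]
        refine lintegral_mono fun t => ?_
        rw [enorm_mul, ← mul_assoc, ← mul_assoc, ← ENNReal.ofReal_mul (by positivity)]
        refine mul_le_mul ?_ le_rfl (by simp) (by simp)
        rw [← ofReal_norm, ← ofReal_norm, ← ENNReal.ofReal_mul (by positivity)]
        refine ENNReal.ofReal_le_ofReal ((hM y t).trans (le_of_eq (by ring)))
    _ = ∫⁻ y : ℝ × ℝ, (ENNReal.ofReal (1+y.1^2)⁻¹ * ∫⁻ t, ENNReal.ofReal (1+t^2)⁻¹ * ‖h (x.1 - r*y.1, x.2 - c*t)‖ₑ) * (ENNReal.ofReal (D * (1+y.2^2)⁻¹)) := by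
        congr 1; ext y; rw [mul_comm]
    _ = _ := by
        rw [Measure.volume_eq_prod]
        rw [lintegral_prod_mul (f := fun y1 : ℝ => ENNReal.ofReal (1+y1^2)⁻¹ * ∫⁻ t, ENNReal.ofReal (1+t^2)⁻¹ * ‖h (x.1 - r*y1, x.2 - c*t)‖ₑ)
          (g := fun y2 : ℝ => ENNReal.ofReal (D * (1+y2^2)⁻¹)) (Measurable.mul (by fun_prop) hm2).aemeasurable (by fun_prop)]
        rw [mul_comm, Pois2]
        congr 1
        simp_rw [ENNReal.ofReal_mul hD]
        rw [lintegral_const_mul' _ _ ENNReal.ofReal_ne_top, lintegral_cauchy]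

lemma kernel_repr (Φ : SchwartzMap (ℝ × ℝ) ℂ) (φ : SchwartzMap ℝ ℂ) (H : ℝ × ℝ → ℂ) (hH : Integrable H)
    (r s c : ℝ) (hc : c ≠ 0) (x : ℝ × ℝ) :
    Integrable (fun y : ℝ × ℝ => Φ y * ∫ t, φ (t - s/c*y.2) * FTinv H (x.1 - r*y.1, x.2 - c*t)) ∧
    ∫ y : ℝ × ℝ, Φ y * ∫ t, φ (t - s/c*y.2) * FTinv H (x.1 - r*y.1, x.2 - c*t)
      = FTinv (fun ξ => (FT Φ (r*ξ.1, s*ξ.2) * ∫ t, ch (-(t*(c*ξ.2))) * φ t) * H ξ) x := by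
  have hΦ : Integrable Φ := Φ.integrable
  have hφ : Integrable φ := φ.integrable
  have hcF := continuous_FTinv H hH
  have hint : Integrable (fun z : (ℝ × ℝ) × ℝ => Φ z.1 * φ z.2 * FTinv H (x - (r*z.1.1, s*z.1.2 + c*z.2)))
      ((volume : Measure (ℝ × ℝ)).prod volume) := by
    have := (hΦ.mul_prod hφ).bdd_mul (c := ∫ ξ, ‖H ξ‖) (f := fun z : (ℝ × ℝ) × ℝ => FTinv H (x - (r*z.1.1, s*z.1.2 + c*z.2)))
      (hcF.comp (by fun_prop)).aestronglyMeasurable (ae_of_all _ fun z => norm_FTinv_le H _)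
    exact this.congr (ae_of_all _ fun z => by simp only; ring)
  have hinner : ∀ y : ℝ × ℝ, ∫ t, Φ y * φ t * FTinv H (x - (r*y.1, s*y.2 + c*t))
      = Φ y * ∫ t, φ (t - s/c*y.2) * FTinv H (x.1 - r*y.1, x.2 - c*t) := by
    intro y
    rw [← integral_sub_right_eq_self _ (s/c*y.2), ← integral_const_mul]
    congr 1; ext t
    rw [mul_assoc]; congr 3
    ext
    · simp
    · simp; field_simp; ring
  have hsup := FTinv_superpose ((volume : Measure (ℝ × ℝ)).prod (volume : Measure ℝ)) (fun z => Φ z.1 * φ z.2)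
    (hΦ.mul_prod hφ) (fun z => (r*z.1.1, s*z.1.2 + c*z.2)) (by fun_prop) H hH x
  rw [integral_prod _ hint] at hsup
  simp only [hinner] at hsup
  refine ⟨?_, ?_⟩
  · have := hint.integral_prod_left
    simp only [hinner] at this
    exact this
  · rw [hsup]
    congr 1; ext ξ; congr 1
    rw [FT_eq, ← integral_prod_mul]
    congr 1; ext z
    rw [show -(r*z.1.1*ξ.1 + (s*z.1.2 + c*z.2)*ξ.2) = -(z.1.1*(r*ξ.1)+z.1.2*(s*ξ.2)) + -(z.2*(c*ξ.2)) by ring, ch_add]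
    ring

lemma cauchy_shift (t δ : ℝ) : (1+(t-δ)^2)⁻¹ ≤ 2*(1+δ^2)*(1+t^2)⁻¹ := by
  rw [← div_eq_mul_inv, inv_eq_one_div, div_le_div_iff₀ (by positivity) (by positivity)]
  nlinarith [sq_nonneg (t-2*δ), sq_nonneg (t-δ), mul_nonneg (sq_nonneg δ) (sq_nonneg (t-δ))]

lemma schwartz_diff (φ : SchwartzMap ℝ ℂ) : ∃ C : ℝ, 0 < C ∧ ∀ t δ, ‖φ (t-δ) - φ t‖ ≤ C * |δ| * (1+δ^2) * (1+t^2)⁻¹ := by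
  obtain ⟨C, hC, h⟩ := decay1 (SchwartzMap.derivCLM ℂ ℂ φ)
  refine ⟨C*2, by positivity, fun t δ => ?_⟩
  have := Convex.norm_image_sub_le_of_norm_deriv_le (f := φ) (s := uIcc t (t-δ)) (x := t) (y := t-δ) (C := C*(2*(1+δ^2)*(1+t^2)⁻¹))
    (fun τ _ => φ.differentiableAt) ?_ (convex_uIcc _ _) left_mem_uIcc right_mem_uIcc
  · refine this.trans (le_of_eq ?_)
    rw [show t - δ - t = -δ by ring, norm_neg, Real.norm_eq_abs]; ring
  · intro τ hτ
    have h1 := h τ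
    rw [SchwartzMap.derivCLM_apply] at h1
    refine h1.trans (mul_le_mul_of_nonneg_left ?_ hC.le)
    have h2 := cauchy_shift t (t-τ)
    rw [sub_sub_cancel] at h2
    refine h2.trans ?_
    have : (t-τ)^2 ≤ δ^2 := by
      rw [sq_le_sq]
      have := abs_sub_left_of_mem_uIcc hτ
      rw [abs_sub_comm]; simpa using this
    gcongr

lemma mul_cube (a : SchwartzMap (ℝ × ℝ) ℂ) : ∃ a3 : SchwartzMap (ℝ × ℝ) ℂ, ∀ ξ, a3 ξ = (ξ.2:ℂ)^3 * a ξ := by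
  have hg : (fun ξ : ℝ × ℝ => (ξ.2:ℂ)^3).HasTemperateGrowth := by
    have h : (fun ξ : ℝ × ℝ => (ξ.2:ℂ)).HasTemperateGrowth :=
      (Complex.ofRealCLM.comp (ContinuousLinearMap.snd ℝ ℝ ℝ)).hasTemperateGrowth
    have := (h.mul h).mul h
    refine (congrArg _ ?_).mp this
    ext ξ; simp only [Pi.mul_apply]; ring
  refine ⟨SchwartzMap.smulLeftCLM ℂ (fun ξ : ℝ × ℝ => (ξ.2:ℂ)^3) a, fun ξ => ?_⟩
  rw [SchwartzMap.smulLeftCLM_apply_apply hg, smul_eq_mul]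

/-- The basic kernel estimate. -/
lemma kernel_bound (a : SchwartzMap (ℝ × ℝ) ℂ) (ha : ∀ ξ1, a (ξ1, 0) = 0) :
    ∃ C : ℝ, 0 < C ∧ ∀ r s c : ℝ, 0 < s → 0 < c → ∀ H : ℝ × ℝ → ℂ, Integrable H → ∀ x,
      ‖FTinv (fun ξ => (a (r*ξ.1, s*ξ.2) * (lhat 4 (c*ξ.2) : ℂ)) * H ξ) x‖ₑ
        ≤ ENNReal.ofReal (C * min (s/c) (c/s)) * Pois2 r c (fun z => ‖FTinv H z‖ₑ) x := by
  obtain ⟨Φ, hΦ⟩ := exists_FT_eq a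
  obtain ⟨a3, ha3⟩ := mul_cube a
  obtain ⟨Φ3, hΦ3⟩ := exists_FT_eq a3
  obtain ⟨φ, hφ⟩ := exists_lker 4
  obtain ⟨φ1, hφ1⟩ := exists_lker 1
  obtain ⟨A, hA, hAb⟩ := decay2 Φ
  obtain ⟨A3, hA3, hA3b⟩ := decay2 Φ3
  obtain ⟨D, hD, hDb⟩ := schwartz_diff φ
  obtain ⟨D1, hD1, hD1b⟩ := decay1 φ1
  refine ⟨(A*D + A3*(D1*2))*Real.pi, by positivity, fun r s c hs hc H hH x => ?_⟩
  have hcF := continuous_FTinv H hH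
  set w := s/c with hw
  have hw0 : 0 < w := by positivity
  have hcs : c/s = w⁻¹ := by rw [hw, inv_div]
  rw [hcs]
  rcases le_total w 1 with hw1 | hw1
  · have e1 := kernel_repr Φ φ H hH r s c hc.ne' x
    have e0 := kernel_repr Φ φ H hH r 0 c hc.ne' x
    simp only [hΦ, hφ, zero_mul, ha, zero_div, sub_zero] at e1 e0
    have z0 : FTinv (fun _ : ℝ × ℝ => (0:ℂ)) x = 0 := by simp [FTinv]
    rw [z0] at e0
    have key : FTinv (fun ξ => (a (r*ξ.1, s*ξ.2) * (lhat 4 (c*ξ.2) : ℂ)) * H ξ) x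
        = ∫ y : ℝ × ℝ, Φ y * ∫ t, (φ (t - w*y.2) - φ t) * FTinv H (x.1 - r*y.1, x.2 - c*t) := by
      rw [← e1.2, ← sub_zero (∫ y : ℝ × ℝ, _), ← e0.2, ← integral_sub e1.1 e0.1]
      congr 1; ext y
      rw [← mul_sub]; congr 1
      have hb : ∀ ψ : ℝ → ℂ, Integrable ψ → Integrable fun t => ψ t * FTinv H (x.1 - r*y.1, x.2 - c*t) := fun ψ hψ =>
        hψ.mul_bdd (c := ∫ ξ, ‖H ξ‖) (hcF.comp (by fun_prop)).aestronglyMeasurable (ae_of_all _ fun z => norm_FTinv_le H _)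
      rw [← integral_sub (hb _ (φ.integrable.comp_sub_right _)) (hb _ φ.integrable)]
      congr 1; ext t; ring
    rw [key]
    refine (double_kernel_le Φ (fun y t => φ (t - w*y.2) - φ t) (A*D*w) (by positivity) ?_ _ hcF r c x).trans ?_
    · intro y t
      have h1 : |w*y.2| * (1+(w*y.2)^2) ≤ w * (1+y.2^2)^2 := by
        rw [abs_mul, abs_of_pos hw0]
        have : |y.2| ≤ 1 + y.2^2 := by nlinarith [sq_abs y.2, sq_nonneg (|y.2|-1), abs_nonneg y.2]
        have h3 : (w*y.2)^2 ≤ y.2^2 := by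
          rw [mul_pow]; exact mul_le_of_le_one_left (sq_nonneg _) (pow_le_one₀ hw0.le hw1)
        calc _ = w * (|y.2| * (1+(w*y.2)^2)) := by ring
          _ ≤ w * ((1+y.2^2)*(1+y.2^2)) := by gcongr
          _ = _ := by ring
      calc _ ≤ A * ((1+y.1^2)⁻¹ * ((1+y.2^2)⁻¹)^3) * (D * |w*y.2| * (1+(w*y.2)^2) * (1+t^2)⁻¹) :=
            mul_le_mul (hAb y) (hDb t _) (norm_nonneg _) (by positivity)
        _ = A * ((1+y.1^2)⁻¹ * ((1+y.2^2)⁻¹)^3) * D * (1+t^2)⁻¹ * (|w*y.2| * (1+(w*y.2)^2)) := by ring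
        _ ≤ A * ((1+y.1^2)⁻¹ * ((1+y.2^2)⁻¹)^3) * D * (1+t^2)⁻¹ * (w * (1+y.2^2)^2) := by gcongr
        _ = _ := by field_simp
    · refine mul_le_mul (ENNReal.ofReal_le_ofReal ?_) le_rfl (by simp) (by simp)
      rw [min_eq_left (hw1.trans (by rw [one_le_inv₀ hw0]; exact hw1))]
      have : 0 ≤ A3*(D1*2)*w*Real.pi := by positivity
      nlinarith
  · have e1 := kernel_repr Φ3 φ1 H hH r s c hc.ne' x
    simp only [hΦ3, hφ1, ha3] at e1
    have key : FTinv (fun ξ => (a (r*ξ.1, s*ξ.2) * (lhat 4 (c*ξ.2) : ℂ)) * H ξ) x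
        = ∫ y : ℝ × ℝ, Φ3 y * ∫ t, (((w⁻¹)^3 : ℝ) * φ1 (t - w*y.2)) * FTinv H (x.1 - r*y.1, x.2 - c*t) := by
      have : ∀ y : ℝ × ℝ, Φ3 y * ∫ t, (((w⁻¹)^3 : ℝ) * φ1 (t - w*y.2)) * FTinv H (x.1 - r*y.1, x.2 - c*t)
          = ((w⁻¹)^3 : ℝ) * (Φ3 y * ∫ t, φ1 (t - w*y.2) * FTinv H (x.1 - r*y.1, x.2 - c*t)) := by
        intro y
        simp_rw [mul_assoc]
        rw [integral_const_mul]; ring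
      simp_rw [this]
      rw [integral_const_mul, e1.2, FTinv_eq, FTinv_eq, ← integral_const_mul]
      congr 1; ext ξ
      rw [lhat_four]
      have hs' : (s:ℂ) ≠ 0 := by exact_mod_cast hs.ne'
      have hc' : (c:ℂ) ≠ 0 := by exact_mod_cast hc.ne'
      rw [hw]; push_cast
      field_simp
    rw [key]
    refine (double_kernel_le Φ3 (fun y t => ((w⁻¹)^3 : ℝ) * φ1 (t - w*y.2)) (A3*(D1*2)*w⁻¹) (by positivity) ?_ _ hcF r c x).trans ?_
    · intro y t
      have h1 : 1+(w*y.2)^2 ≤ w^2 * (1+y.2^2) := by nlinarith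
      have h2 : ‖(((w⁻¹)^3 : ℝ):ℂ) * φ1 (t - w*y.2)‖ ≤ (w⁻¹)^3 * (D1 * (2*(w^2*(1+y.2^2))*(1+t^2)⁻¹)) := by
        rw [norm_mul, Complex.norm_real, Real.norm_eq_abs, abs_of_nonneg (by positivity)]
        refine mul_le_mul_of_nonneg_left ((hD1b _).trans (mul_le_mul_of_nonneg_left ((cauchy_shift _ _).trans ?_) hD1.le)) (by positivity)
        gcongr
      calc _ ≤ A3 * ((1+y.1^2)⁻¹ * ((1+y.2^2)⁻¹)^3) * ((w⁻¹)^3 * (D1 * (2*(w^2*(1+y.2^2))*(1+t^2)⁻¹))) :=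
            mul_le_mul (hA3b y) h2 (norm_nonneg _) (by positivity)
        _ = A3*(D1*2)*w⁻¹ * ((1+y.1^2)⁻¹ * (1+y.2^2)⁻¹ * (1+t^2)⁻¹) * (1+y.2^2)⁻¹ := by field_simp
        _ ≤ _ := mul_le_of_le_one_right (by positivity) (inv_le_one_of_one_le₀ (by nlinarith [sq_nonneg y.2]))
    · refine mul_le_mul (ENNReal.ofReal_le_ofReal ?_) le_rfl (by simp) (by simp)
      rw [min_eq_right ((inv_le_one_of_one_le₀ hw1).trans hw1)]
      have : 0 ≤ A*D*w⁻¹*Real.pi := by positivity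
      nlinarith

/-- The modulus of a frequency-localised piece. -/
def hD (F : ℝ × ℝ → ℂ) (c : ℝ) (x : ℝ × ℝ) : ℝ := |(FTinv (fun ξ => (kapM (c*ξ.2) : ℂ) * F ξ) x).re|

/-- The Poisson average of `hD` in the second variable. -/
def H2 (F : ℝ × ℝ → ℂ) (c : ℝ) (x : ℝ × ℝ) : ℝ := ∫ t, (1+t^2)⁻¹ * hD F c (x.1, x.2 - c*t)

/-- The maximal function of `H2` in the first variable. -/
def MM (F : ℝ × ℝ → ℂ) (c : ℝ) (x : ℝ × ℝ) : ℝ≥0∞ := Mmax (fun y => H2 F c (y, x.2)) x.1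

lemma integrable_kapM (H : ℝ × ℝ → ℂ) (hH : Integrable H) (c : ℝ) : Integrable fun ξ : ℝ × ℝ => (kapM (c*ξ.2) : ℂ) * H ξ :=
  integrable_mult _ (Complex.continuous_ofReal.comp (continuous_kapM.comp (by fun_prop))) 2
    (fun ξ => by simpa using kapM_le _) H hH

lemma continuous_hD (F : ℝ × ℝ → ℂ) (hF : Integrable F) (c : ℝ) : Continuous (hD F c) :=
  (Complex.continuous_re.comp (continuous_FTinv _ (integrable_kapM F hF c))).abs

lemma hD_nonneg (F : ℝ × ℝ → ℂ) (c : ℝ) (x) : 0 ≤ hD F c x := abs_nonneg _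

lemma hD_le (F : ℝ × ℝ → ℂ) (c : ℝ) (x) : hD F c x ≤ ∫ ξ, ‖(kapM (c*ξ.2) : ℂ) * F ξ‖ :=
  (Complex.abs_re_le_norm _).trans (norm_FTinv_le _ _)

lemma integrable_H2 (F : ℝ × ℝ → ℂ) (hF : Integrable F) (c : ℝ) (x : ℝ × ℝ) :
    Integrable fun t => (1+t^2)⁻¹ * hD F c (x.1, x.2 - c*t) := by
  refine integrable_inv_one_add_sq.mul_bdd (c := ∫ ξ, ‖(kapM (c*ξ.2) : ℂ) * F ξ‖)
    ((continuous_hD F hF c).comp (by fun_prop)).aestronglyMeasurable (ae_of_all _ fun t => ?_)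
  rw [Real.norm_eq_abs, abs_of_nonneg (hD_nonneg _ _ _)]
  exact hD_le F c _

lemma continuous_H2 (F : ℝ × ℝ → ℂ) (hF : Integrable F) (c : ℝ) : Continuous (H2 F c) := by
  refine continuous_of_dominated (bound := fun t => (1+t^2)⁻¹ * ∫ ξ, ‖(kapM (c*ξ.2) : ℂ) * F ξ‖)
    (fun x => (integrable_H2 F hF c x).aestronglyMeasurable) (fun x => ae_of_all _ fun t => ?_)
    (integrable_inv_one_add_sq.mul_const _) (ae_of_all _ fun t => ?_)
  · rw [Real.norm_eq_abs, abs_of_nonneg (mul_nonneg (by positivity) (hD_nonneg _ _ _))]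
    exact mul_le_mul_of_nonneg_left (hD_le F c _) (by positivity)
  · exact continuous_const.mul ((continuous_hD F hF c).comp (by fun_prop))

lemma H2_nonneg (F : ℝ × ℝ → ℂ) (c : ℝ) (x) : 0 ≤ H2 F c x :=
  integral_nonneg fun t => mul_nonneg (by positivity) (hD_nonneg _ _ _)

lemma ofReal_H2 (F : ℝ × ℝ → ℂ) (hF : Integrable F) (c : ℝ) (x : ℝ × ℝ) :
    ENNReal.ofReal (H2 F c x) = Pois c (fun t => hD F c (x.1, t)) x.2 := by
  rw [H2, ofReal_integral_eq_lintegral_ofReal (integrable_H2 F hF c x)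
    (ae_of_all _ fun t => mul_nonneg (by positivity) (hD_nonneg _ _ _)), Pois]
  congr 1; ext t
  rw [ENNReal.ofReal_mul (by positivity)]

lemma Pois2_eq (F : ℝ × ℝ → ℂ) (hF : Integrable F) (r c : ℝ) (h : ℝ × ℝ → ℂ) (hh : ∀ z, ‖h z‖ₑ = ENNReal.ofReal (hD F c z)) (x : ℝ × ℝ) :
    Pois2 r c (fun z => ‖h z‖ₑ) x = Pois r (fun y => H2 F c (y, x.2)) x.1 := by
  simp only [Pois2, hh, Pois, ofReal_H2 F hF]

lemma Lam_mono_mul (h h' : ℝ → ℝ) (hc : Continuous h) (hc' : Continuous h') (hle : ∀ x, h x ≤ 4 * h' x) (r : ℝ) (hr : 0 < r) (x : ℝ) :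
    Lam r h x ≤ 4 * Lam r h' x := by
  have e : ∀ (g : ℝ → ℝ) a, avgI (fun x => 4 * g x) a r = 4 * avgI g a r := by
    intro g a; unfold avgI; rw [intervalIntegral.integral_const_mul]; ring
  unfold Lam
  rw [← e]
  refine avgI_mono _ _ (continuous_avgI h hc r) (continuous_const.mul (continuous_avgI h' hc' r)) _ _ hr fun a => ?_
  change avgI h a r ≤ 4 * avgI h' a r
  rw [← e]
  exact avgI_mono _ _ hc (continuous_const.mul hc') _ _ hr hle

lemma Mmax_le_mul (h h' : ℝ → ℝ) (hc : Continuous h) (hc' : Continuous h') (hle : ∀ x, h x ≤ 4 * h' x) (x : ℝ) :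
    Mmax h x ≤ 4 * Mmax h' x := by
  refine iSup_le fun j => ?_
  calc _ ≤ ENNReal.ofReal (4 * Lam (2^j) h' x) := ENNReal.ofReal_le_ofReal (Lam_mono_mul h h' hc hc' hle _ (by positivity) x)
    _ = 4 * ENNReal.ofReal (Lam (2^j) h' x) := by rw [ENNReal.ofReal_mul (by norm_num)]; norm_num
    _ ≤ _ := by gcongr; exact le_iSup (fun j : ℤ => ENNReal.ofReal (Lam (2^j) h' x)) j

lemma MM_shift (F : ℝ × ℝ → ℂ) (hF : Integrable F) (c : ℝ) (hc : 0 < c) (x1 a x2 : ℝ) (hax : |a - x2| ≤ c) :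
    MM F c (x1, a) ≤ 4 * MM F c (x1, x2) := by
  have hcont : ∀ z, Continuous fun y => H2 F c (y, z) := fun z => (continuous_H2 F hF c).comp (by fun_prop)
  refine Mmax_le_mul _ _ (hcont _) (hcont _) (fun y => ?_) _
  have := Pois_shift_le c hc (fun t => hD F c (y, t)) a x2 hax
  have e1 := ofReal_H2 F hF c (y, a)
  have e2 := ofReal_H2 F hF c (y, x2)
  simp only at e1 e2
  rw [← e1, ← e2] at this
  have h4 : (4:ℝ≥0∞) = ENNReal.ofReal 4 := by norm_num
  rw [h4, ← ENNReal.ofReal_mul (by norm_num)] at this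
  exact (ENNReal.ofReal_le_ofReal_iff (mul_nonneg (by norm_num) (H2_nonneg _ _ _))).1 this

lemma continuous_avgI_param (g : ℝ × ℝ → ℝ) (hg : Continuous g) (r : ℝ) (hr : r ≠ 0) :
    Continuous fun z : ℝ × ℝ => avgI (fun y => g (y, z.2)) z.1 r := by
  simp_rw [avgI_eq _ _ _ hr]
  have h : Continuous (Function.uncurry fun (z : ℝ × ℝ) (θ : ℝ) => g (z.1 + r*θ, z.2)) :=
    hg.comp (show Continuous fun q : (ℝ × ℝ) × ℝ => (q.1.1 + r*q.2, q.1.2) by fun_prop)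
  exact intervalIntegral.continuous_parametric_intervalIntegral_of_continuous' h 0 1

lemma continuous_Lam_param (g : ℝ × ℝ → ℝ) (hg : Continuous g) (r : ℝ) (hr : r ≠ 0) :
    Continuous fun z : ℝ × ℝ => Lam r (fun y => g (y, z.2)) z.1 := by
  have h1 := continuous_avgI_param g hg r hr
  have h2 := continuous_avgI_param _ h1 r hr
  exact h2.comp (show Continuous fun z : ℝ × ℝ => (z.1 - r, z.2) by fun_prop)

lemma measurable_MM (F : ℝ × ℝ → ℂ) (hF : Integrable F) (c : ℝ) : Measurable (MM F c) :=
  Measurable.iSup fun j => (continuous_Lam_param _ (continuous_H2 F hF c) _ (by positivity)).measurable.ennreal_ofReal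

lemma sum_mul_sq_rpow {κ : Type*} (s : Finset κ) (D : ℝ≥0∞) (X : κ → ℝ≥0∞) (p : ℝ) (hp : 0 ≤ p) :
    (∑ k ∈ s, (D * X k)^2)^(p/2) = D^p * (∑ k ∈ s, (X k)^2)^(p/2) := by
  simp_rw [mul_pow]
  rw [← Finset.mul_sum, ENNReal.mul_rpow_of_nonneg _ _ (by positivity), ← ENNReal.rpow_natCast, ← ENNReal.rpow_mul]
  congr 2; push_cast; ring

lemma hD_eq (F : ℝ × ℝ → ℂ) (hF : Integrable F) (f : ℝ × ℝ → ℝ) (hf : ∀ x, FTinv F x = (f x : ℂ)) (c : ℝ) (hc : c ≠ 0) (x : ℝ × ℝ) :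
    hD F c x = |Lam (c/2) (fun t => f (x.1, t)) x.2 - Lam c (fun t => f (x.1, t)) x.2| ∧
    ‖FTinv (fun ξ => (kapM (c*ξ.2) : ℂ) * F ξ) x‖ₑ = ENNReal.ofReal (hD F c x) := by
  have h := LamDiff_re_im F hF c hc x
  simp only [hf, Complex.ofReal_re, Complex.ofReal_im] at h
  refine ⟨by rw [hD, h.1], ?_⟩
  have h0 : ∀ r x, Lam r (fun _ => (0:ℝ)) x = 0 := by intro r x; simp [Lam, avgI]
  have him := h.2
  rw [h0, h0, sub_zero] at him
  rw [← ofReal_norm, hD]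
  congr 1
  set z := FTinv (fun ξ => (kapM (c*ξ.2) : ℂ) * F ξ) x
  have : z = (z.re : ℂ) := Complex.ext rfl him.symm
  conv_lhs => rw [this]
  rw [Complex.norm_real, Real.norm_eq_abs]

/-- The vector-valued bound for the controlling functions. -/
lemma square_MM (p : ℝ) (hp : 1 < p) (hp2 : p ≤ 2) (F : ℝ × ℝ → ℂ) (hF : Integrable F) (f : ℝ × ℝ → ℝ)
    (hf : ∀ x, FTinv F x = (f x : ℂ)) (l : ℝ) (hl : 0 < l) (N : ℕ) :
    ∫⁻ x : ℝ × ℝ, (∑ k ∈ Finset.range N, MM F (l/2^k) x^2)^(p/2)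
      ≤ 9 * 9 * 4 * 128^2 * (ENNReal.ofReal ((p/(p-1))^p))^3 * ∫⁻ x, ENNReal.ofReal (|f x|^p) := by
  set P := ENNReal.ofReal ((p/(p-1))^p) with hP
  have hfc : Continuous f := by
    have : f = fun x => (FTinv F x).re := by ext x; rw [hf]; simp
    rw [this]; exact Complex.continuous_re.comp (continuous_FTinv F hF)
  have hck : ∀ k : ℕ, 0 < l/2^k := fun k => by positivity
  have hm1 : Measurable fun x : ℝ × ℝ => (∑ k ∈ Finset.range N, MM F (l/2^k) x^2)^(p/2) :=
    Measurable.pow_const (Finset.measurable_fun_sum _ fun k _ => (measurable_MM F hF _).pow_const 2) _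
  have hm2 : Measurable fun x : ℝ × ℝ => (∑ k ∈ Finset.range N, ENNReal.ofReal (H2 F (l/2^k) x)^2)^(p/2) :=
    Measurable.pow_const (Finset.measurable_fun_sum _ fun k _ => ((continuous_H2 F hF _).measurable.ennreal_ofReal).pow_const 2) _
  have step1 : ∀ x2 : ℝ, ∫⁻ x1, (∑ k ∈ Finset.range N, MM F (l/2^k) (x1, x2)^2)^(p/2)
      ≤ 9 * (P * ∫⁻ x1, (∑ k ∈ Finset.range N, ENNReal.ofReal (H2 F (l/2^k) (x1, x2))^2)^(p/2)) := by
    intro x2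
    have := fs_Mmax p hp hp2 (fun (k : Fin N) y => H2 F (l/2^(k:ℕ)) (y, x2))
      (fun k => (continuous_H2 F hF _).comp (by fun_prop)) (fun k y => H2_nonneg _ _ _)
    simp only [Finset.sum_range]
    exact this
  have step2 : ∀ x1 : ℝ, ∫⁻ x2, (∑ k ∈ Finset.range N, ENNReal.ofReal (H2 F (l/2^k) (x1, x2))^2)^(p/2)
      ≤ 128^2 * (9 * (P * ∫⁻ x2, (∑ k ∈ Finset.range N, ENNReal.ofReal (hD F (l/2^k) (x1, x2))^2)^(p/2))) := by
    intro x1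
    have := fs_Mmax p hp hp2 (fun (k : Fin N) t => hD F (l/2^(k:ℕ)) (x1, t))
      (fun k => (continuous_hD F hF _).comp (by fun_prop)) (fun k y => hD_nonneg _ _ _)
    simp only [Finset.sum_range]
    refine le_trans ?_ (mul_le_mul le_rfl this (by simp) (by simp))
    rw [← lintegral_const_mul' _ _ (by simp)]
    refine lintegral_mono fun x2 => ?_
    calc _ ≤ (∑ k : Fin N, (128 * Mmax (fun t => hD F (l/2^(k:ℕ)) (x1, t)) x2)^2)^(p/2) := by
          refine ENNReal.rpow_le_rpow (Finset.sum_le_sum fun k _ => ?_) (by linarith)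
          refine pow_le_pow_left' ?_ 2
          rw [ofReal_H2 F hF]
          exact Pois_le_Mmax _ (hck k) _ ((continuous_hD F hF _).comp (by fun_prop)) (fun _ => hD_nonneg _ _ _) _
      _ = 128^p * (∑ k : Fin N, (Mmax (fun t => hD F (l/2^(k:ℕ)) (x1, t)) x2)^2)^(p/2) := sum_mul_sq_rpow _ _ _ _ (by linarith)
      _ ≤ _ := by
          refine mul_le_mul ?_ le_rfl (by simp) (by simp)
          have : (128:ℝ≥0∞)^2 = 128^(2:ℝ) := by rw [← ENNReal.rpow_natCast]; norm_num
          rw [this]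
          exact ENNReal.rpow_le_rpow_of_exponent_le (by norm_num) hp2
  have step3 : ∀ x1 : ℝ, ∫⁻ x2, (∑ k ∈ Finset.range N, ENNReal.ofReal (hD F (l/2^k) (x1, x2))^2)^(p/2)
      ≤ 4 * (P * ∫⁻ x2, ENNReal.ofReal (|f (x1, x2)|^p)) := by
    intro x1
    refine le_trans (le_of_eq ?_) (square_Lam p hp hp2 l hl N (fun t => f (x1, t)) (hfc.comp (by fun_prop)))
    congr 1; ext x2; congr 1
    refine Finset.sum_congr rfl fun k _ => ?_
    rw [(hD_eq F hF f hf _ (hck k).ne' (x1, x2)).1]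
    have : l/2^k/2 = l/2^(k+1) := by rw [pow_succ]; field_simp
    rw [this]
  rw [Measure.volume_eq_prod, lintegral_prod_symm' _ hm1]
  calc _ ≤ ∫⁻ x2, 9 * P * ∫⁻ x1, (∑ k ∈ Finset.range N, ENNReal.ofReal (H2 F (l/2^k) (x1, x2))^2)^(p/2) :=
        lintegral_mono fun x2 => (step1 x2).trans (le_of_eq (mul_assoc _ _ _).symm)
    _ = 9 * P * ∫⁻ x2, ∫⁻ x1, (∑ k ∈ Finset.range N, ENNReal.ofReal (H2 F (l/2^k) (x1, x2))^2)^(p/2) :=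
        lintegral_const_mul' _ _ (ENNReal.mul_ne_top (by simp) ENNReal.ofReal_ne_top)
    _ = 9 * P * ∫⁻ x1, ∫⁻ x2, (∑ k ∈ Finset.range N, ENNReal.ofReal (H2 F (l/2^k) (x1, x2))^2)^(p/2) := by
        rw [← lintegral_prod_symm' (μ := volume) (ν := volume) _ hm2, lintegral_prod _ hm2.aemeasurable]
    _ ≤ 9 * P * ∫⁻ x1, (128^2 * 9 * P * 4 * P) * ∫⁻ x2, ENNReal.ofReal (|f (x1, x2)|^p) := by
        refine mul_le_mul le_rfl (lintegral_mono fun x1 => ?_) (by simp) (by simp)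
        refine (step2 x1).trans (le_trans (mul_le_mul le_rfl (mul_le_mul le_rfl (mul_le_mul le_rfl (step3 x1) (by simp) (by simp)) (by simp) (by simp)) (by simp) (by simp)) (le_of_eq ?_))
        ring
    _ = 9 * P * ((128^2 * 9 * P * 4 * P) * ∫⁻ x1, ∫⁻ x2, ENNReal.ofReal (|f (x1, x2)|^p)) := by
        rw [lintegral_const_mul']
        refine ENNReal.mul_ne_top (ENNReal.mul_ne_top (ENNReal.mul_ne_top ?_ ENNReal.ofReal_ne_top) (by simp)) ENNReal.ofReal_ne_top
        norm_num
    _ = _ := by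
        rw [lintegral_prod _ (Measurable.aemeasurable (by fun_prop))]
        ring

lemma schwartz_bdd (a : SchwartzMap (ℝ × ℝ) ℂ) : ∃ B : ℝ, 0 < B ∧ ∀ ξ, ‖a ξ‖ ≤ B :=
  ⟨‖a.toBoundedContinuousFunction‖ + 1, by positivity, fun ξ => by
    have := a.toBoundedContinuousFunction.norm_coe_le_norm ξ
    simp only [SchwartzMap.toBoundedContinuousFunction_apply] at this
    linarith⟩

/-- A finite sum of anisotropic dilates of a multiplier. -/
def dilSum {ι : Type*} (a : ℝ × ℝ → ℂ) (J : Finset ι) (r s : ι → ℝ) (ξ : ℝ × ℝ) : ℂ :=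
  ∑ j ∈ J, a (r j * ξ.1, s j * ξ.2)

lemma continuous_dilSum {ι : Type*} (a : SchwartzMap (ℝ × ℝ) ℂ) (J : Finset ι) (r s : ι → ℝ) :
    Continuous (dilSum a J r s) := by
  unfold dilSum
  exact continuous_finsetSum _ fun j _ => a.continuous.comp (by fun_prop)

lemma dilSum_bdd {ι : Type*} (a : SchwartzMap (ℝ × ℝ) ℂ) (J : Finset ι) (r s : ι → ℝ) :
    ∃ B : ℝ, ∀ ξ, ‖dilSum a J r s ξ‖ ≤ B := by
  obtain ⟨B, _, hB⟩ := schwartz_bdd a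
  exact ⟨J.card * B, fun ξ => (norm_sum_le _ _).trans (by simpa using Finset.sum_le_card_nsmul J _ B fun j _ => hB _)⟩

lemma integrable_dilSum {ι : Type*} (a : SchwartzMap (ℝ × ℝ) ℂ) (J : Finset ι) (r s : ι → ℝ) (H : ℝ × ℝ → ℂ) (hH : Integrable H) :
    Integrable fun ξ => dilSum a J r s ξ * H ξ := by
  obtain ⟨B, hB⟩ := dilSum_bdd a J r s
  exact integrable_mult _ (continuous_dilSum a J r s) B hB H hH

lemma integrable_lhat (H : ℝ × ℝ → ℂ) (hH : Integrable H) (c : ℝ) : Integrable fun ξ : ℝ × ℝ => (lhat 4 (c*ξ.2) : ℂ) * H ξ := by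
  obtain ⟨B, hB⟩ := lhat_bdd 4
  exact integrable_mult _ (Complex.continuous_ofReal.comp ((contDiff_lhat 4).continuous.comp (by fun_prop))) B
    (fun ξ => by simpa using hB _) H hH

/-- One frequency-localised piece of a multiplier operator. -/
def pieceM {ι : Type*} (a : ℝ × ℝ → ℂ) (J : Finset ι) (r s : ι → ℝ) (F : ℝ × ℝ → ℂ) (c : ℝ) (ξ : ℝ × ℝ) : ℂ :=
  dilSum a J r s ξ * ((lhat 4 (c*ξ.2) : ℂ) * ((kapM (c*ξ.2) : ℂ) * F ξ))

lemma integrable_pieceM {ι : Type*} (a : SchwartzMap (ℝ × ℝ) ℂ) (J : Finset ι) (r s : ι → ℝ) (F : ℝ × ℝ → ℂ) (hF : Integrable F) (c : ℝ) :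
    Integrable (pieceM a J r s F c) :=
  integrable_dilSum _ _ _ _ _ (integrable_lhat _ (integrable_kapM F hF c) c)

lemma piece_bound (a : SchwartzMap (ℝ × ℝ) ℂ) (C : ℝ) (hC : 0 < C)
    (hk : ∀ r s c : ℝ, 0 < s → 0 < c → ∀ H : ℝ × ℝ → ℂ, Integrable H → ∀ x,
      ‖FTinv (fun ξ => (a (r*ξ.1, s*ξ.2) * (lhat 4 (c*ξ.2) : ℂ)) * H ξ) x‖ₑ
        ≤ ENNReal.ofReal (C * min (s/c) (c/s)) * Pois2 r c (fun z => ‖FTinv H z‖ₑ) x)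
    {ι : Type*} (J : Finset ι) (r s : ι → ℝ) (hr : ∀ j, 0 < r j) (hs : ∀ j, 0 < s j)
    (F : ℝ × ℝ → ℂ) (hF : Integrable F) (f : ℝ × ℝ → ℝ) (hf : ∀ x, FTinv F x = (f x : ℂ))
    (c : ℝ) (hc : 0 < c) (K : ℝ) (hK : ∑ j ∈ J, min (s j / c) (c / s j) ≤ K) (x : ℝ × ℝ) :
    ‖FTinv (pieceM a J r s F c) x‖ₑ ≤ ENNReal.ofReal (128 * C * K) * MM F c x := by
  have e : pieceM a J r s F c = fun ξ => ∑ j ∈ J, (a (r j*ξ.1, s j*ξ.2) * (lhat 4 (c*ξ.2) : ℂ)) * ((kapM (c*ξ.2) : ℂ) * F ξ) := by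
    ext ξ; rw [pieceM, dilSum, Finset.sum_mul]; exact Finset.sum_congr rfl fun j _ => by ring
  have hkF := integrable_kapM F hF c
  have hint : ∀ j ∈ J, Integrable fun ξ => (a (r j*ξ.1, s j*ξ.2) * (lhat 4 (c*ξ.2) : ℂ)) * ((kapM (c*ξ.2) : ℂ) * F ξ) := by
    intro j _
    have := integrable_dilSum a {j} r s _ (integrable_lhat _ hkF c)
    simp only [dilSum, Finset.sum_singleton] at this
    exact this.congr (ae_of_all _ fun ξ => by ring)
  rw [e, FTinv_sum _ _ hint]
  refine (enorm_sum_le _ _).trans ?_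
  calc _ ≤ ∑ j ∈ J, ENNReal.ofReal (C * min (s j/c) (c/s j)) * (128 * MM F c x) := by
        refine Finset.sum_le_sum fun j _ => (hk (r j) (s j) c (hs j) hc _ hkF x).trans ?_
        refine mul_le_mul le_rfl ?_ (by simp) (by simp)
        rw [Pois2_eq F hF _ _ _ (fun z => (hD_eq F hF f hf c hc.ne' z).2)]
        exact Pois_le_Mmax _ (hr j) _ ((continuous_H2 F hF c).comp (by fun_prop)) (fun _ => H2_nonneg _ _ _) _
    _ = ENNReal.ofReal (C * ∑ j ∈ J, min (s j/c) (c/s j)) * (128 * MM F c x) := by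
        rw [← Finset.sum_mul, ← ENNReal.ofReal_sum_of_nonneg, Finset.mul_sum]
        intro j _
        have := hs j
        positivity
    _ ≤ ENNReal.ofReal (C * K) * (128 * MM F c x) :=
        mul_le_mul (ENNReal.ofReal_le_ofReal (mul_le_mul_of_nonneg_left hK hC.le)) le_rfl (by simp) (by simp)
    _ = _ := by
        rw [show 128 * C * K = 128 * (C * K) by ring, ENNReal.ofReal_mul (p := 128) (by norm_num)]
        rw [show ENNReal.ofReal 128 = 128 by norm_num]; ring

lemma telescope_kapM (l s : ℝ) (N : ℕ) :
    ∑ k ∈ Finset.range N, kapM (l/2^k*s) * (lhat 4 (l/2^k*s) * kapM (l/2^k*s)) = thB (2*(l/2^N*s)) - thB (2*(l*s)) := by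
  have h : ∀ k : ℕ, kapM (l/2^k*s) * (lhat 4 (l/2^k*s) * kapM (l/2^k*s)) = thB (2*(l/2^(k+1)*s)) - thB (2*(l/2^k*s)) := by
    intro k
    have := lhat_kapM (l/2^k*s)
    rw [psB] at this
    rw [show 2*(l/2^(k+1)*s) = l/2^k*s by rw [pow_succ]; field_simp, ← this]; ring
  simp_rw [h]
  rw [Finset.sum_range_sub (fun k => (thB (2*(l/2^k*s)) : ℝ))]; simp

/-- Frequency truncation in the second variable. -/
def truncM (l : ℝ) (N : ℕ) (s : ℝ) : ℝ := thB (2*(l/2^N*s)) - thB (2*(l*s))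

lemma truncM_le (l : ℝ) (N : ℕ) (s : ℝ) : |truncM l N s| ≤ 1 := by
  unfold truncM
  have h1 := thB.nonneg (x := 2*(l/2^N*s))
  have h2 := thB.nonneg (x := 2*(l*s))
  have h3 := thB.le_one (x := 2*(l/2^N*s))
  have h4 := thB.le_one (x := 2*(l*s))
  rw [abs_le]; constructor <;> linarith

lemma continuous_truncM (l : ℝ) (N : ℕ) : Continuous (truncM l N) := by
  unfold truncM
  have := thB.continuous
  fun_prop

lemma trunc_eq {ι : Type*} (a : SchwartzMap (ℝ × ℝ) ℂ) (J : Finset ι) (r s : ι → ℝ) (F : ℝ × ℝ → ℂ) (hF : Integrable F)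
    (l : ℝ) (hl : 0 < l) (N : ℕ) (x : ℝ × ℝ) :
    ∑ k ∈ Finset.range N, (Lam (l/2^(k+1)) (fun t => (FTinv (pieceM a J r s F (l/2^k)) (x.1, t)).re) x.2
      - Lam (l/2^k) (fun t => (FTinv (pieceM a J r s F (l/2^k)) (x.1, t)).re) x.2)
      = (FTinv (fun ξ => (truncM l N ξ.2 : ℂ) * (dilSum a J r s ξ * F ξ)) x).re ∧
    ∑ k ∈ Finset.range N, (Lam (l/2^(k+1)) (fun t => (FTinv (pieceM a J r s F (l/2^k)) (x.1, t)).im) x.2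
      - Lam (l/2^k) (fun t => (FTinv (pieceM a J r s F (l/2^k)) (x.1, t)).im) x.2)
      = (FTinv (fun ξ => (truncM l N ξ.2 : ℂ) * (dilSum a J r s ξ * F ξ)) x).im := by
  have h := fun k : ℕ => LamDiff_re_im _ (integrable_pieceM a J r s F hF (l/2^k)) (l/2^k) (by positivity) x
  have e1 : ∀ k : ℕ, l/2^k/2 = l/2^(k+1) := fun k => by rw [pow_succ]; field_simp
  simp only [e1] at h
  have e2 : (fun ξ : ℝ × ℝ => (truncM l N ξ.2 : ℂ) * (dilSum a J r s ξ * F ξ))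
      = fun ξ => ∑ k ∈ Finset.range N, (kapM (l/2^k*ξ.2) : ℂ) * pieceM a J r s F (l/2^k) ξ := by
    ext ξ
    rw [truncM, ← telescope_kapM]
    push_cast
    rw [Finset.sum_mul]
    refine Finset.sum_congr rfl fun k _ => ?_
    rw [pieceM]; ring
  have e3 := FTinv_sum (Finset.range N) (fun k ξ => (kapM (l/2^k*ξ.2) : ℂ) * pieceM a J r s F (l/2^k) ξ)
    (fun k _ => integrable_kapM _ (integrable_pieceM a J r s F hF (l/2^k)) _) x
  rw [e2, e3, Complex.re_sum, Complex.im_sum]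
  exact ⟨Finset.sum_congr rfl fun k _ => (h k).1, Finset.sum_congr rfl fun k _ => (h k).2⟩

lemma enorm_rpow_le_re_im (z : ℂ) (p : ℝ) (hp : 1 < p) (hp2 : p ≤ 2) :
    ‖z‖ₑ^p ≤ 2 * (ENNReal.ofReal (|z.re|^p) + ENNReal.ofReal (|z.im|^p)) := by
  have h1 : ‖z‖ₑ ≤ ENNReal.ofReal |z.re| + ENNReal.ofReal |z.im| := by
    rw [← ENNReal.ofReal_add (abs_nonneg _) (abs_nonneg _), ← ofReal_norm]
    exact ENNReal.ofReal_le_ofReal (Complex.norm_le_abs_re_add_abs_im z)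
  calc _ ≤ (ENNReal.ofReal |z.re| + ENNReal.ofReal |z.im|)^p := ENNReal.rpow_le_rpow h1 (by linarith)
    _ ≤ 2^(p-1) * (ENNReal.ofReal |z.re|^p + ENNReal.ofReal |z.im|^p) := ENNReal.rpow_add_le_mul_rpow_add_rpow _ _ hp.le
    _ ≤ 2^(1:ℝ) * (ENNReal.ofReal |z.re|^p + ENNReal.ofReal |z.im|^p) :=
        mul_le_mul (ENNReal.rpow_le_rpow_of_exponent_le (by norm_num) (by linarith)) le_rfl (by simp) (by simp)
    _ = _ := by
        rw [ENNReal.rpow_one, ENNReal.ofReal_rpow_of_nonneg (abs_nonneg _) (by linarith), ENNReal.ofReal_rpow_of_nonneg (abs_nonneg _) (by linarith)]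

lemma trunc_bound (a : SchwartzMap (ℝ × ℝ) ℂ) (C : ℝ) (hC : 0 < C)
    (hk : ∀ r s c : ℝ, 0 < s → 0 < c → ∀ H : ℝ × ℝ → ℂ, Integrable H → ∀ x,
      ‖FTinv (fun ξ => (a (r*ξ.1, s*ξ.2) * (lhat 4 (c*ξ.2) : ℂ)) * H ξ) x‖ₑ
        ≤ ENNReal.ofReal (C * min (s/c) (c/s)) * Pois2 r c (fun z => ‖FTinv H z‖ₑ) x)
    (p : ℝ) (hp : 1 < p) (hp2 : p ≤ 2)
    {ι ν : Type*} [Fintype ν] [Nonempty ν] (J : Finset ι) (r s : ν → ι → ℝ) (hr : ∀ u j, 0 < r u j) (hs : ∀ u j, 0 < s u j)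
    (F : ℝ × ℝ → ℂ) (hF : Integrable F) (f : ℝ × ℝ → ℝ) (hf : ∀ x, FTinv F x = (f x : ℂ))
    (K : ℝ) (hK : ∀ u, ∀ n : ℤ, ∑ j ∈ J, min (s u j / 2^n) (2^n / s u j) ≤ K) (R : ℤ) (N : ℕ) :
    ∫⁻ x, ⨆ u, ‖FTinv (fun ξ => (truncM (2^R) N ξ.2 : ℂ) * (dilSum a J (r u) (s u) ξ * F ξ)) x‖ₑ^p
      ≤ 4 * ENNReal.ofReal (72 * Real.exp 5 * Real.log (1 + Fintype.card ν) ^ (p/2)) *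
        (ENNReal.ofReal (512 * C * K) ^ p * (9 * 9 * 4 * 128^2 * (ENNReal.ofReal ((p/(p-1))^p))^3 * ∫⁻ x, ENNReal.ofReal (|f x|^p))) := by
  set l : ℝ := 2^R with hl
  have hl0 : 0 < l := by positivity
  have hck : ∀ k : ℕ, l/2^k = 2^(R - k) := fun k => by rw [zpow_sub₀ (by norm_num), zpow_natCast]
  set T : ν → ℝ × ℝ → ℂ := fun u => FTinv (fun ξ => (truncM l N ξ.2 : ℂ) * (dilSum a J (r u) (s u) ξ * F ξ)) with hT
  have hTc : ∀ u, Continuous (T u) := fun u => continuous_FTinv _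
    (integrable_mult _ (Complex.continuous_ofReal.comp ((continuous_truncM l N).comp continuous_snd)) 1
      (fun ξ => by simpa using truncM_le _ _ _) _ (integrable_dilSum a J (r u) (s u) F hF))
  set A := ENNReal.ofReal (72 * Real.exp 5 * Real.log (1 + Fintype.card ν) ^ (p/2)) with hA
  set Q : ℝ × ℝ → ℝ≥0∞ := fun x => (∑ k ∈ Finset.range N, (ENNReal.ofReal (512 * C * K) * MM F (l/2^k) x)^2)^(p/2) with hQ
  have hgc : ∀ u (k : ℕ) x1, Continuous fun t => FTinv (pieceM a J (r u) (s u) F (l/2^k)) (x1, t) := fun u k x1 =>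
    (continuous_FTinv _ (integrable_pieceM a J (r u) (s u) F hF _)).comp (by fun_prop)
  have hgG : ∀ u (k : ℕ) x1 t x2, |t - x2| ≤ l/2^k → ‖FTinv (pieceM a J (r u) (s u) F (l/2^k)) (x1, t)‖ₑ
      ≤ ENNReal.ofReal (512 * C * K) * MM F (l/2^k) (x1, x2) := by
    intro u k x1 t x2 h
    have hc0 : 0 < l/2^k := by positivity
    refine (piece_bound a C hC hk J (r u) (s u) (hr u) (hs u) F hF f hf (l/2^k) hc0 K (by rw [hck]; exact hK u _) _).trans ?_
    refine (mul_le_mul le_rfl (MM_shift F hF _ hc0 x1 t x2 h) (by simp) (by simp)).trans (le_of_eq ?_)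
    rw [show 512 * C * K = (128 * C * K) * 4 by ring, ENNReal.ofReal_mul' (q := 4) (by norm_num), show ENNReal.ofReal 4 = 4 by norm_num]
    ring
  have hre : ∀ x1, ∫⁻ x2, ⨆ u, ENNReal.ofReal (|(T u (x1, x2)).re|^p) ≤ A * ∫⁻ x2, Q (x1, x2) := by
    intro x1
    have := cww_Lam p hp hp2 l hl0 N (fun u k t => (FTinv (pieceM a J (r u) (s u) F (l/2^k)) (x1, t)).re)
      (fun u k => Complex.continuous_re.comp (hgc u k x1)) (fun k t => ENNReal.ofReal (512 * C * K) * MM F (l/2^k) (x1, t))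
      (fun u k t x2 h => le_trans (by rw [← ofReal_norm]; exact ENNReal.ofReal_le_ofReal (Complex.abs_re_le_norm _)) (hgG u k x1 t x2 h))
    refine le_trans (le_of_eq ?_) this
    congr 1; ext x2; congr 1; ext u
    rw [(trunc_eq a J (r u) (s u) F hF l hl0 N (x1, x2)).1]
  have him : ∀ x1, ∫⁻ x2, ⨆ u, ENNReal.ofReal (|(T u (x1, x2)).im|^p) ≤ A * ∫⁻ x2, Q (x1, x2) := by
    intro x1
    have := cww_Lam p hp hp2 l hl0 N (fun u k t => (FTinv (pieceM a J (r u) (s u) F (l/2^k)) (x1, t)).im)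
      (fun u k => Complex.continuous_im.comp (hgc u k x1)) (fun k t => ENNReal.ofReal (512 * C * K) * MM F (l/2^k) (x1, t))
      (fun u k t x2 h => le_trans (by rw [← ofReal_norm]; exact ENNReal.ofReal_le_ofReal (Complex.abs_im_le_norm _)) (hgG u k x1 t x2 h))
    refine le_trans (le_of_eq ?_) this
    congr 1; ext x2; congr 1; ext u
    rw [(trunc_eq a J (r u) (s u) F hF l hl0 N (x1, x2)).2]
  have hQm : Measurable Q := Measurable.pow_const (Finset.measurable_fun_sum _ fun k _ =>
    ((measurable_MM F hF _).const_mul _).pow_const 2) _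
  have hm : Measurable fun x => ⨆ u, ‖T u x‖ₑ^p := Measurable.iSup fun u => ((hTc u).measurable.enorm).pow_const p
  have hmre : ∀ x1, Measurable fun x2 => ⨆ u, ENNReal.ofReal (|(T u (x1, x2)).re|^p) := fun x1 => Measurable.iSup fun u => by
    have : Continuous fun x2 => (T u (x1, x2)).re := Complex.continuous_re.comp ((hTc u).comp (by fun_prop))
    have := this.measurable
    fun_prop
  have hQQ : ∫⁻ x, Q x ≤ ENNReal.ofReal (512 * C * K) ^ p * (9 * 9 * 4 * 128^2 * (ENNReal.ofReal ((p/(p-1))^p))^3 * ∫⁻ x, ENNReal.ofReal (|f x|^p)) := by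
    have : ∀ x, Q x = ENNReal.ofReal (512 * C * K) ^ p * (∑ k ∈ Finset.range N, (MM F (l/2^k) x)^2)^(p/2) := fun x =>
      sum_mul_sq_rpow _ _ _ _ (by linarith)
    simp_rw [this]
    rw [lintegral_const_mul' _ _ (ENNReal.rpow_ne_top_of_nonneg (by linarith) ENNReal.ofReal_ne_top)]
    exact mul_le_mul le_rfl (square_MM p hp hp2 F hF f hf l hl0 N) (by simp) (by simp)
  calc ∫⁻ x, ⨆ u, ‖T u x‖ₑ^p = ∫⁻ x1, ∫⁻ x2, ⨆ u, ‖T u (x1, x2)‖ₑ^p := by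
        rw [Measure.volume_eq_prod, lintegral_prod _ hm.aemeasurable]
    _ ≤ ∫⁻ x1, (4 * A) * ∫⁻ x2, Q (x1, x2) := by
        refine lintegral_mono fun x1 => ?_
        calc _ ≤ ∫⁻ x2, 2 * ((⨆ u, ENNReal.ofReal (|(T u (x1, x2)).re|^p)) + ⨆ u, ENNReal.ofReal (|(T u (x1, x2)).im|^p)) := by
              refine lintegral_mono fun x2 => iSup_le fun u => (enorm_rpow_le_re_im _ p hp hp2).trans ?_
              refine mul_le_mul le_rfl (add_le_add ?_ ?_) (by simp) (by simp)
              · exact le_iSup (fun u => ENNReal.ofReal (|(T u (x1, x2)).re|^p)) u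
              · exact le_iSup (fun u => ENNReal.ofReal (|(T u (x1, x2)).im|^p)) u
          _ ≤ 2 * (A * (∫⁻ x2, Q (x1, x2)) + A * ∫⁻ x2, Q (x1, x2)) := by
              rw [lintegral_const_mul' _ _ (by simp), lintegral_add_left (hmre x1)]
              exact mul_le_mul le_rfl (add_le_add (hre x1) (him x1)) (by simp) (by simp)
          _ = _ := by ring
    _ = (4 * A) * ∫⁻ x, Q x := by
        rw [lintegral_const_mul' _ _ (ENNReal.mul_ne_top (by simp) ENNReal.ofReal_ne_top), Measure.volume_eq_prod, lintegral_prod _ hQm.aemeasurable]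
    _ ≤ _ := mul_le_mul le_rfl hQQ (by simp) (by simp)

lemma truncM_tendsto (s : ℝ) (hs : s ≠ 0) : ∀ᶠ n : ℕ in atTop, truncM (2^(n:ℤ)) (2*n) s = 1 := by
  have h1 : Tendsto (fun n : ℕ => (2:ℝ)^n) atTop atTop := tendsto_pow_atTop_atTop_of_one_lt (by norm_num)
  filter_upwards [h1.eventually_ge_atTop (4*|s|), h1.eventually_ge_atTop (1/|s|)] with n hn1 hn2
  have hp : (0:ℝ) < 2^n := by positivity
  have hs' := abs_pos.2 hs
  rw [div_le_iff₀ hs'] at hn2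
  rw [truncM, thB_one, thB_zero, sub_zero]
  · rw [abs_mul, abs_mul, zpow_natCast, abs_of_pos hp, abs_two]; linarith
  · have : (2:ℝ)^(n:ℤ)/2^(2*n) = 1/2^n := by rw [zpow_natCast, two_mul, pow_add]; field_simp
    rw [this, abs_mul, abs_mul, abs_two, abs_of_pos (by positivity), one_div_mul_eq_div, mul_div_assoc', div_le_iff₀ hp]
    linarith

/-- The maximal inequality for finitely many sums of dilates of a multiplier vanishing on the line `ξ₂ = 0`. -/
lemma max_second (a : SchwartzMap (ℝ × ℝ) ℂ) (ha : ∀ ξ1, a (ξ1, 0) = 0) :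
    ∃ C : ℝ, 0 < C ∧ ∀ (p : ℝ), 1 < p → p ≤ 2 →
    ∀ {ι ν : Type} [Fintype ν] [Nonempty ν] (J : Finset ι) (r s : ν → ι → ℝ), (∀ u j, 0 < r u j) → (∀ u j, 0 < s u j) →
    ∀ (F : ℝ × ℝ → ℂ), Integrable F → ∀ (f : ℝ × ℝ → ℝ), (∀ x, FTinv F x = (f x : ℂ)) →
    ∀ K : ℝ, 0 ≤ K → (∀ u, ∀ n : ℤ, ∑ j ∈ J, min (s u j / 2^n) (2^n / s u j) ≤ K) →
    ∫⁻ x, ⨆ u, ‖FTinv (fun ξ => dilSum a J (r u) (s u) ξ * F ξ) x‖ₑ^p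
      ≤ 4 * ENNReal.ofReal (72 * Real.exp 5 * Real.log (1 + Fintype.card ν) ^ (p/2)) *
        (ENNReal.ofReal (C * K) ^ p * (9 * 9 * 4 * 128^2 * (ENNReal.ofReal ((p/(p-1))^p))^3 * ∫⁻ x, ENNReal.ofReal (|f x|^p))) := by
  obtain ⟨C, hC, hk⟩ := kernel_bound a ha
  refine ⟨512 * C, by positivity, ?_⟩
  intro p hp hp2 ι ν _ _ J r s hr hs F hF f hf K hK0 hK
  refine lintegral_le_of_tendsto (fun n x => ⨆ u, ‖FTinv (fun ξ => (truncM (2^(n:ℤ)) (2*n) ξ.2 : ℂ) * (dilSum a J (r u) (s u) ξ * F ξ)) x‖ₑ^p) _ ?_ ?_ _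
    (fun n => trunc_bound a C hC hk p hp hp2 J r s hr hs F hF f hf K hK n (2*n))
  · intro n
    refine Measurable.iSup fun u => Measurable.pow_const (Measurable.enorm (Continuous.measurable ?_)) p
    exact continuous_FTinv _ (integrable_mult _ (Complex.continuous_ofReal.comp ((continuous_truncM _ _).comp continuous_snd)) 1
      (fun ξ => by simpa using truncM_le _ _ _) _ (integrable_dilSum a J (r u) (s u) F hF))
  · intro x
    simp_rw [← Finset.sup_univ_eq_iSup]
    refine Filter.Tendsto.finset_sup_nhds_apply (L := ℝ≥0∞) fun u _ => ?_
    refine (ENNReal.continuous_rpow_const.tendsto _).comp ?_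
    refine (continuous_enorm.tendsto _).comp ?_
    simp only [FTinv_eq]
    have hint := integrable_dilSum a J (r u) (s u) F hF
    refine tendsto_integral_of_dominated_convergence (fun ξ => ‖dilSum a J (r u) (s u) ξ * F ξ‖) ?_ hint.norm ?_ ?_
    · intro n
      exact (FTinv_integrable _ (integrable_mult _ (Complex.continuous_ofReal.comp ((continuous_truncM _ _).comp continuous_snd)) 1
        (fun ξ => by simpa using truncM_le _ _ _) _ hint) x).aestronglyMeasurable
    · intro n
      refine ae_of_all _ fun ξ => ?_
      rw [norm_mul, norm_ch, one_mul, norm_mul]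
      refine mul_le_of_le_one_left (norm_nonneg _) ?_
      simpa using truncM_le _ _ _
    · refine ae_of_all _ fun ξ => ?_
      by_cases h0 : ξ.2 = 0
      · have : dilSum a J (r u) (s u) ξ = 0 := by
          rw [dilSum]; exact Finset.sum_eq_zero fun j _ => by rw [h0, mul_zero]; exact ha _
        simp [this]
      · refine tendsto_const_nhds.congr' ?_
        filter_upwards [truncM_tendsto ξ.2 h0] with n hn
        rw [hn]; simp

/-- The linear form with given partial derivatives. -/
def pgrad (a b : ℂ) : ℝ × ℝ →L[ℝ] ℂ :=
  (ContinuousLinearMap.fst ℝ ℝ ℝ).smulRight a + (ContinuousLinearMap.snd ℝ ℝ ℝ).smulRight b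

lemma schwartz_of_class (S : Set (ℝ × ℝ → ℂ))
    (hd : ∀ g ∈ S, ∃ g1 ∈ S, ∃ g2 ∈ S, ∀ ξ, HasFDerivAt g (pgrad (g1 ξ) (g2 ξ)) ξ)
    (hb : ∀ g ∈ S, ∀ k : ℕ, ∃ C : ℝ, ∀ ξ, ‖ξ‖^k * ‖g ξ‖ ≤ C) (g : ℝ × ℝ → ℂ) (hg : g ∈ S) :
    ∃ a : SchwartzMap (ℝ × ℝ) ℂ, ⇑a = g := by
  have e : ∀ g g1 g2 : ℝ × ℝ → ℂ, (∀ ξ, HasFDerivAt g (pgrad (g1 ξ) (g2 ξ)) ξ) →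
      fderiv ℝ g = ((ContinuousLinearMap.smulRightL ℝ (ℝ × ℝ) ℂ (ContinuousLinearMap.fst ℝ ℝ ℝ)) ∘ g1)
        + ((ContinuousLinearMap.smulRightL ℝ (ℝ × ℝ) ℂ (ContinuousLinearMap.snd ℝ ℝ ℝ)) ∘ g2) := by
    intro g g1 g2 h; ext1 ξ; exact (h ξ).fderiv
  have hsm : ∀ n : ℕ, ∀ g ∈ S, ContDiff ℝ n g := by
    intro n
    induction n with
    | zero =>
      intro g hg
      obtain ⟨g1, _, g2, _, h⟩ := hd g hg
      simp only [Nat.cast_zero, contDiff_zero]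
      exact continuous_iff_continuousAt.2 fun ξ => (h ξ).continuousAt
    | succ n ih =>
      intro g hg
      obtain ⟨g1, hg1, g2, hg2, h⟩ := hd g hg
      rw [Nat.cast_succ, contDiff_succ_iff_fderiv]
      refine ⟨fun ξ => (h ξ).differentiableAt, by simp, ?_⟩
      rw [e g g1 g2 h]
      exact ((ContinuousLinearMap.contDiff _).comp (ih g1 hg1)).add ((ContinuousLinearMap.contDiff _).comp (ih g2 hg2))
  have hdec : ∀ n : ℕ, ∀ g ∈ S, ∀ k : ℕ, ∃ C : ℝ, ∀ ξ, ‖ξ‖^k * ‖iteratedFDeriv ℝ n g ξ‖ ≤ C := by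
    intro n
    induction n with
    | zero => intro g hg k; simpa using hb g hg k
    | succ n ih =>
      intro g hg k
      obtain ⟨g1, hg1, g2, hg2, h⟩ := hd g hg
      obtain ⟨C1, hC1⟩ := ih g1 hg1 k
      obtain ⟨C2, hC2⟩ := ih g2 hg2 k
      set L1 := ContinuousLinearMap.smulRightL ℝ (ℝ × ℝ) ℂ (ContinuousLinearMap.fst ℝ ℝ ℝ)
      set L2 := ContinuousLinearMap.smulRightL ℝ (ℝ × ℝ) ℂ (ContinuousLinearMap.snd ℝ ℝ ℝ)
      refine ⟨‖L1‖ * C1 + ‖L2‖ * C2, fun ξ => ?_⟩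
      have c1 := (hsm n g1 hg1).contDiffAt (x := ξ)
      have c2 := (hsm n g2 hg2).contDiffAt (x := ξ)
      rw [← norm_iteratedFDeriv_fderiv, e g g1 g2 h, iteratedFDeriv_add_apply
        ((ContinuousLinearMap.contDiff _).contDiffAt.comp _ c1) ((ContinuousLinearMap.contDiff _).contDiffAt.comp _ c2)]
      calc _ ≤ ‖ξ‖^k * (‖L1‖ * ‖iteratedFDeriv ℝ n g1 ξ‖ + ‖L2‖ * ‖iteratedFDeriv ℝ n g2 ξ‖) := by
            refine mul_le_mul_of_nonneg_left ((norm_add_le _ _).trans (add_le_add ?_ ?_)) (by positivity)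
            · exact L1.norm_iteratedFDeriv_comp_left c1 le_rfl
            · exact L2.norm_iteratedFDeriv_comp_left c2 le_rfl
        _ = ‖L1‖ * (‖ξ‖^k * ‖iteratedFDeriv ℝ n g1 ξ‖) + ‖L2‖ * (‖ξ‖^k * ‖iteratedFDeriv ℝ n g2 ξ‖) := by ring
        _ ≤ _ := add_le_add (mul_le_mul_of_nonneg_left (hC1 ξ) L1.opNorm_nonneg) (mul_le_mul_of_nonneg_left (hC2 ξ) L2.opNorm_nonneg)
  exact ⟨⟨g, contDiff_infty.2 fun n => hsm n g hg, fun k n => hdec n g hg k⟩, rfl⟩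

lemma schwartz_tensor (α β : SchwartzMap ℝ ℂ) : ∃ a : SchwartzMap (ℝ × ℝ) ℂ, ∀ ξ, a ξ = α ξ.1 * β ξ.2 := by
  suffices h : ∃ a : SchwartzMap (ℝ × ℝ) ℂ, ⇑a = fun ξ : ℝ × ℝ => α ξ.1 * β ξ.2 by
    obtain ⟨a, ha⟩ := h
    exact ⟨a, fun ξ => by rw [ha]⟩
  refine schwartz_of_class {g | ∃ α β : SchwartzMap ℝ ℂ, g = fun ξ => α ξ.1 * β ξ.2} ?_ ?_ _ ⟨α, β, rfl⟩
  · rintro _ ⟨α, β, rfl⟩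
    refine ⟨_, ⟨SchwartzMap.derivCLM ℝ ℂ α, β, rfl⟩, _, ⟨α, SchwartzMap.derivCLM ℝ ℂ β, rfl⟩, fun ξ => ?_⟩
    have h1 : HasFDerivAt (fun ξ : ℝ × ℝ => α ξ.1) _ ξ := (α.hasDerivAt ξ.1).hasFDerivAt.comp ξ hasFDerivAt_fst
    have h2 : HasFDerivAt (fun ξ : ℝ × ℝ => β ξ.2) _ ξ := (β.hasDerivAt ξ.2).hasFDerivAt.comp ξ hasFDerivAt_snd
    refine (h1.mul h2).congr_fderiv ?_
    ext <;> simp [pgrad, SchwartzMap.derivCLM_apply, mul_comm]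
  · rintro _ ⟨α, β, rfl⟩ k
    obtain ⟨A0, _, hA0⟩ := α.decay 0 0
    obtain ⟨Ak, _, hAk⟩ := α.decay k 0
    obtain ⟨B0, _, hB0⟩ := β.decay 0 0
    obtain ⟨Bk, _, hBk⟩ := β.decay k 0
    have hA0 : ∀ x, ‖α x‖ ≤ A0 := fun x => by simpa using hA0 x
    have hB0 : ∀ x, ‖β x‖ ≤ B0 := fun x => by simpa using hB0 x
    have hAk : ∀ x, ‖x‖^k * ‖α x‖ ≤ Ak := fun x => by simpa using hAk x
    have hBk : ∀ x, ‖x‖^k * ‖β x‖ ≤ Bk := fun x => by simpa using hBk x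
    have hA00 := (norm_nonneg _).trans (hA0 0)
    have hB00 := (norm_nonneg _).trans (hB0 0)
    have hAk0 : 0 ≤ Ak := le_trans (by positivity) (hAk 0)
    have hBk0 : 0 ≤ Bk := le_trans (by positivity) (hBk 0)
    refine ⟨Ak * B0 + A0 * Bk, fun ξ => ?_⟩
    rw [norm_mul]
    rcases le_total ‖ξ.1‖ ‖ξ.2‖ with h | h
    · rw [show ‖ξ‖ = ‖ξ.2‖ by rw [Prod.norm_def, max_eq_right h]]
      calc _ = ‖α ξ.1‖ * (‖ξ.2‖^k * ‖β ξ.2‖) := by ring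
        _ ≤ A0 * Bk := mul_le_mul (hA0 _) (hBk _) (by positivity) hA00
        _ ≤ _ := by nlinarith [mul_nonneg hAk0 hB00]
    · rw [show ‖ξ‖ = ‖ξ.1‖ by rw [Prod.norm_def, max_eq_left h]]
      calc _ = (‖ξ.1‖^k * ‖α ξ.1‖) * ‖β ξ.2‖ := by ring
        _ ≤ Ak * B0 := mul_le_mul (hAk _) (hB0 _) (by positivity) hAk0
        _ ≤ _ := by nlinarith [mul_nonneg hA00 hBk0]

lemma schwartz_split (a : SchwartzMap (ℝ × ℝ) ℂ) (ha : a 0 = 0) :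
    ∃ a1 a2 : SchwartzMap (ℝ × ℝ) ℂ, a = a1 + a2 ∧ (∀ y, a1 (0, y) = 0) ∧ ∀ x, a2 (x, 0) = 0 := by
  set α : SchwartzMap ℝ ℂ := SchwartzMap.compCLM ℝ (g := fun x : ℝ => ((x, 0) : ℝ × ℝ))
    (ContinuousLinearMap.inl ℝ ℝ ℝ).hasTemperateGrowth ⟨1, 1, fun x => by simp [Prod.norm_def]⟩ a with hα
  have hα' : ∀ x, α x = a (x, 0) := fun x => by rw [hα]; rfl
  have hs : HasCompactSupport fun x => (thB x : ℂ) :=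
    HasCompactSupport.comp_left (g := fun r : ℝ => (r : ℂ)) thB.hasCompactSupport (by simp)
  have hc : ContDiff ℝ ∞ fun x => (thB x : ℂ) := by
    have h1 : ContDiff ℝ ∞ (fun x => thB x) := thB.contDiff
    exact Complex.ofRealCLM.contDiff.comp h1
  set β : SchwartzMap ℝ ℂ := hs.toSchwartzMap hc with hβ
  have hβ' : ∀ x, β x = thB x := fun x => rfl
  obtain ⟨a1, ha1⟩ := schwartz_tensor α β
  refine ⟨a1, a - a1, by simp, fun y => ?_, fun x => ?_⟩
  · rw [ha1, hα']
    rw [show ((0:ℝ), (0:ℝ)) = 0 from rfl, ha, zero_mul]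
  · rw [sub_apply, ha1, hα', hβ', thB_one 0 (by norm_num)]; simp

lemma FTinv_swap (H : ℝ × ℝ → ℂ) (x : ℝ × ℝ) : FTinv H x = FTinv (H ∘ Prod.swap) x.swap := by
  rw [FTinv_eq, FTinv_eq, Measure.volume_eq_prod, ← integral_prod_swap]
  congr 1; ext ξ
  simp only [Function.comp, Prod.fst_swap, Prod.snd_swap, add_comm]

lemma lintegral_swap (g : ℝ × ℝ → ℝ≥0∞) : ∫⁻ x : ℝ × ℝ, g x.swap = ∫⁻ x, g x :=
  Measure.measurePreserving_swap.lintegral_comp_emb MeasurableEquiv.prodComm.measurableEmbedding g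

/-- The maximal inequality for multipliers vanishing on the line `ξ₁ = 0`. -/
lemma max_first (a : SchwartzMap (ℝ × ℝ) ℂ) (ha : ∀ y, a (0, y) = 0) :
    ∃ C : ℝ, 0 < C ∧ ∀ (p : ℝ), 1 < p → p ≤ 2 →
    ∀ {ι ν : Type} [Fintype ν] [Nonempty ν] (J : Finset ι) (r s : ν → ι → ℝ), (∀ u j, 0 < r u j) → (∀ u j, 0 < s u j) →
    ∀ (F : ℝ × ℝ → ℂ), Integrable F → ∀ (f : ℝ × ℝ → ℝ), (∀ x, FTinv F x = (f x : ℂ)) →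
    ∀ K : ℝ, 0 ≤ K → (∀ u, ∀ n : ℤ, ∑ j ∈ J, min (r u j / 2^n) (2^n / r u j) ≤ K) →
    ∫⁻ x, ⨆ u, ‖FTinv (fun ξ => dilSum a J (r u) (s u) ξ * F ξ) x‖ₑ^p
      ≤ 4 * ENNReal.ofReal (72 * Real.exp 5 * Real.log (1 + Fintype.card ν) ^ (p/2)) *
        (ENNReal.ofReal (C * K) ^ p * (9 * 9 * 4 * 128^2 * (ENNReal.ofReal ((p/(p-1))^p))^3 * ∫⁻ x, ENNReal.ofReal (|f x|^p))) := by
  set a' := SchwartzMap.compCLMOfContinuousLinearEquiv ℝ (ContinuousLinearEquiv.prodComm ℝ ℝ ℝ) a with ha'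
  have e : ∀ x y, a' (x, y) = a (y, x) := fun x y => rfl
  obtain ⟨C, hC, h⟩ := max_second a' (fun x => by rw [e]; exact ha _)
  refine ⟨C, hC, fun p hp hp2 ι ν _ _ J r s hr hs F hF f hf K hK0 hK => ?_⟩
  have := h p hp hp2 J s r hs hr (F ∘ Prod.swap) hF.swap (f ∘ Prod.swap) (fun x => by
    rw [Function.comp, ← hf, FTinv_swap F x.swap, Prod.swap_swap]) K hK0 hK
  rw [show ∫⁻ x, ENNReal.ofReal (|(f ∘ Prod.swap) x|^p) = ∫⁻ x, ENNReal.ofReal (|f x|^p) from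
    lintegral_swap fun x => ENNReal.ofReal (|f x|^p)] at this
  refine le_trans (le_of_eq ?_) this
  rw [← lintegral_swap]
  congr 1; ext x; congr 1; ext u
  rw [FTinv_swap, Prod.swap_swap]
  rfl

lemma summable_geo_int : Summable fun m : ℤ => 2 * (1/2:ℝ)^m.natAbs := by
  refine Summable.mul_left _ (Summable.of_nat_of_neg ?_ ?_)
  · simpa using summable_geometric_of_lt_one (r := (1/2:ℝ)) (by norm_num) (by norm_num)
  · simpa using summable_geometric_of_lt_one (r := (1/2:ℝ)) (by norm_num) (by norm_num)

lemma geo_term (β : ℝ) (hβ : 1 ≤ β) (v : ℝ) (j : ℤ) :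
    min ((2:ℝ)^(v - j*β)) ((2:ℝ)^(j*β - v)) ≤ 2 * (1/2:ℝ)^(j - ⌊v/β⌋).natAbs := by
  set j0 := ⌊v/β⌋
  have hb0 : 0 < β := by linarith
  have h1 : (j0:ℝ) ≤ v/β := Int.floor_le _
  have h2 : v/β < j0 + 1 := Int.lt_floor_add_one _
  have hv : v = β * (v/β) := by field_simp
  set w := v/β
  have e : 2 * (1/2:ℝ)^(j - j0).natAbs = (2:ℝ)^(1 - |(j:ℝ) - j0|) := by
    rw [Real.rpow_sub (by norm_num), Real.rpow_one]
    have : |(j:ℝ) - j0| = ((j - j0).natAbs : ℝ) := by rw [Nat.cast_natAbs]; push_cast; rfl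
    rw [this, Real.rpow_natCast, one_div, inv_pow]; rfl
  rw [e]
  rcases le_or_gt j j0 with h | h
  · refine (min_le_right _ _).trans (Real.rpow_le_rpow_of_exponent_le (by norm_num) ?_)
    have h' : (j:ℝ) ≤ j0 := by exact_mod_cast h
    rw [abs_of_nonpos (by linarith), hv]
    nlinarith
  · refine (min_le_left _ _).trans (Real.rpow_le_rpow_of_exponent_le (by norm_num) ?_)
    have h' : (j0:ℝ) + 1 ≤ j := by exact_mod_cast h
    rw [abs_of_nonneg (by linarith), hv]
    nlinarith

lemma geo_sum : ∃ K : ℝ, 0 < K ∧ ∀ β y : ℝ, 1 ≤ β → 0 < y → ∀ J : Finset ℤ, ∀ n : ℤ,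
    ∑ j ∈ J, min ((2:ℝ)^(-((j:ℝ)*β)) * y / 2^n) (2^n / ((2:ℝ)^(-((j:ℝ)*β)) * y)) ≤ K := by
  refine ⟨(∑' m : ℤ, 2 * (1/2:ℝ)^m.natAbs) + 1, add_pos_of_nonneg_of_pos (tsum_nonneg fun _ => by positivity) one_pos, ?_⟩
  intro β y hβ hy J n
  set v := Real.logb 2 (y/2^n)
  have hv : (2:ℝ)^v = y/2^n := Real.rpow_logb (by norm_num) (by norm_num) (by positivity)
  have hterm : ∀ j : ℤ, min ((2:ℝ)^(-((j:ℝ)*β)) * y / 2^n) (2^n / ((2:ℝ)^(-((j:ℝ)*β)) * y)) ≤ 2 * (1/2:ℝ)^(j - ⌊v/β⌋).natAbs := by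
    intro j
    refine le_trans (le_of_eq ?_) (geo_term β hβ v j)
    congr 1
    · rw [sub_eq_neg_add, Real.rpow_add (by norm_num), hv, mul_div_assoc]
    · rw [Real.rpow_sub (by norm_num), hv, Real.rpow_neg (by norm_num)]
      field_simp
  have hs := summable_geo_int.comp_injective (sub_left_injective (b := ⌊v/β⌋))
  calc _ ≤ ∑ j ∈ J, 2 * (1/2:ℝ)^(j - ⌊v/β⌋).natAbs := Finset.sum_le_sum fun j _ => hterm j
    _ ≤ ∑' j : ℤ, 2 * (1/2:ℝ)^(j - ⌊v/β⌋).natAbs := hs.sum_le_tsum _ fun _ _ => by positivity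
    _ = ∑' m : ℤ, 2 * (1/2:ℝ)^m.natAbs := (Equiv.subRight ⌊v/β⌋).tsum_eq fun m : ℤ => 2 * (1/2:ℝ)^m.natAbs
    _ ≤ _ := by linarith

lemma const_bound (p : ℝ) (hp : 1 < p) (hp2 : p ≤ 2) (C L : ℝ) (hC : 0 ≤ C) (hL : 0 ≤ L) (I : ℝ≥0∞) :
    4 * ENNReal.ofReal (72 * Real.exp 5 * L ^ (p/2)) *
        (ENNReal.ofReal C ^ p * (9 * 9 * 4 * 128^2 * (ENNReal.ofReal ((p/(p-1))^p))^3 * I))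
      ≤ ENNReal.ofReal ((4 * (72 * Real.exp 5) * (9 * 9 * 4 * 128^2) * 8) * C * (p-1)^(-3:ℝ) * √L)^p * I := by
  have hp1 : 0 < p - 1 := by linarith
  have h5 : 1 ≤ Real.exp 5 := Real.one_le_exp (by norm_num)
  set E : ℝ := 4 * (72 * Real.exp 5) * (9 * 9 * 4 * 128^2) with hE
  have hE1 : 1 ≤ E := by rw [hE]; nlinarith
  have e1 : 4 * ENNReal.ofReal (72 * Real.exp 5 * L ^ (p/2)) *
        (ENNReal.ofReal C ^ p * (9 * 9 * 4 * 128^2 * (ENNReal.ofReal ((p/(p-1))^p))^3 * I))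
      = ENNReal.ofReal (E * (√L)^p * C^p * ((p/(p-1))^p)^3) * I := by
    have : L^(p/2) = (√L)^p := by
      rw [Real.sqrt_eq_rpow, ← Real.rpow_mul hL]; congr 1; ring
    rw [this, ENNReal.ofReal_rpow_of_nonneg hC (by linarith), ← ENNReal.ofReal_pow (by positivity)]
    have hEof : ENNReal.ofReal E = 4 * ENNReal.ofReal (72 * Real.exp 5) * (9 * 9 * 4 * 128^2) := by
      rw [hE, ENNReal.ofReal_mul (p := 4 * (72 * Real.exp 5)) (by positivity), ENNReal.ofReal_mul (p := 4) (by positivity)]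
      norm_num
    rw [ENNReal.ofReal_mul (p := E * (√L)^p * C^p) (by positivity), ENNReal.ofReal_mul (p := E * (√L)^p) (by positivity),
      ENNReal.ofReal_mul (p := E) (by positivity), hEof,
      ENNReal.ofReal_mul (p := 72 * Real.exp 5) (q := (√L)^p) (by positivity)]
    ring
  rw [e1, ENNReal.ofReal_rpow_of_nonneg (by positivity) (by linarith)]
  refine mul_le_mul (ENNReal.ofReal_le_ofReal ?_) le_rfl (by simp) (by simp)
  have e2 : ((p/(p-1))^p)^3 ≤ (8 * (p-1)^(-3:ℝ))^p := by
    rw [← Real.rpow_natCast, ← Real.rpow_mul (by positivity), mul_comm p, Real.rpow_mul (by positivity)]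
    refine Real.rpow_le_rpow (by positivity) ?_ (by linarith)
    rw [Real.rpow_neg hp1.le, Real.div_rpow (by linarith) hp1.le, div_eq_mul_inv]
    push_cast
    refine mul_le_mul_of_nonneg_right ?_ (by positivity)
    have : (8:ℝ) = 2^(3:ℝ) := by norm_num
    rw [this]
    exact Real.rpow_le_rpow (by linarith) hp2 (by norm_num)
  have e3 : E ≤ E^p := Real.self_le_rpow_of_one_le hE1 hp.le
  calc _ ≤ E^p * (√L)^p * C^p * (8 * (p-1)^(-3:ℝ))^p := by gcongr
    _ = _ := by
        rw [← Real.mul_rpow (by positivity) (by positivity), ← Real.mul_rpow (by positivity) (by positivity), ← Real.mul_rpow (by positivity) (by positivity)]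
        congr 1; ring

lemma FTinv_add (G H : ℝ × ℝ → ℂ) (hG : Integrable G) (hH : Integrable H) (x : ℝ × ℝ) :
    FTinv (fun ξ => G ξ + H ξ) x = FTinv G x + FTinv H x := by
  simp only [FTinv_eq, mul_add]
  exact integral_add (FTinv_integrable G hG x) (FTinv_integrable H hH x)

/-- The partial sums of a lacunary multiplier. -/
def parM (b : ℝ) (a : ℝ × ℝ → ℂ) (J : Finset ℤ) (u : ℝ) (ξ : ℝ × ℝ) : ℂ := ∑ j ∈ J, a (dil b j u ξ)

lemma parM_eq (b : ℝ) (a : ℝ × ℝ → ℂ) (J : Finset ℤ) (u : ℝ) :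
    parM b a J u = dilSum a J (fun j : ℤ => (2:ℝ)^(-(j:ℝ))) (fun j : ℤ => (2:ℝ)^(-((j:ℝ)*b)) * u) := by
  ext ξ; simp only [parM, dilSum, dil, mul_assoc]

lemma enorm_add_rpow_le (z w : ℂ) (p : ℝ) (hp : 1 < p) (hp2 : p ≤ 2) : ‖z + w‖ₑ^p ≤ 2 * (‖z‖ₑ^p + ‖w‖ₑ^p) := by
  calc _ ≤ (‖z‖ₑ + ‖w‖ₑ)^p := ENNReal.rpow_le_rpow (enorm_add_le _ _) (by linarith)
    _ ≤ 2^(p-1) * (‖z‖ₑ^p + ‖w‖ₑ^p) := ENNReal.rpow_add_le_mul_rpow_add_rpow _ _ hp.le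
    _ ≤ 2^(1:ℝ) * (‖z‖ₑ^p + ‖w‖ₑ^p) :=
        mul_le_mul (ENNReal.rpow_le_rpow_of_exponent_le (by norm_num) (by linarith)) le_rfl (by simp) (by simp)
    _ = _ := by rw [ENNReal.rpow_one]

/-- The maximal inequality for finitely many scales and dilations. -/
theorem max_finite (b : ℝ) (hb : 1 < b) (a : SchwartzMap (ℝ × ℝ) ℂ) (ha : a 0 = 0) :
    ∃ C : ℝ, 0 < C ∧ ∀ (p : ℝ), 1 < p → p ≤ 2 →
    ∀ {ν : Type} [Fintype ν] [Nonempty ν] (v : ν → ℝ), (∀ u, 0 < v u) → ∀ J : Finset ℤ,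
    ∀ (F : ℝ × ℝ → ℂ), Integrable F → ∀ (f : ℝ × ℝ → ℝ), (∀ x, FTinv F x = (f x : ℂ)) →
    ∫⁻ x, ⨆ u, ‖FTinv (fun ξ => parM b a J (v u) ξ * F ξ) x‖ₑ^p
      ≤ ENNReal.ofReal (C * (p-1)^(-3:ℝ) * √(Real.log (1 + Fintype.card ν)))^p * ∫⁻ x, ENNReal.ofReal (|f x|^p) := by
  obtain ⟨K, hK0, hK⟩ := geo_sum
  obtain ⟨a1, a2, rfl, h1, h2⟩ := schwartz_split a ha
  obtain ⟨C1, hC1, hb1⟩ := max_first a1 h1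
  obtain ⟨C2, hC2, hb2⟩ := max_second a2 h2
  set E : ℝ := (4 * (72 * Real.exp 5) * (9 * 9 * 4 * 128^2) * 8) with hE
  have hE0 : 0 < E := by positivity
  refine ⟨4 * (E * ((C1 + C2) * K)), by positivity, ?_⟩
  intro p hp hp2 ν _ _ v hv J F hF f hf
  set r : ν → ℤ → ℝ := fun _ j => (2:ℝ)^(-(j:ℝ))
  set s : ν → ℤ → ℝ := fun u j => (2:ℝ)^(-((j:ℝ)*b)) * v u
  have hr : ∀ u j, 0 < r u j := fun u j => by positivity
  have hs : ∀ u j, 0 < s u j := fun u j => mul_pos (by positivity) (hv u)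
  have hL : 0 ≤ Real.log (1 + Fintype.card ν) := Real.log_nonneg (by simp)
  set L := Real.log (1 + Fintype.card ν)
  set I := ∫⁻ x, ENNReal.ofReal (|f x|^p)
  have hm : ∀ (C : ℝ), 0 < C → C ≤ C1 + C2 → 4 * ENNReal.ofReal (72 * Real.exp 5 * L ^ (p/2)) *
        (ENNReal.ofReal (C * K) ^ p * (9 * 9 * 4 * 128^2 * (ENNReal.ofReal ((p/(p-1))^p))^3 * I))
        ≤ ENNReal.ofReal (E * ((C1 + C2) * K) * (p-1)^(-3:ℝ) * √L)^p * I := by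
    intro C hC hle
    refine (const_bound p hp hp2 (C*K) L (by positivity) hL I).trans ?_
    refine mul_le_mul (ENNReal.rpow_le_rpow (ENNReal.ofReal_le_ofReal ?_) (by linarith)) le_rfl (by simp) (by simp)
    have : 0 < p - 1 := by linarith
    gcongr
  have B1 := (hb1 p hp hp2 J r s hr hs F hF f hf K hK0.le (fun u n => by
    have := hK 1 1 le_rfl one_pos J n
    simpa [r] using this)).trans (hm C1 hC1 (by linarith))
  have B2 := (hb2 p hp hp2 J r s hr hs F hF f hf K hK0.le (fun u n => hK b (v u) hb.le (hv u) J n)).trans (hm C2 hC2 (by linarith))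
  have i1 := fun u => integrable_dilSum a1 J (r u) (s u) F hF
  have i2 := fun u => integrable_dilSum a2 J (r u) (s u) F hF
  calc _ ≤ ∫⁻ x, 2 * ((⨆ u, ‖FTinv (fun ξ => dilSum a1 J (r u) (s u) ξ * F ξ) x‖ₑ^p) + ⨆ u, ‖FTinv (fun ξ => dilSum a2 J (r u) (s u) ξ * F ξ) x‖ₑ^p) := by
        refine lintegral_mono fun x => iSup_le fun u => ?_
        have e : (fun ξ => parM b (a1 + a2) J (v u) ξ * F ξ) = fun ξ => dilSum a1 J (r u) (s u) ξ * F ξ + dilSum a2 J (r u) (s u) ξ * F ξ := by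
          ext ξ
          rw [← add_mul, parM_eq, dilSum, dilSum, dilSum, ← Finset.sum_add_distrib]
          rfl
        rw [show (⇑(a1 + a2)) = (⇑a1 + ⇑a2) from rfl, e, FTinv_add _ _ (i1 u) (i2 u)]
        refine (enorm_add_rpow_le _ _ p hp hp2).trans ?_
        refine mul_le_mul le_rfl (add_le_add ?_ ?_) (by simp) (by simp)
        · exact le_iSup (fun u => ‖FTinv (fun ξ => dilSum a1 J (r u) (s u) ξ * F ξ) x‖ₑ^p) u
        · exact le_iSup (fun u => ‖FTinv (fun ξ => dilSum a2 J (r u) (s u) ξ * F ξ) x‖ₑ^p) u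
    _ ≤ 2 * (ENNReal.ofReal (E * ((C1 + C2) * K) * (p-1)^(-3:ℝ) * √L)^p * I + ENNReal.ofReal (E * ((C1 + C2) * K) * (p-1)^(-3:ℝ) * √L)^p * I) := by
        rw [lintegral_const_mul' _ _ (by simp), lintegral_add_left (Measurable.iSup fun u =>
          ((continuous_FTinv _ (i1 u)).measurable.enorm).pow_const p)]
        exact mul_le_mul le_rfl (add_le_add B1 B2) (by simp) (by simp)
    _ = 4 * ENNReal.ofReal (E * ((C1 + C2) * K) * (p-1)^(-3:ℝ) * √L)^p * I := by ring
    _ ≤ 4^p * ENNReal.ofReal (E * ((C1 + C2) * K) * (p-1)^(-3:ℝ) * √L)^p * I := by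
        refine mul_le_mul (mul_le_mul ?_ le_rfl (by simp) (by simp)) le_rfl (by simp) (by simp)
        calc (4:ℝ≥0∞) = 4^(1:ℝ) := by simp
          _ ≤ 4^p := ENNReal.rpow_le_rpow_of_exponent_le (by norm_num) hp.le
    _ = _ := by
        rw [← ENNReal.mul_rpow_of_nonneg _ _ (by linarith)]
        congr 2
        rw [show (4:ℝ≥0∞) = ENNReal.ofReal 4 by norm_num, ← ENNReal.ofReal_mul (by norm_num)]
        congr 1; ring

/-- Smooth amplitudes vanishing off `[1/2, 2]`. -/
def IsAmp (A : ℝ → ℂ) : Prop := ContDiff ℝ ∞ A ∧ ∀ t, t ∉ Icc (1/2:ℝ) 2 → A t = 0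

lemma IsAmp.end_left {A : ℝ → ℂ} (hA : IsAmp A) : A (1/2) = 0 := by
  have hc : IsClosed {t | A t = 0} := isClosed_eq hA.1.continuous continuous_const
  have h : Iio (1/2:ℝ) ⊆ {t | A t = 0} := fun t ht => hA.2 t fun h => absurd h.1 (not_le.2 ht)
  have := hc.closure_subset_iff.2 h
  rw [closure_Iio] at this
  exact this self_mem_Iic

lemma IsAmp.end_right {A : ℝ → ℂ} (hA : IsAmp A) : A 2 = 0 := by
  have hc : IsClosed {t | A t = 0} := isClosed_eq hA.1.continuous continuous_const
  have h : Ioi (2:ℝ) ⊆ {t | A t = 0} := fun t ht => hA.2 t fun h => absurd h.2 (not_le.2 ht)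
  have := hc.closure_subset_iff.2 h
  rw [closure_Ioi] at this
  exact this self_mem_Ici

lemma IsAmp.deriv {A : ℝ → ℂ} (hA : IsAmp A) : IsAmp (deriv A) := by
  refine ⟨(contDiff_infty_iff_deriv.1 hA.1).2, fun t ht => ?_⟩
  have : A =ᶠ[𝓝 t] fun _ => 0 := by
    filter_upwards [isClosed_Icc.isOpen_compl.mem_nhds ht] with s hs using hA.2 s hs
  rw [this.deriv_eq]; simp

lemma IsAmp.rpow_mul {A : ℝ → ℂ} (hA : IsAmp A) (r : ℝ) (z : ℂ) : IsAmp fun t => z * ((t^r:ℝ):ℂ) * A t := by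
  refine ⟨contDiff_iff_contDiffAt.2 fun t => ?_, fun t ht => by simp [hA.2 t ht]⟩
  by_cases h : t = 0
  · have : (fun t => z * ((t^r:ℝ):ℂ) * A t) =ᶠ[𝓝 t] fun _ => 0 := by
      filter_upwards [Iio_mem_nhds (show t < 1/2 by rw [h]; norm_num)] with s hs
      rw [hA.2 s fun h => absurd h.1 (not_le.2 hs), mul_zero]
    exact contDiffAt_const.congr_of_eventuallyEq this
  · exact (contDiffAt_const.mul (Complex.ofRealCLM.contDiff.contDiffAt.comp t
      (Real.contDiffAt_rpow_const_of_ne h))).mul hA.1.contDiffAt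

lemma IsAmp.bdd {A : ℝ → ℂ} (hA : IsAmp A) : ∃ B, 0 ≤ B ∧ ∀ t ∈ Icc (1/2:ℝ) 2, ‖A t‖ ≤ B := by
  obtain ⟨B, hB⟩ := isCompact_Icc.exists_bound_of_continuousOn (s := Icc (1/2:ℝ) 2) hA.1.continuous.continuousOn
  exact ⟨B, (norm_nonneg _).trans (hB 1 ⟨by norm_num, by norm_num⟩), hB⟩

/-- The oscillating exponential along the curve `(e t, c t^b)`. -/
def oscE (e c b : ℝ) (ξ : ℝ × ℝ) (t : ℝ) : ℂ :=
  Complex.exp (((-(2 * Real.pi * (ξ.1 * (e * t) + ξ.2 * (c * t^b))) : ℝ) : ℂ) * Complex.I)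

/-- The derivative of the phase of `oscE`. -/
def oscD (e c b : ℝ) (ξ : ℝ × ℝ) (t : ℝ) : ℝ := ξ.1 * e + ξ.2 * (c * (b * t^(b-1)))

lemma norm_oscE (e c b : ℝ) (ξ : ℝ × ℝ) (t : ℝ) : ‖oscE e c b ξ t‖ = 1 := Complex.norm_exp_ofReal_mul_I _

/-- Oscillatory integrals with powers of the phase derivative in the denominator. -/
def oscJ (e c b : ℝ) (k : ℕ) (A : ℝ → ℂ) (ξ : ℝ × ℝ) : ℂ :=
  ∫ t in (1/2:ℝ)..2, oscE e c b ξ t * A t * ((oscD e c b ξ t : ℝ) : ℂ)⁻¹^k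

lemma hasDerivAt_oscE (e c b : ℝ) (ξ : ℝ × ℝ) (t : ℝ) (ht : 0 < t) :
    HasDerivAt (oscE e c b ξ) (oscE e c b ξ t * (-(2 * Real.pi * Complex.I) * (oscD e c b ξ t : ℝ))) t := by
  have h1 : HasDerivAt (fun t : ℝ => -(2 * Real.pi * (ξ.1 * (e * t) + ξ.2 * (c * t^b))))
      (-(2 * Real.pi * (ξ.1 * (e * 1) + ξ.2 * (c * (b * t^(b-1)))))) t :=
    (((((hasDerivAt_id t).const_mul e).const_mul ξ.1).add
      (((Real.hasDerivAt_rpow_const (Or.inl ht.ne')).const_mul c).const_mul ξ.2)).const_mul (2 * Real.pi)).neg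
  have h2 := ((h1.ofReal_comp).mul_const Complex.I).cexp
  refine h2.congr_deriv ?_
  simp only [oscE, oscD]; push_cast; ring

lemma hasDerivAt_oscD (e c b : ℝ) (ξ : ℝ × ℝ) (t : ℝ) (ht : 0 < t) :
    HasDerivAt (oscD e c b ξ) (ξ.2 * (c * (b * ((b-1) * t^(b-2))))) t := by
  have h := ((((Real.hasDerivAt_rpow_const (p := b-1) (Or.inl ht.ne')).const_mul b).const_mul c).const_mul ξ.2).const_add (ξ.1*e)
  refine h.congr_deriv ?_
  rw [show b - 1 - 1 = b - 2 by ring]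

lemma oscJ_step (e c b : ℝ) (k : ℕ) (A : ℝ → ℂ) (hA : IsAmp A) (ξ : ℝ × ℝ)
    (hD : ∀ t ∈ Icc (1/2:ℝ) 2, oscD e c b ξ t ≠ 0) :
    (2 * Real.pi * Complex.I) * oscJ e c b k A ξ = oscJ e c b (k+1) (deriv A) ξ
      - ξ.2 * oscJ e c b (k+2) (fun t => ((k+1) * (c * (b * (b-1))) : ℂ) * ((t^(b-2):ℝ):ℂ) * A t) ξ := by
  have huI : uIcc (1/2:ℝ) 2 = Icc (1/2) 2 := uIcc_of_le (by norm_num)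
  have hpos : ∀ t ∈ Icc (1/2:ℝ) 2, 0 < t := fun t ht => by linarith [ht.1]
  have hder : ∀ t ∈ Icc (1/2:ℝ) 2, HasDerivAt (fun t => oscE e c b ξ t * A t * ((oscD e c b ξ t : ℝ) : ℂ)⁻¹^(k+1))
      (-(2 * Real.pi * Complex.I) * (oscE e c b ξ t * A t * ((oscD e c b ξ t : ℝ) : ℂ)⁻¹^k)
        + (oscE e c b ξ t * deriv A t * ((oscD e c b ξ t : ℝ) : ℂ)⁻¹^(k+1)
          - ξ.2 * (oscE e c b ξ t * (((k+1) * (c * (b * (b-1))) : ℂ) * ((t^(b-2):ℝ):ℂ) * A t) * ((oscD e c b ξ t : ℝ) : ℂ)⁻¹^(k+2)))) t := by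
    intro t ht
    have h0 : ((oscD e c b ξ t : ℝ) : ℂ) ≠ 0 := by exact_mod_cast hD t ht
    have hAd : HasDerivAt A (deriv A t) t := (hA.1.differentiable (by simp)).differentiableAt.hasDerivAt
    have h := ((hasDerivAt_oscE e c b ξ t (hpos t ht)).mul hAd).mul
      ((((hasDerivAt_oscD e c b ξ t (hpos t ht)).ofReal_comp).inv h0).pow (k+1))
    refine h.congr_deriv ?_
    simp only [Pi.mul_apply, Pi.pow_apply, Pi.inv_apply, Nat.add_sub_cancel]
    have hi : ((oscD e c b ξ t : ℝ) : ℂ) * ((oscD e c b ξ t : ℝ) : ℂ)⁻¹ = 1 := mul_inv_cancel₀ h0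
    rw [div_eq_mul_inv, ← inv_pow]
    push_cast
    linear_combination (-(2 * Real.pi * Complex.I) * oscE e c b ξ t * A t * ((oscD e c b ξ t : ℝ) : ℂ)⁻¹^k) * hi
  have hcE : ContinuousOn (oscE e c b ξ) (Icc (1/2:ℝ) 2) := fun t ht => (hasDerivAt_oscE e c b ξ t (hpos t ht)).continuousAt.continuousWithinAt
  have hcD : ContinuousOn (fun t => ((oscD e c b ξ t : ℝ) : ℂ)⁻¹) (Icc (1/2:ℝ) 2) := fun t ht =>
    ContinuousWithinAt.inv₀ (((hasDerivAt_oscD e c b ξ t (hpos t ht)).ofReal_comp).continuousAt.continuousWithinAt) (by exact_mod_cast hD t ht)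
  have hint : ∀ (m : ℕ) (B : ℝ → ℂ), IsAmp B → IntervalIntegrable (fun t => oscE e c b ξ t * B t * ((oscD e c b ξ t : ℝ) : ℂ)⁻¹^m) volume (1/2) 2 := by
    intro m B hB
    refine ContinuousOn.intervalIntegrable ?_
    rw [huI]
    exact (hcE.mul hB.1.continuous.continuousOn).mul (hcD.pow m)
  have i1 := (hint k A hA).const_mul (-(2 * Real.pi * Complex.I))
  have i2 := hint (k+1) _ hA.deriv
  have i3 := (hint (k+2) _ (hA.rpow_mul (b-2) ((k+1) * (c * (b * (b-1))) : ℂ))).const_mul (ξ.2:ℂ)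
  have key := intervalIntegral.integral_eq_sub_of_hasDerivAt (a := 1/2) (b := 2) (fun t ht => hder t (huI ▸ ht)) (i1.add (i2.sub i3))
  rw [hA.end_left, hA.end_right, intervalIntegral.integral_add i1 (i2.sub i3), intervalIntegral.integral_sub i2 i3,
    intervalIntegral.integral_const_mul, intervalIntegral.integral_const_mul] at key
  simp only [oscJ]
  linear_combination -key

lemma oscJ_decay (e c b κ : ℝ) (hκ : 0 < κ) (N : ℕ) : ∀ (k : ℕ) (A : ℝ → ℂ), IsAmp A → ∃ C, 0 ≤ C ∧ ∀ ξ : ℝ × ℝ, 1 ≤ ‖ξ‖ →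
    (∀ t ∈ Icc (1/2:ℝ) 2, κ * ‖ξ‖ ≤ |oscD e c b ξ t|) → ‖ξ‖^(k+N) * ‖oscJ e c b k A ξ‖ ≤ C := by
  induction N with
  | zero =>
    intro k A hA
    obtain ⟨B, hB0, hB⟩ := hA.bdd
    refine ⟨B * (κ⁻¹)^k * (3/2), by positivity, fun ξ hξ hD => ?_⟩
    have h : ‖oscJ e c b k A ξ‖ ≤ (B * (κ * ‖ξ‖)⁻¹^k) * |2 - 1/2| := by
      refine intervalIntegral.norm_integral_le_of_norm_le_const fun t ht => ?_
      rw [uIoc_of_le (by norm_num)] at ht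
      have ht' : t ∈ Icc (1/2:ℝ) 2 := ⟨ht.1.le, ht.2⟩
      rw [norm_mul, norm_mul, norm_oscE, one_mul, norm_pow, norm_inv, Complex.norm_real, Real.norm_eq_abs]
      have := hD t ht'
      have h2 : 0 < κ * ‖ξ‖ := by positivity
      gcongr
      exact hB t ht'
    have h3 : ‖ξ‖ ^ k * (κ * ‖ξ‖)⁻¹^k = κ⁻¹^k := by
      rw [← mul_pow]; congr 1; field_simp
    calc _ ≤ ‖ξ‖^(k+0) * ((B * (κ * ‖ξ‖)⁻¹^k) * |2 - 1/2|) := by gcongr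
      _ = B * (‖ξ‖ ^ k * (κ * ‖ξ‖)⁻¹^k) * (3/2) := by rw [add_zero]; norm_num; ring
      _ ≤ _ := by rw [h3]
  | succ N ih =>
    intro k A hA
    obtain ⟨C1, hC1, h1⟩ := ih (k+1) _ hA.deriv
    obtain ⟨C2, hC2, h2⟩ := ih (k+2) _ (hA.rpow_mul (b-2) ((k+1) * (c * (b * (b-1))) : ℂ))
    refine ⟨C1 + C2, by positivity, fun ξ hξ hD => ?_⟩
    have hstep := oscJ_step e c b k A hA ξ fun t ht h0 => by
      have := hD t ht
      rw [h0, abs_zero] at this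
      nlinarith
    have hn : ‖oscJ e c b k A ξ‖ ≤ ‖(2 * Real.pi * Complex.I) * oscJ e c b k A ξ‖ := by
      rw [norm_mul]
      refine le_mul_of_one_le_left (norm_nonneg _) ?_
      rw [norm_mul, norm_mul, Complex.norm_I, Complex.norm_real, Real.norm_eq_abs, abs_of_pos Real.pi_pos]
      norm_num; linarith [Real.pi_gt_three]
    rw [hstep] at hn
    have hx2 : ‖(ξ.2:ℂ)‖ ≤ ‖ξ‖ := by rw [Complex.norm_real]; exact norm_snd_le ξ
    have h1' := h1 ξ hξ hD
    have h2' := h2 ξ hξ hD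
    calc _ ≤ ‖ξ‖^(k+(N+1)) * (‖oscJ e c b (k+1) (deriv A) ξ‖ + ‖ξ‖ * ‖oscJ e c b (k+2) (fun t => ((k+1) * (c * (b * (b-1))) : ℂ) * ((t^(b-2):ℝ):ℂ) * A t) ξ‖) := by
          refine mul_le_mul_of_nonneg_left (hn.trans ((norm_sub_le _ _).trans ?_)) (by positivity)
          rw [norm_mul]
          gcongr
      _ = ‖ξ‖^(k+1+N) * ‖oscJ e c b (k+1) (deriv A) ξ‖ + ‖ξ‖^(k+2+N) * ‖oscJ e c b (k+2) (fun t => ((k+1) * (c * (b * (b-1))) : ℂ) * ((t^(b-2):ℝ):ℂ) * A t) ξ‖ := by ring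
      _ ≤ _ := add_le_add h1' h2'

lemma hasFDerivAt_oscE (e c b : ℝ) (t : ℝ) (ξ : ℝ × ℝ) : HasFDerivAt (fun ξ => oscE e c b ξ t)
    (pgrad (oscE e c b ξ t * (-(2 * Real.pi * Complex.I) * e * (t^(1:ℝ) : ℝ)))
      (oscE e c b ξ t * (-(2 * Real.pi * Complex.I) * c * (t^b : ℝ)))) ξ := by
  have h1 : HasFDerivAt (fun ξ : ℝ × ℝ => -(2 * Real.pi * (ξ.1 * (e * t) + ξ.2 * (c * t^b)))) _ ξ :=
    ((((hasFDerivAt_fst (𝕜 := ℝ) (E := ℝ) (F := ℝ) (p := ξ)).mul_const (e*t)).add ((hasFDerivAt_snd (𝕜 := ℝ) (E := ℝ) (F := ℝ) (p := ξ)).mul_const (c * t^b))).const_mul (2 * Real.pi)).neg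
  have h2 := ((Complex.ofRealCLM.hasFDerivAt.comp ξ h1).mul_const Complex.I).cexp
  refine h2.congr_fderiv ?_
  ext <;> simp [pgrad, oscE] <;> ring

lemma continuousOn_oscE (e c b : ℝ) (ξ : ℝ × ℝ) : ContinuousOn (oscE e c b ξ) (Icc (1/2:ℝ) 2) := fun t ht =>
  (hasDerivAt_oscE e c b ξ t (by linarith [ht.1])).continuousAt.continuousWithinAt

lemma continuousOn_pgrad (s : Set ℝ) (u v : ℝ → ℂ) (hu : ContinuousOn u s) (hv : ContinuousOn v s) :
    ContinuousOn (fun t => pgrad (u t) (v t)) s :=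
  (((ContinuousLinearMap.smulRightL ℝ (ℝ × ℝ) ℂ (ContinuousLinearMap.fst ℝ ℝ ℝ)).continuous.comp_continuousOn hu)).add
    (((ContinuousLinearMap.smulRightL ℝ (ℝ × ℝ) ℂ (ContinuousLinearMap.snd ℝ ℝ ℝ)).continuous.comp_continuousOn hv))

lemma norm_pgrad_le (u v : ℂ) : ‖pgrad u v‖ ≤ ‖u‖ + ‖v‖ := by
  refine ContinuousLinearMap.opNorm_le_bound _ (by positivity) fun ξ => ?_
  simp only [pgrad, add_apply, ContinuousLinearMap.smulRight_apply, ContinuousLinearMap.coe_fst', ContinuousLinearMap.coe_snd']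
  refine (norm_add_le _ _).trans ?_
  rw [norm_smul, norm_smul, add_mul, mul_comm ‖ξ.1‖, mul_comm ‖ξ.2‖]
  exact add_le_add (mul_le_mul_of_nonneg_left (norm_fst_le ξ) (norm_nonneg _)) (mul_le_mul_of_nonneg_left (norm_snd_le ξ) (norm_nonneg _))

lemma hasFDerivAt_oscJ (e c b : ℝ) (A : ℝ → ℂ) (hA : IsAmp A) (ξ : ℝ × ℝ) : HasFDerivAt (oscJ e c b 0 A)
    (pgrad (oscJ e c b 0 (fun t => (-(2 * Real.pi * Complex.I) * e) * (t^(1:ℝ) : ℝ) * A t) ξ)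
      (oscJ e c b 0 (fun t => (-(2 * Real.pi * Complex.I) * c) * (t^b : ℝ) * A t) ξ)) ξ := by
  have hA1 := hA.rpow_mul 1 (-(2 * Real.pi * Complex.I) * e)
  have hA2 := hA.rpow_mul b (-(2 * Real.pi * Complex.I) * c)
  obtain ⟨B1, hB1, h1⟩ := hA1.bdd
  obtain ⟨B2, hB2, h2⟩ := hA2.bdd
  set A1 : ℝ → ℂ := fun t => (-(2 * Real.pi * Complex.I) * e) * (t^(1:ℝ) : ℝ) * A t
  set A2 : ℝ → ℂ := fun t => (-(2 * Real.pi * Complex.I) * c) * (t^b : ℝ) * A t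
  have huI : uIcc (1/2:ℝ) 2 = Icc (1/2) 2 := uIcc_of_le (by norm_num)
  have hΙ : uIoc (1/2:ℝ) 2 = Ioc (1/2) 2 := uIoc_of_le (by norm_num)
  have hsub : Ioc (1/2:ℝ) 2 ⊆ Icc (1/2) 2 := Ioc_subset_Icc_self
  have hc : ∀ (D : ℝ → ℂ) (ζ : ℝ × ℝ), IsAmp D → ContinuousOn (fun t => oscE e c b ζ t * D t) (Icc (1/2:ℝ) 2) :=
    fun D ζ hD => (continuousOn_oscE e c b ζ).mul hD.1.continuous.continuousOn
  have hF' : ContinuousOn (fun t => pgrad (oscE e c b ξ t * A1 t) (oscE e c b ξ t * A2 t)) (Icc (1/2:ℝ) 2) :=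
    continuousOn_pgrad _ _ _ (hc A1 ξ hA1) (hc A2 ξ hA2)
  have key := intervalIntegral.hasFDerivAt_integral_of_dominated_of_fderiv_le (𝕜 := ℝ) (μ := volume) (a := 1/2) (b := 2)
    (F := fun ξ t => oscE e c b ξ t * A t) (F' := fun ξ t => pgrad (oscE e c b ξ t * A1 t) (oscE e c b ξ t * A2 t)) (x₀ := ξ)
    (s := univ) (bound := fun _ => B1 + B2) univ_mem
    (Eventually.of_forall fun ζ => by
      rw [hΙ]; exact ((hc A ζ hA).mono hsub).aestronglyMeasurable measurableSet_Ioc)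
    (ContinuousOn.intervalIntegrable (by rw [huI]; exact hc A ξ hA))
    (by rw [hΙ]; exact (hF'.mono hsub).aestronglyMeasurable measurableSet_Ioc)
    (Eventually.of_forall fun t ht ζ _ => by
      rw [hΙ] at ht
      refine (norm_pgrad_le _ _).trans ?_
      rw [norm_mul (oscE e c b ζ t), norm_mul (oscE e c b ζ t), norm_oscE, one_mul, one_mul]
      exact add_le_add (h1 t (hsub ht)) (h2 t (hsub ht)))
    intervalIntegrable_const
    (Eventually.of_forall fun t ht ζ _ => by
      refine ((hasFDerivAt_oscE e c b t ζ).mul_const (A t)).congr_fderiv ?_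
      ext <;> simp [pgrad, A1, A2] <;> ring)
  have e0 : ∀ D : ℝ → ℂ, oscJ e c b 0 D = fun ξ => ∫ t in (1/2:ℝ)..2, oscE e c b ξ t * D t := by
    intro D; ext ξ; simp only [oscJ, pow_zero, mul_one]
  rw [e0, e0, e0]
  refine key.congr_fderiv ?_
  ext1
  · simp only
    ext
    simp only [ContinuousLinearMap.comp_apply]
    rw [ContinuousLinearMap.intervalIntegral_apply (ContinuousOn.intervalIntegrable (by rw [huI]; exact hF'))]
    simp [pgrad]
  · ext
    simp only [ContinuousLinearMap.comp_apply]
    rw [ContinuousLinearMap.intervalIntegral_apply (ContinuousOn.intervalIntegrable (by rw [huI]; exact hF'))]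
    simp [pgrad]

/-- Smooth multipliers that are homogeneous of nonpositive degree away from the origin and
vanish near the large frequencies at which the phase of `oscE` is nearly stationary. -/
structure IsGoodMult (e c b κ : ℝ) (M : ℝ × ℝ → ℂ) : Prop where
  smooth : ContDiff ℝ ∞ M
  hom : ∃ n : ℕ, ∀ ξ : ℝ × ℝ, 100 < ‖ξ‖ → ∀ r : ℝ, 1 ≤ r → (r:ℂ)^n * M (r • ξ) = M ξ
  van : ∀ ξ : ℝ × ℝ, 100 < ‖ξ‖ → ¬ (∀ t ∈ Icc (1/2:ℝ) 2, κ * ‖ξ‖ ≤ |oscD e c b ξ t|) → M =ᶠ[𝓝 ξ] fun _ => 0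

lemma IsGoodMult.bdd {e c b κ : ℝ} {M : ℝ × ℝ → ℂ} (hM : IsGoodMult e c b κ M) : ∃ B, 0 ≤ B ∧ ∀ ξ, ‖M ξ‖ ≤ B := by
  obtain ⟨B, hB⟩ := (isCompact_closedBall (0:ℝ×ℝ) 200).exists_bound_of_continuousOn hM.smooth.continuous.continuousOn
  obtain ⟨n, hn⟩ := hM.hom
  refine ⟨B, (norm_nonneg _).trans (hB 0 (by simp)), fun ξ => ?_⟩
  by_cases h : ‖ξ‖ ≤ 200
  · exact hB ξ (by simpa using h)
  push Not at h
  set r := ‖ξ‖/200 with hr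
  have hr1 : 1 ≤ r := by rw [hr]; linarith
  have hr0 : 0 < r := by linarith
  have hω : ‖r⁻¹ • ξ‖ = 200 := by
    rw [norm_smul, norm_inv, Real.norm_eq_abs, abs_of_pos hr0, hr]; field_simp
  have h1 := hn (r⁻¹ • ξ) (by rw [hω]; norm_num) r hr1
  rw [smul_inv_smul₀ hr0.ne'] at h1
  have h2 := hB (r⁻¹ • ξ) (by simp [hω])
  rw [← h1, norm_mul, norm_pow, Complex.norm_real, Real.norm_eq_abs, abs_of_pos hr0] at h2
  exact (le_mul_of_one_le_left (norm_nonneg _) (one_le_pow₀ hr1)).trans h2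

lemma IsGoodMult.fderiv {e c b κ : ℝ} {M : ℝ × ℝ → ℂ} (hM : IsGoodMult e c b κ M) (v : ℝ × ℝ) :
    IsGoodMult e c b κ fun ξ => fderiv ℝ M ξ v := by
  refine ⟨(hM.smooth.fderiv_right (by simp)).clm_apply contDiff_const, ?_, ?_⟩
  · obtain ⟨n, hn⟩ := hM.hom
    refine ⟨n+1, fun ξ hξ r hr => ?_⟩
    have he : (fun ζ : ℝ × ℝ => (r:ℂ)^n * M (r • ζ)) =ᶠ[𝓝 ξ] M := by
      filter_upwards [(isOpen_lt continuous_const continuous_norm).mem_nhds hξ] with ζ hζ using hn ζ hζ r hr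
    have h1 : HasFDerivAt (fun ζ : ℝ × ℝ => (r:ℂ)^n * M (r • ζ)) _ ξ :=
      (((hM.smooth.differentiable (by simp)) (r • ξ)).hasFDerivAt.comp ξ ((hasFDerivAt_id (𝕜 := ℝ) ξ).const_smul r)).const_mul ((r:ℂ)^n)
    have h2 := congrArg (fun L => L v) (h1.congr_of_eventuallyEq he.symm).fderiv
    simp only [smul_apply, ContinuousLinearMap.comp_apply, ContinuousLinearMap.id_apply, map_smul] at h2
    rw [h2, pow_succ]
    simp [mul_assoc]
  · intro ξ hξ hg
    filter_upwards [(hM.van ξ hξ hg).fderiv (𝕜 := ℝ)] with ζ hζ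
    rw [hζ]; simp

/-- Finite sums of good multipliers times oscillatory integrals. -/
inductive OscClass (e c b κ : ℝ) : (ℝ × ℝ → ℂ) → Prop
  | base (M : ℝ × ℝ → ℂ) (A : ℝ → ℂ) (hM : IsGoodMult e c b κ M) (hA : IsAmp A) :
      OscClass e c b κ fun ξ => M ξ * oscJ e c b 0 A ξ
  | add (g h : ℝ × ℝ → ℂ) (hg : OscClass e c b κ g) (hh : OscClass e c b κ h) : OscClass e c b κ fun ξ => g ξ + h ξ

lemma pgrad_add (u v u' v' : ℂ) : pgrad u v + pgrad u' v' = pgrad (u+u') (v+v') := by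
  ext <;> simp [pgrad]

lemma OscClass.deriv {e c b κ : ℝ} {g : ℝ × ℝ → ℂ} (hg : OscClass e c b κ g) :
    ∃ g1, OscClass e c b κ g1 ∧ ∃ g2, OscClass e c b κ g2 ∧ ∀ ξ, HasFDerivAt g (pgrad (g1 ξ) (g2 ξ)) ξ := by
  induction hg with
  | base M A hM hA =>
    refine ⟨_, .add _ _ (.base _ _ (hM.fderiv (1,0)) hA) (.base _ _ hM (hA.rpow_mul 1 (-(2 * Real.pi * Complex.I) * e))),
      _, .add _ _ (.base _ _ (hM.fderiv (0,1)) hA) (.base _ _ hM (hA.rpow_mul b (-(2 * Real.pi * Complex.I) * c))), fun ξ => ?_⟩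
    refine (((hM.smooth.differentiable (by simp)) ξ).hasFDerivAt.mul (hasFDerivAt_oscJ e c b A hA ξ)).congr_fderiv ?_
    ext <;> simp [pgrad] <;> ring
  | add g h _ _ ihg ihh =>
    obtain ⟨g1, hg1, g2, hg2, hg'⟩ := ihg
    obtain ⟨h1, hh1, h2, hh2, hh'⟩ := ihh
    exact ⟨_, .add _ _ hg1 hh1, _, .add _ _ hg2 hh2, fun ξ => ((hg' ξ).add (hh' ξ)).congr_fderiv (pgrad_add _ _ _ _)⟩

lemma oscJ_bdd (e c b : ℝ) (A : ℝ → ℂ) (hA : IsAmp A) : ∃ B, 0 ≤ B ∧ ∀ ξ, ‖oscJ e c b 0 A ξ‖ ≤ B := by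
  obtain ⟨B, hB0, hB⟩ := hA.bdd
  refine ⟨B * |2 - 1/2|, by positivity, fun ξ => ?_⟩
  refine intervalIntegral.norm_integral_le_of_norm_le_const fun t ht => ?_
  rw [uIoc_of_le (by norm_num)] at ht
  rw [norm_mul, norm_mul, norm_oscE, one_mul, pow_zero, norm_one, mul_one]
  exact hB t ⟨ht.1.le, ht.2⟩

lemma OscClass.decay {e c b κ : ℝ} (hκ : 0 < κ) {g : ℝ × ℝ → ℂ} (hg : OscClass e c b κ g) (k : ℕ) :
    ∃ C : ℝ, ∀ ξ, ‖ξ‖^k * ‖g ξ‖ ≤ C := by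
  induction hg with
  | base M A hM hA =>
    obtain ⟨B, hB0, hB⟩ := hM.bdd
    obtain ⟨B', hB0', hB'⟩ := oscJ_bdd e c b A hA
    obtain ⟨C, hC0, hC⟩ := oscJ_decay e c b κ hκ k 0 A hA
    refine ⟨100^k * (B * B') + B * C, fun ξ => ?_⟩
    rw [norm_mul]
    by_cases h : ‖ξ‖ ≤ 100
    · calc _ ≤ 100^k * (B * B') := by
            gcongr
            · exact hB ξ
            · exact hB' ξ
        _ ≤ _ := le_add_of_nonneg_right (by positivity)
    push Not at h
    by_cases hg : ∀ t ∈ Icc (1/2:ℝ) 2, κ * ‖ξ‖ ≤ |oscD e c b ξ t|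
    · have := hC ξ (by linarith) hg
      rw [zero_add] at this
      calc _ = ‖M ξ‖ * (‖ξ‖^k * ‖oscJ e c b 0 A ξ‖) := by ring
        _ ≤ B * C := by
            gcongr
            exact hB ξ
        _ ≤ _ := le_add_of_nonneg_left (by positivity)
    · rw [(hM.van ξ h hg).eq_of_nhds]
      simp; positivity
  | add g h _ _ ihg ihh =>
    obtain ⟨C, hC⟩ := ihg
    obtain ⟨D, hD⟩ := ihh
    refine ⟨C + D, fun ξ => ?_⟩
    calc _ ≤ ‖ξ‖^k * (‖g ξ‖ + ‖h ξ‖) := by gcongr; exact norm_add_le _ _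
      _ ≤ _ := by rw [mul_add]; exact add_le_add (hC ξ) (hD ξ)

lemma schwartz_osc (e c b κ : ℝ) (hκ : 0 < κ) (M : ℝ × ℝ → ℂ) (A : ℝ → ℂ) (hM : IsGoodMult e c b κ M) (hA : IsAmp A) :
    ∃ a : SchwartzMap (ℝ × ℝ) ℂ, ⇑a = fun ξ => M ξ * oscJ e c b 0 A ξ :=
  schwartz_of_class {g | OscClass e c b κ g} (fun _ hg => hg.deriv) (fun _ hg k => hg.decay hκ k) _ (.base M A hM hA)

lemma stationary_mem (e c b T x y : ℝ) (he : |e| = 1) (hc : c ≠ 0) (hb : 1 < b) (lo hi : ℝ)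
    (hTlo : (1/2:ℝ)^(b-1) ≤ T) (hThi : T ≤ 2^(b-1)) (κ : ℝ)
    (hκ1 : κ ≤ 1/2) (hκ2 : κ * (1 + 2 * |c| * b * 2^(b-1)) ≤ |c| * (b * (1/2:ℝ)^(b-1) - lo))
    (hκ3 : κ * (1 + 2 * |c| * b * 2^(b-1)) ≤ |c| * (hi - b * 2^(b-1))) (hκ : 0 < κ) (hN : 0 < max |x| |y|)
    (h : |x * e + y * (c * (b * T))| < κ * max |x| |y|) : y ≠ 0 ∧ x * e / (c * y) ∈ Ioo (-hi) (-lo) := by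
  have hT0 : 0 < T := lt_of_lt_of_le (by positivity) hTlo
  set P : ℝ := 2^(b-1)
  have hP : 0 < P := by positivity
  have hc' : 0 < |c| := abs_pos.2 hc
  set K := 1 + 2 * |c| * b * P with hK
  have hxe : |x| = |x * e| := by rw [abs_mul, he, mul_one]
  have hyc : |y * (c * (b * T))| ≤ |c| * b * P * |y| := by
    rw [abs_mul, abs_mul, abs_of_pos (by positivity : 0 < b * T)]
    calc _ = |c| * b * T * |y| := by ring
      _ ≤ _ := by gcongr
  have h1 : |x| ≤ κ * max |x| |y| + |c| * b * P * |y| := by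
    rw [hxe] at h ⊢
    have := abs_sub_abs_le_abs_sub (x * e) (-(y * (c * (b * T))))
    rw [sub_neg_eq_add, abs_neg] at this
    linarith
  have hmax : max |x| |y| ≤ K * |y| := by
    have h0 : 0 ≤ |c| * b * P * |y| := by positivity
    rcases max_choice |x| |y| with hm | hm
    · rw [hm] at h1 ⊢
      have := mul_le_mul_of_nonneg_right hκ1 (abs_nonneg x)
      rw [hK]; nlinarith [abs_nonneg y]
    · rw [hm, hK]; nlinarith [abs_nonneg y]
  have hy : 0 < |y| := by
    by_contra h0
    have : |y| = 0 := le_antisymm (not_lt.1 h0) (abs_nonneg y)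
    rw [this, mul_zero] at hmax
    rw [this] at hN
    linarith
  have hy0 : y ≠ 0 := abs_pos.1 hy
  have h2 : |x * e / (c * y) + b * T| * (|c| * |y|) < κ * K * |y| := by
    rw [← abs_mul, ← abs_mul]
    have : (x * e / (c * y) + b * T) * (c * y) = x * e + y * (c * (b * T)) := by field_simp
    rw [this]
    calc _ < _ := h
      _ ≤ κ * (K * |y|) := by gcongr
      _ = _ := by ring
  have h3 : |x * e / (c * y) + b * T| * |c| < κ * K := by
    rw [← mul_assoc] at h2
    exact lt_of_mul_lt_mul_right h2 hy.le
  have h4 : |x * e / (c * y) + b * T| < b * (1/2:ℝ)^(b-1) - lo := by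
    refine lt_of_mul_lt_mul_right (h3.trans_le (hκ2.trans_eq (mul_comm _ _))) hc'.le
  have h5 : |x * e / (c * y) + b * T| < hi - b * P := by
    refine lt_of_mul_lt_mul_right (h3.trans_le (hκ3.trans_eq (mul_comm _ _))) hc'.le
  rw [abs_lt] at h4 h5
  have h6 : b * (1/2:ℝ)^(b-1) ≤ b * T := by gcongr
  have h7 : b * T ≤ b * P := by gcongr
  exact ⟨hy0, by constructor <;> linarith [h4.1, h4.2, h5.1, h5.2]⟩

lemma sq_lt_of_norm (r : ℝ) (hr : 0 ≤ r) (ξ : ℝ × ℝ) (h : r < ‖ξ‖) : r^2 < ξ.1^2 + ξ.2^2 := by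
  rw [Prod.norm_def, lt_max_iff, Real.norm_eq_abs, Real.norm_eq_abs] at h
  rcases h with h | h
  · have := sq_lt_sq' (by linarith) h
    rw [sq_abs] at this; nlinarith [sq_nonneg ξ.2]
  · have := sq_lt_sq' (by linarith) h
    rw [sq_abs] at this; nlinarith [sq_nonneg ξ.1]

lemma isGoodMult_cutoff (e c b : ℝ) (he : |e| = 1) (hc : c ≠ 0) (hb : 1 < b) (η : ℝ × ℝ → ℝ) (hηsm : ContDiff ℝ ∞ η)
    (hηsupp : ∀ ξ : ℝ × ℝ, (100:ℝ)^2 < ξ.1^2 + ξ.2^2 → η ξ = 0)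
    (hηone : ∀ ξ : ℝ × ℝ, ξ.1^2 + ξ.2^2 ≤ (50:ℝ)^2 → η ξ = 1)
    (ς : ℝ → ℝ) (hςsm : ContDiff ℝ ∞ ς)
    (hςsupp : ∀ v : ℝ, v ∉ Ioo (-(b * (4:ℝ) ^ (b-1))) (-(b * (4:ℝ)⁻¹ ^ (b-1))) → ς v = 0)
    (hςone : ∀ v ∈ Icc (-(b * ((7:ℝ)/2) ^ (b-1))) (-(b * ((2:ℝ)/7) ^ (b-1))), ς v = 1) :
    ∃ κ > 0, IsGoodMult e c b κ fun ξ => ((1 - (1 - η ξ) * ς (ξ.1 * e / (c * ξ.2)) : ℝ) : ℂ) := by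
  have hb0 : 0 < b := by linarith
  have hc' : 0 < |c| := abs_pos.2 hc
  have hlo : b * ((2:ℝ)/7)^(b-1) < b * (1/2:ℝ)^(b-1) :=
    mul_lt_mul_of_pos_left (Real.rpow_lt_rpow (by norm_num) (by norm_num) (by linarith)) hb0
  have hhi : b * (2:ℝ)^(b-1) < b * ((7:ℝ)/2)^(b-1) :=
    mul_lt_mul_of_pos_left (Real.rpow_lt_rpow (by norm_num) (by norm_num) (by linarith)) hb0
  set K := 1 + 2 * |c| * b * 2^(b-1)
  have hK : 0 < K := by positivity
  set ε := min (|c| * (b * (1/2:ℝ)^(b-1) - b * ((2:ℝ)/7)^(b-1))) (|c| * (b * ((7:ℝ)/2)^(b-1) - b * (2:ℝ)^(b-1)))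
  have hε : 0 < ε := lt_min (mul_pos hc' (by linarith)) (mul_pos hc' (by linarith))
  have hκ : 0 < min (1/2) (ε / K) := lt_min (by norm_num) (by positivity)
  have hκK : min (1/2) (ε / K) * K ≤ ε := by
    calc _ ≤ ε / K * K := by gcongr; exact min_le_right _ _
      _ = ε := by field_simp
  have h1e : ∀ ξ : ℝ × ℝ, ξ.2 ≠ 0 → ContDiffAt ℝ ∞ (fun ξ : ℝ × ℝ => ξ.1 * e / (c * ξ.2)) ξ := fun ξ h =>
    (contDiffAt_fst.mul contDiffAt_const).div (contDiffAt_const.mul contDiffAt_snd) (mul_ne_zero hc h)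
  refine ⟨min (1/2) (ε/K), hκ, ?_, ⟨0, ?_⟩, ?_⟩
  · refine Complex.ofRealCLM.contDiff.comp (contDiff_iff_contDiffAt.2 fun ξ => ?_)
    by_cases h2 : ξ.2 = 0
    · by_cases h1 : ξ.1 = 0
      · have : (fun ξ : ℝ × ℝ => 1 - (1 - η ξ) * ς (ξ.1 * e / (c * ξ.2))) =ᶠ[𝓝 ξ] fun _ => 1 := by
          have ho : IsOpen {ζ : ℝ × ℝ | ζ.1^2 + ζ.2^2 < 50^2} := isOpen_lt (by fun_prop) (by fun_prop)
          filter_upwards [ho.mem_nhds (show ξ.1^2 + ξ.2^2 < 50^2 by rw [h1, h2]; norm_num)] with ζ hζ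
          rw [hηone ζ (le_of_lt hζ)]; simp
        exact contDiffAt_const.congr_of_eventuallyEq this
      · have : (fun ξ : ℝ × ℝ => 1 - (1 - η ξ) * ς (ξ.1 * e / (c * ξ.2))) =ᶠ[𝓝 ξ] fun _ => 1 := by
          have ho : IsOpen {ζ : ℝ × ℝ | |c * ζ.2| * (b * 4^(b-1)) < |ζ.1|} := isOpen_lt (by fun_prop) (by fun_prop)
          filter_upwards [ho.mem_nhds (show |c * ξ.2| * (b * 4^(b-1)) < |ξ.1| by rw [h2]; simpa using h1)] with ζ hζ
          rw [hςsupp, mul_zero, sub_zero]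
          intro hv
          have hneg : ζ.1 * e / (c * ζ.2) < 0 := hv.2.trans (by simp; positivity)
          have h0 : c * ζ.2 ≠ 0 := fun h => by rw [h, div_zero] at hneg; exact lt_irrefl _ hneg
          have hv1 : |ζ.1 * e / (c * ζ.2)| ≤ b * 4^(b-1) := by
            rw [abs_of_neg hneg]; linarith [hv.1]
          rw [abs_div, abs_mul ζ.1, he, mul_one, div_le_iff₀ (abs_pos.2 h0)] at hv1
          have : |c * ζ.2| * (b * 4^(b-1)) < |ζ.1| := hζ
          linarith
        exact contDiffAt_const.congr_of_eventuallyEq this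
    · exact contDiffAt_const.sub ((contDiffAt_const.sub hηsm.contDiffAt).mul
        (hςsm.contDiffAt.comp ξ (h1e ξ h2)))
  · intro ξ hξ r hr
    have hr0 : r ≠ 0 := by linarith
    have hn : 100 < ‖r • ξ‖ := by
      rw [norm_smul, Real.norm_eq_abs, abs_of_pos (by linarith)]; nlinarith
    rw [hηsupp _ (sq_lt_of_norm 100 (by norm_num) _ hξ), hηsupp _ (sq_lt_of_norm 100 (by norm_num) _ hn), pow_zero, one_mul]
    simp only [Prod.smul_fst, Prod.smul_snd, smul_eq_mul]
    rw [show r * ξ.1 * e / (c * (r * ξ.2)) = ξ.1 * e / (c * ξ.2) by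
      rw [mul_assoc, mul_left_comm c r, mul_div_mul_left _ _ hr0]]
  · intro ξ hξ hg
    push Not at hg
    obtain ⟨t, ht, hD⟩ := hg
    have hTlo : (1/2:ℝ)^(b-1) ≤ t^(b-1) := Real.rpow_le_rpow (by norm_num) ht.1 (by linarith)
    have hThi : t^(b-1) ≤ 2^(b-1) := Real.rpow_le_rpow (by linarith [ht.1]) ht.2 (by linarith)
    have hN : 0 < max |ξ.1| |ξ.2| := by
      have : ‖ξ‖ = max |ξ.1| |ξ.2| := rfl
      rw [← this]; linarith
    obtain ⟨h0, hv⟩ := stationary_mem e c b (t^(b-1)) ξ.1 ξ.2 he hc hb _ _ hTlo hThi _ (min_le_left _ _)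
      (hκK.trans (min_le_left _ _)) (hκK.trans (min_le_right _ _)) hκ hN hD
    filter_upwards [(isOpen_lt continuous_const continuous_norm).mem_nhds hξ,
      (h1e ξ h0).continuousAt.eventually (isOpen_Ioo.mem_nhds hv)] with ζ h1 h2
    rw [hηsupp _ (sq_lt_of_norm 100 (by norm_num) _ h1), hςone _ (Ioo_subset_Icc_self h2)]
    simp

lemma curve_neg_neg (b cp cm s : ℝ) (hs : 0 < s) : curve b cp cm (-s) = cm * s^b := by
  rw [curve, if_neg (by linarith), if_pos (by linarith), neg_neg]

lemma integral_eq_oscJ (e c b : ℝ) (A : ℝ → ℂ) (ξ : ℝ × ℝ) (h : ℝ → ℂ)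
    (hh : ∀ t ∈ Icc (1/2:ℝ) 2, h t = oscE e c b ξ t * A t) (h0 : ∀ t, t ∉ Icc (1/2:ℝ) 2 → h t = 0) :
    ∫ t, h t = oscJ e c b 0 A ξ := by
  rw [oscJ, intervalIntegral.integral_of_le (by norm_num), ← integral_Icc_eq_integral_Ioc,
    ← setIntegral_eq_integral_of_forall_compl_eq_zero (s := Icc (1/2:ℝ) 2) h0]
  refine setIntegral_congr_fun measurableSet_Icc fun t ht => ?_
  simp only [pow_zero, mul_one]
  exact hh t ht

lemma sigmaHat_pos (b cp cm : ℝ) (χ : ℝ → ℝ) (hχ : ∀ t : ℝ, t ∉ Ioo (1/2 : ℝ) 2 → χ t = 0) (ξ : ℝ × ℝ) :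
    sigmaHat b cp cm χ ξ = oscJ 1 cp b 0 (fun t => 1 * ((t^(-1:ℝ) : ℝ) : ℂ) * (χ t : ℂ)) ξ := by
  refine integral_eq_oscJ _ _ _ _ _ _ (fun t ht => ?_) (fun t ht => ?_)
  · have ht0 : 0 < t := by linarith [ht.1]
    rw [oscE, curve, if_pos ht0, Real.rpow_neg_one, one_mul t]
    push_cast; ring
  · rw [hχ t fun h => ht (Ioo_subset_Icc_self h)]; simp

lemma sigmaHat_neg (b cp cm : ℝ) (χ : ℝ → ℝ) (hχ : ∀ t : ℝ, t ∉ Ioo (1/2 : ℝ) 2 → χ t = 0) (ξ : ℝ × ℝ) :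
    sigmaHat b cp cm (fun t => χ (-t)) ξ = oscJ (-1) cm b 0 (fun t => (-1) * ((t^(-1:ℝ) : ℝ) : ℂ) * (χ t : ℂ)) ξ := by
  rw [sigmaHat, ← integral_neg_eq_self]
  refine integral_eq_oscJ _ _ _ _ _ _ (fun t ht => ?_) (fun t ht => ?_)
  · have ht0 : 0 < t := by linarith [ht.1]
    rw [oscE, curve_neg_neg b cp cm t ht0, Real.rpow_neg_one, neg_neg, neg_one_mul t]
    push_cast; rw [div_neg]; ring
  · rw [neg_neg, hχ t fun h => ht (Ioo_subset_Icc_self h)]; simp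

lemma oscE_zero (e c b t : ℝ) : oscE e c b 0 t = 1 := by simp [oscE]

lemma exists_phiHatSigma (b cp cm : ℝ) (hb : 1 < b) (hcp : cp ≠ 0) (hcm : cm ≠ 0)
    (χp : ℝ → ℝ) (hχsm : ContDiff ℝ (⊤ : ℕ∞) χp)
    (hχsupp : ∀ t : ℝ, t ∉ Ioo (1/2 : ℝ) 2 → χp t = 0)
    (η : ℝ × ℝ → ℝ) (hηsm : ContDiff ℝ (⊤ : ℕ∞) η)
    (hηsupp : ∀ ξ : ℝ × ℝ, (100:ℝ)^2 < ξ.1^2 + ξ.2^2 → η ξ = 0)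
    (hηone : ∀ ξ : ℝ × ℝ, ξ.1^2 + ξ.2^2 ≤ (50:ℝ)^2 → η ξ = 1)
    (ςp : ℝ → ℝ) (hςpsm : ContDiff ℝ (⊤ : ℕ∞) ςp)
    (hςpsupp : ∀ v : ℝ, v ∉ Ioo (b * (4:ℝ)⁻¹ ^ (b-1)) (b * (4:ℝ) ^ (b-1)) → ςp v = 0)
    (hςpone : ∀ v ∈ Icc (b * ((2:ℝ)/7) ^ (b-1)) (b * ((7:ℝ)/2) ^ (b-1)), ςp v = 1)
    (ςm : ℝ → ℝ) (hςmsm : ContDiff ℝ (⊤ : ℕ∞) ςm)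
    (hςmsupp : ∀ v : ℝ, v ∉ Ioo (-(b * (4:ℝ) ^ (b-1))) (-(b * (4:ℝ)⁻¹ ^ (b-1))) → ςm v = 0)
    (hςmone : ∀ v ∈ Icc (-(b * ((7:ℝ)/2) ^ (b-1))) (-(b * ((2:ℝ)/7) ^ (b-1))), ςm v = 1) :
    ∃ a : SchwartzMap (ℝ × ℝ) ℂ, ⇑a = phiHatSigma b cp cm χp η ςp ςm ∧ a 0 = 0 := by
  have hχ : IsAmp fun t => (χp t : ℂ) := ⟨Complex.ofRealCLM.contDiff.comp hχsm, fun t ht => by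
    show (χp t : ℂ) = 0
    rw [hχsupp t fun h => ht (Ioo_subset_Icc_self h), Complex.ofReal_zero]⟩
  obtain ⟨κ1, hκ1, hM1⟩ := isGoodMult_cutoff 1 cp b (by simp) hcp hb η hηsm hηsupp hηone ςm hςmsm hςmsupp hςmone
  obtain ⟨κ2, hκ2, hM2⟩ := isGoodMult_cutoff (-1) cm b (by simp) hcm hb η hηsm hηsupp hηone (fun v => ςp (-v))
    (hςpsm.comp contDiff_neg) (fun v hv => hςpsupp _ fun h => hv ⟨by linarith [h.2], by linarith [h.1]⟩)
    (fun v hv => hςpone _ ⟨by linarith [hv.2], by linarith [hv.1]⟩)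
  obtain ⟨a1, ha1⟩ := schwartz_osc 1 cp b κ1 hκ1 _ _ hM1 (hχ.rpow_mul (-1) 1)
  obtain ⟨a2, ha2⟩ := schwartz_osc (-1) cm b κ2 hκ2 _ _ hM2 (hχ.rpow_mul (-1) (-1))
  have heq : ⇑(a1 + a2) = phiHatSigma b cp cm χp η ςp ςm := by
    ext ξ
    rw [add_apply, ha1, ha2]
    simp only [phiHatSigma]
    rw [← sigmaHat_pos b cp cm χp hχsupp, ← sigmaHat_neg b cp cm χp hχsupp]
    simp only [mul_one, mul_neg, neg_div, neg_neg]
    push_cast; ring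
  refine ⟨a1 + a2, heq, ?_⟩
  rw [heq]
  simp only [phiHatSigma]
  rw [hηone 0 (by simp), sigmaHat_pos b cp cm χp hχsupp, sigmaHat_neg b cp cm χp hχsupp]
  have : oscJ (-1) cm b 0 (fun t => (-1) * ((t^(-1:ℝ) : ℝ) : ℂ) * (χp t : ℂ)) 0 = - oscJ 1 cp b 0 (fun t => 1 * ((t^(-1:ℝ) : ℝ) : ℂ) * (χp t : ℂ)) 0 := by
    rw [oscJ, oscJ, ← intervalIntegral.integral_neg]
    congr 1; ext t
    rw [oscE_zero, oscE_zero]; ring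
  rw [this]; simp

lemma exists_euler_deriv (a : SchwartzMap (ℝ × ℝ) ℂ) : ∃ a' : SchwartzMap (ℝ × ℝ) ℂ, ∀ ξ, a' ξ = (ξ.2:ℂ) * fderiv ℝ a ξ (0,1) := by
  have hg : Function.HasTemperateGrowth fun ξ : ℝ × ℝ => (ξ.2:ℂ) :=
    (Complex.ofRealCLM.comp (ContinuousLinearMap.snd ℝ ℝ ℝ)).hasTemperateGrowth
  refine ⟨SchwartzMap.smulLeftCLM ℂ (fun ξ : ℝ × ℝ => (ξ.2:ℂ)) (LineDeriv.lineDerivOp ((0,1):ℝ×ℝ) a), fun ξ => ?_⟩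
  rw [SchwartzMap.smulLeftCLM_apply_apply hg, SchwartzMap.lineDerivOp_apply_eq_fderiv, smul_eq_mul]

lemma continuous_parM (b : ℝ) (a : SchwartzMap (ℝ × ℝ) ℂ) (J : Finset ℤ) :
    Continuous fun q : ℝ × (ℝ × ℝ) => parM b a J q.1 q.2 := by
  simp only [parM, dil]
  refine continuous_finsetSum _ fun j _ => a.continuous.comp ?_
  fun_prop

lemma exists_parM_bdd (b : ℝ) (a : SchwartzMap (ℝ × ℝ) ℂ) (J : Finset ℤ) :
    ∃ B, 0 < B ∧ ∀ u ξ, ‖parM b a J u ξ‖ ≤ B := by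
  obtain ⟨B, hB, h⟩ := schwartz_bdd a
  refine ⟨J.card * B + 1, by positivity, fun u ξ => ?_⟩
  have : ‖parM b a J u ξ‖ ≤ ∑ j ∈ J, B := (norm_sum_le _ _).trans (Finset.sum_le_sum fun j _ => h _)
  rw [Finset.sum_const, nsmul_eq_mul] at this
  linarith

lemma integrable_parM (b : ℝ) (a : SchwartzMap (ℝ × ℝ) ℂ) (J : Finset ℤ) (u : ℝ) (F : ℝ × ℝ → ℂ)
    (hF : Integrable F) : Integrable fun ξ => parM b a J u ξ * F ξ := by
  obtain ⟨B, -, h⟩ := exists_parM_bdd b a J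
  exact integrable_mult _ ((continuous_parM b a J).comp (by fun_prop : Continuous fun ξ : ℝ × ℝ => (u, ξ))) B
    (h u) F hF

lemma continuous_FTinv_parM (b : ℝ) (a : SchwartzMap (ℝ × ℝ) ℂ) (J : Finset ℤ) (F : ℝ × ℝ → ℂ)
    (hF : Integrable F) :
    Continuous fun q : ℝ × (ℝ × ℝ) => FTinv (fun ξ => parM b a J q.1 ξ * F ξ) q.2 := by
  obtain ⟨B, -, h⟩ := exists_parM_bdd b a J
  simp only [FTinv_eq]
  refine continuous_of_dominated (bound := fun ξ => B * ‖F ξ‖) (fun q => ?_) (fun q => ?_)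
    (hF.norm.const_mul B) (ae_of_all _ fun ξ => ?_)
  · exact (continuous_ch.comp (by fun_prop)).aestronglyMeasurable.mul
      (integrable_parM b a J q.1 F hF).aestronglyMeasurable
  · refine ae_of_all _ fun ξ => ?_
    rw [norm_mul, norm_mul, norm_ch, one_mul]
    gcongr
    exact h _ _
  · refine (continuous_ch.comp (by fun_prop)).mul (Continuous.mul ?_ continuous_const)
    exact (continuous_parM b a J).comp (by fun_prop : Continuous fun q : ℝ × (ℝ × ℝ) => (q.1, ξ))

lemma hasDerivAt_parM (b : ℝ) (a a' : SchwartzMap (ℝ × ℝ) ℂ)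
    (ha : ∀ ξ, a' ξ = (ξ.2:ℂ) * fderiv ℝ a ξ (0,1)) (J : Finset ℤ) (R σ : ℝ) (hσ : 0 < σ) (ξ : ℝ × ℝ) :
    HasDerivAt (fun σ : ℝ => parM b a J (R * σ) ξ) ((σ⁻¹ : ℂ) * parM b a' J (R * σ) ξ) σ := by
  simp only [parM, Finset.mul_sum]
  refine HasDerivAt.fun_sum fun j _ => ?_
  have h1 : HasDerivAt (fun σ : ℝ => dil b j (R * σ) ξ) (((2:ℝ)^(-((j:ℝ)*b)) * (R * ξ.2)) • ((0:ℝ), (1:ℝ))) σ := by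
    have h2 : HasDerivAt (fun σ : ℝ => (2:ℝ)^(-((j:ℝ)*b)) * (R * σ * ξ.2)) ((2:ℝ)^(-((j:ℝ)*b)) * (R * 1 * ξ.2)) σ :=
      (((hasDerivAt_id σ).const_mul R).mul_const _).const_mul _
    have := (hasDerivAt_const σ ((2:ℝ)^(-(j:ℝ)) * ξ.1)).prodMk h2
    simpa [dil] using this
  have h3 := (a.differentiable.differentiableAt (x := dil b j (R * σ) ξ)).hasFDerivAt.comp_hasDerivAt σ h1
  refine HasDerivAt.congr_deriv (f := fun σ : ℝ => a (dil b j (R * σ) ξ)) h3 ?_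
  rw [map_smul, ha, Complex.real_smul]
  simp only [dil]
  have : (σ:ℂ) ≠ 0 := by exact_mod_cast hσ.ne'
  push_cast
  field_simp

lemma hasDerivAt_FTinv_parM (b : ℝ) (a a' : SchwartzMap (ℝ × ℝ) ℂ)
    (ha : ∀ ξ, a' ξ = (ξ.2:ℂ) * fderiv ℝ a ξ (0,1)) (J : Finset ℤ) (F : ℝ × ℝ → ℂ)
    (hF : Integrable F) (R σ : ℝ) (hσ : 1/2 < σ) (x : ℝ × ℝ) :
    HasDerivAt (fun σ : ℝ => FTinv (fun ξ => parM b a J (R * σ) ξ * F ξ) x)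
      ((σ⁻¹ : ℂ) * FTinv (fun ξ => parM b a' J (R * σ) ξ * F ξ) x) σ := by
  obtain ⟨B, hB, h⟩ := exists_parM_bdd b a' J
  simp only [FTinv_eq]
  rw [← integral_const_mul]
  have hch : AEStronglyMeasurable (fun ξ : ℝ × ℝ => ch (x.1 * ξ.1 + x.2 * ξ.2)) volume :=
    (continuous_ch.comp (by fun_prop)).aestronglyMeasurable
  refine (hasDerivAt_integral_of_dominated_loc_of_deriv_le (s := Ioi (1/2)) (bound := fun ξ => 2 * B * ‖F ξ‖)
    (F := fun (σ : ℝ) (ξ : ℝ × ℝ) => ch (x.1 * ξ.1 + x.2 * ξ.2) * (parM b a J (R * σ) ξ * F ξ))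
    (F' := fun (σ : ℝ) (ξ : ℝ × ℝ) => (σ⁻¹ : ℂ) * (ch (x.1 * ξ.1 + x.2 * ξ.2) * (parM b a' J (R * σ) ξ * F ξ)))
    (Ioi_mem_nhds hσ) (Eventually.of_forall fun τ => ?_) ?_ ?_ ?_ (hF.norm.const_mul _) ?_).2
  · exact hch.mul (integrable_parM b a J _ F hF).aestronglyMeasurable
  · refine (integrable_parM b a J (R * σ) F hF).bdd_mul (c := 1) hch (ae_of_all _ fun ξ => ?_)
    rw [norm_ch]
  · exact (hch.mul (integrable_parM b a' J _ F hF).aestronglyMeasurable).const_mul _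
  · refine ae_of_all _ fun ξ τ hτ => ?_
    have hτ' : (1/2:ℝ) < τ := hτ
    rw [norm_mul, norm_mul, norm_mul, norm_ch, one_mul, ← mul_assoc]
    refine mul_le_mul_of_nonneg_right (mul_le_mul ?_ (h _ _) (norm_nonneg _) (by norm_num)) (norm_nonneg _)
    rw [norm_inv, Complex.norm_real, Real.norm_of_nonneg (by linarith)]
    exact inv_le_of_inv_le₀ (by linarith) (by linarith)
  · refine ae_of_all _ fun ξ τ hτ => ?_
    have hτ' : (1/2:ℝ) < τ := hτ
    have := ((hasDerivAt_parM b a a' ha J R τ (by linarith) ξ).mul_const (F ξ)).const_mul (ch (x.1 * ξ.1 + x.2 * ξ.2))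
    exact this.congr_deriv (by ring)

lemma enorm_FTinv_parM_le (b : ℝ) (a a' : SchwartzMap (ℝ × ℝ) ℂ)
    (ha : ∀ ξ, a' ξ = (ξ.2:ℂ) * fderiv ℝ a ξ (0,1)) (J : Finset ℤ) (F : ℝ × ℝ → ℂ)
    (hF : Integrable F) (p : ℝ) (hp : 1 < p) (hp2 : p ≤ 2) (R s : ℝ) (hs : s ∈ Icc (1:ℝ) 2) (x : ℝ × ℝ) :
    ‖FTinv (fun ξ => parM b a J (R * s) ξ * F ξ) x‖ₑ ^ p ≤
      2 * (‖FTinv (fun ξ => parM b a J R ξ * F ξ) x‖ₑ ^ p +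
        ∫⁻ σ in Icc (1:ℝ) 2, ‖FTinv (fun ξ => parM b a' J (R * σ) ξ * F ξ) x‖ₑ ^ p) := by
  set D : ℝ → ℂ := fun σ => FTinv (fun ξ => parM b a' J (R * σ) ξ * F ξ) x with hD
  have hDc : Continuous D :=
    (continuous_FTinv_parM b a' J F hF).comp (by fun_prop : Continuous fun σ : ℝ => (R * σ, x))
  have hint : IntervalIntegrable (fun σ : ℝ => (σ⁻¹ : ℂ) * D σ) volume 1 s := by
    refine ContinuousOn.intervalIntegrable fun σ hσ => ContinuousAt.continuousWithinAt ?_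
    rw [uIcc_of_le hs.1] at hσ
    have : (σ:ℂ) ≠ 0 := by exact_mod_cast (by linarith [hσ.1] : σ ≠ 0)
    exact (Complex.continuous_ofReal.continuousAt.inv₀ this).mul hDc.continuousAt
  have hftc := intervalIntegral.integral_eq_sub_of_hasDerivAt (fun σ hσ => by
    rw [uIcc_of_le hs.1] at hσ
    exact hasDerivAt_FTinv_parM b a a' ha J F hF R σ (by linarith [hσ.1]) x) hint
  rw [mul_one] at hftc
  have hsplit : FTinv (fun ξ => parM b a J (R * s) ξ * F ξ) x = FTinv (fun ξ => parM b a J R ξ * F ξ) x +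
      ∫ σ in (1:ℝ)..s, (σ⁻¹ : ℂ) * D σ := by rw [hftc]; ring
  rw [hsplit]
  refine (enorm_add_rpow_le _ _ p hp hp2).trans ?_
  gcongr
  have : IsProbabilityMeasure ((volume : Measure ℝ).restrict (Icc 1 2)) := ⟨by simp; norm_num⟩
  refine le_trans (ENNReal.rpow_le_rpow ?_ (by linarith)) (lintegral_rpow_le_of_prob _ p hp.le _
    hDc.measurable.enorm.aemeasurable)
  rw [intervalIntegral.integral_of_le hs.1]
  refine (enorm_integral_le_lintegral_enorm _).trans ?_
  refine le_trans ?_ (lintegral_mono_set (fun σ hσ => ⟨hσ.1.le, hσ.2.trans hs.2⟩ : Ioc 1 s ⊆ Icc (1:ℝ) 2))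
  refine setLIntegral_mono' measurableSet_Ioc fun σ hσ => ?_
  rw [enorm_mul]
  refine mul_le_of_le_one_left (by simp) ?_
  rw [enorm_inv (by exact_mod_cast (by linarith [hσ.1] : σ ≠ 0)), ENNReal.inv_le_one, ← ofReal_norm,
    Complex.norm_real, Real.norm_of_nonneg (by linarith [hσ.1]), ENNReal.one_le_ofReal]
  exact hσ.1.le

/-- An `L^p` majorant for the truncated maximal function. -/
def majG (b : ℝ) (a a' : ℝ × ℝ → ℂ) (S : Set ℤ) (p : ℝ) (F : ℝ × ℝ → ℂ) (J : Finset ℤ) (x : ℝ × ℝ) : ℝ≥0∞ :=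
  2 * ((⨆ n : S, ‖FTinv (fun ξ => parM b a J ((2:ℝ)^(n:ℤ)) ξ * F ξ) x‖ₑ ^ p) +
    ∫⁻ σ in Icc (1:ℝ) 2, ⨆ n : S, ‖FTinv (fun ξ => parM b a' J ((2:ℝ)^(n:ℤ) * σ) ξ * F ξ) x‖ₑ ^ p)

lemma measurable_majG_snd (b : ℝ) (a' : SchwartzMap (ℝ × ℝ) ℂ) (S : Set ℤ) (p : ℝ)
    (F : ℝ × ℝ → ℂ) (hF : Integrable F) (J : Finset ℤ) :
    Measurable fun q : ℝ × (ℝ × ℝ) => ⨆ n : S, ‖FTinv (fun ξ => parM b a' J ((2:ℝ)^(n:ℤ) * q.1) ξ * F ξ) q.2‖ₑ ^ p := by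
  refine Measurable.iSup fun n => Measurable.pow_const ?_ _
  exact ((continuous_FTinv_parM b a' J F hF).comp
    (by fun_prop : Continuous fun q : ℝ × (ℝ × ℝ) => ((2:ℝ)^(n:ℤ) * q.1, q.2))).measurable.enorm

lemma measurable_majG_fst (b : ℝ) (a : SchwartzMap (ℝ × ℝ) ℂ) (S : Set ℤ) (p : ℝ)
    (F : ℝ × ℝ → ℂ) (hF : Integrable F) (J : Finset ℤ) :
    Measurable fun x : ℝ × ℝ => ⨆ n : S, ‖FTinv (fun ξ => parM b a J ((2:ℝ)^(n:ℤ)) ξ * F ξ) x‖ₑ ^ p := by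
  refine Measurable.iSup fun n => Measurable.pow_const ?_ _
  exact (continuous_FTinv _ (integrable_parM b a J _ F hF)).measurable.enorm

lemma measurable_majG (b : ℝ) (a a' : SchwartzMap (ℝ × ℝ) ℂ) (S : Set ℤ) (p : ℝ)
    (F : ℝ × ℝ → ℂ) (hF : Integrable F) (J : Finset ℤ) : Measurable (majG b a a' S p F J) :=
  ((measurable_majG_fst b a S p F hF J).add
    (measurable_majG_snd b a' S p F hF J).lintegral_prod_left').const_mul 2

lemma le_majG (b : ℝ) (a a' : SchwartzMap (ℝ × ℝ) ℂ)
    (ha : ∀ ξ, a' ξ = (ξ.2:ℂ) * fderiv ℝ a ξ (0,1)) (J : Finset ℤ) (F : ℝ × ℝ → ℂ)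
    (hF : Integrable F) (p : ℝ) (hp : 1 < p) (hp2 : p ≤ 2) (S : Set ℤ) (n : ℤ) (hn : n ∈ S) (s : ℝ)
    (hs : s ∈ Icc (1:ℝ) 2) (x : ℝ × ℝ) :
    ‖FTinv (fun ξ => parM b a J ((2:ℝ)^n * s) ξ * F ξ) x‖ₑ ^ p ≤ majG b a a' S p F J x := by
  refine (enorm_FTinv_parM_le b a a' ha J F hF p hp hp2 _ s hs x).trans ?_
  refine mul_le_mul le_rfl (add_le_add ?_ (lintegral_mono fun σ => ?_)) (by simp) (by simp)
  · exact le_iSup (fun n : S => ‖FTinv (fun ξ => parM b a J ((2:ℝ)^(n:ℤ)) ξ * F ξ) x‖ₑ ^ p) ⟨n, hn⟩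
  · exact le_iSup (fun n : S => ‖FTinv (fun ξ => parM b a' J ((2:ℝ)^(n:ℤ) * σ) ξ * F ξ) x‖ₑ ^ p) ⟨n, hn⟩

lemma lintegral_majG_le (b : ℝ) (a a' : SchwartzMap (ℝ × ℝ) ℂ) (S : Set ℤ) (p : ℝ)
    (F : ℝ × ℝ → ℂ) (hF : Integrable F) (J : Finset ℤ) (B B' : ℝ≥0∞)
    (hB : ∫⁻ x, ⨆ n : S, ‖FTinv (fun ξ => parM b a J ((2:ℝ)^(n:ℤ)) ξ * F ξ) x‖ₑ ^ p ≤ B)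
    (hB' : ∀ σ ∈ Icc (1:ℝ) 2,
      ∫⁻ x, ⨆ n : S, ‖FTinv (fun ξ => parM b a' J ((2:ℝ)^(n:ℤ) * σ) ξ * F ξ) x‖ₑ ^ p ≤ B') :
    ∫⁻ x, majG b a a' S p F J x ≤ 2 * (B + B') := by
  have hm := measurable_majG_snd b a' S p F hF J
  simp only [majG]
  rw [lintegral_const_mul' _ _ (by simp), lintegral_add_left (measurable_majG_fst b a S p F hF J)]
  refine mul_le_mul le_rfl (add_le_add hB ?_) (by simp) (by simp)
  rw [lintegral_lintegral_swap (f := fun x σ => ⨆ n : S, ‖FTinv (fun ξ => parM b a' J ((2:ℝ)^(n:ℤ) * σ) ξ * F ξ) x‖ₑ ^ p)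
    (hm.comp measurable_swap).aemeasurable]
  refine (setLIntegral_mono' measurableSet_Icc hB').trans ?_
  rw [lintegral_const]
  simp
  norm_num

lemma norm_le_min_of_zero (a : SchwartzMap (ℝ × ℝ) ℂ) (ha : a 0 = 0) : ∃ C, 0 < C ∧ ∀ ζ : ℝ × ℝ,
    ‖a ζ‖ ≤ C * (min |ζ.1| |ζ.1|⁻¹ + min |ζ.2| |ζ.2|⁻¹) := by
  obtain ⟨C1, hC1, h1⟩ := a.decay 1 0
  obtain ⟨C2, hC2, h2⟩ := a.decay 0 1
  have hlip : ∀ ζ, ‖a ζ‖ ≤ C2 * ‖ζ‖ := fun ζ => by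
    have := Convex.norm_image_sub_le_of_norm_fderiv_le (𝕜 := ℝ) (f := a) (C := C2) (s := univ) (x := 0) (y := ζ)
      (fun x _ => a.differentiable.differentiableAt) (fun x _ => by
        have := h2 x
        rwa [pow_zero, one_mul, norm_iteratedFDeriv_one] at this) convex_univ (mem_univ _) (mem_univ _)
    simpa [ha] using this
  have hdec : ∀ ζ, ‖ζ‖ * ‖a ζ‖ ≤ C1 := fun ζ => by simpa using h1 ζ
  have key : ∀ ζ : ℝ × ℝ, ‖a ζ‖ ≤ max C1 C2 * min ‖ζ‖ ‖ζ‖⁻¹ := fun ζ => by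
    have hC : 0 ≤ max C1 C2 := hC1.le.trans (le_max_left _ _)
    rw [mul_min_of_nonneg _ _ hC]
    refine le_min ((hlip ζ).trans (by gcongr; exact le_max_right _ _)) ?_
    rcases eq_or_ne ζ 0 with rfl | hz
    · simp [ha]
    · rw [← div_eq_mul_inv, le_div_iff₀ (norm_pos_iff.2 hz), mul_comm]
      exact (hdec ζ).trans (le_max_left _ _)
  refine ⟨max C1 C2, lt_max_of_lt_left hC1, fun ζ => (key ζ).trans ?_⟩
  have hC : 0 ≤ max C1 C2 := hC1.le.trans (le_max_left _ _)
  refine mul_le_mul_of_nonneg_left ?_ hC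
  have n1 : 0 ≤ min |ζ.1| |ζ.1|⁻¹ := by positivity
  have n2 : 0 ≤ min |ζ.2| |ζ.2|⁻¹ := by positivity
  rw [Prod.norm_def, Real.norm_eq_abs, Real.norm_eq_abs]
  rcases max_choice |ζ.1| |ζ.2| with h | h <;> rw [h] <;> linarith

lemma parM_abs_bdd (b : ℝ) (hb : 1 < b) (a : SchwartzMap (ℝ × ℝ) ℂ) (ha : a 0 = 0) :
    ∃ K, 0 < K ∧ ∀ (J : Finset ℤ) (u : ℝ) (ξ : ℝ × ℝ), ∑ j ∈ J, ‖a (dil b j u ξ)‖ ≤ K := by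
  obtain ⟨K, hK, hgeo⟩ := geo_sum
  obtain ⟨C, hC, h⟩ := norm_le_min_of_zero a ha
  have hg : ∀ β, 1 ≤ β → ∀ (J : Finset ℤ) (y : ℝ),
      ∑ j ∈ J, min |(2:ℝ)^(-((j:ℝ)*β)) * y| |(2:ℝ)^(-((j:ℝ)*β)) * y|⁻¹ ≤ K := fun β hβ J y => by
    rcases eq_or_ne y 0 with rfl | hy
    · simpa using hK.le
    · have := hgeo β |y| hβ (abs_pos.2 hy) J 0
      refine le_trans (le_of_eq (Finset.sum_congr rfl fun j _ => ?_)) this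
      rw [abs_mul, abs_of_pos (by positivity : (0:ℝ) < 2^(-((j:ℝ)*β))), zpow_zero, div_one, one_div]
  refine ⟨C * (K + K), by positivity, fun J u ξ => ?_⟩
  refine (Finset.sum_le_sum fun j _ => h _).trans ?_
  rw [← Finset.mul_sum, Finset.sum_add_distrib]
  have e1 := hg 1 le_rfl J ξ.1
  have e2 := hg b hb.le J (u * ξ.2)
  simp only [mul_one] at e1
  exact mul_le_mul_of_nonneg_left (add_le_add e1 e2) hC.le

lemma tendsto_Icc_neg_atTop : Tendsto (fun m : ℕ => Finset.Icc (-(m:ℤ)) m) atTop atTop := by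
  refine tendsto_atTop_finset_of_monotone (fun m n h => Finset.Icc_subset_Icc (by omega) (by omega)) fun j =>
    ⟨j.natAbs, Finset.mem_Icc.2 ⟨by omega, by omega⟩⟩

lemma tendsto_FTinv_parM (b : ℝ) (hb : 1 < b) (a : SchwartzMap (ℝ × ℝ) ℂ) (ha : a 0 = 0) (F : ℝ × ℝ → ℂ)
    (hF : Integrable F) (u : ℝ) (x : ℝ × ℝ) :
    Tendsto (fun m : ℕ => FTinv (fun ξ => parM b a (Finset.Icc (-(m:ℤ)) m) u ξ * F ξ) x) atTop
      (𝓝 (FTinv (fun ξ => (∑' j : ℤ, a (dil b j u ξ)) * F ξ) x)) := by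
  obtain ⟨K, hK, h⟩ := parM_abs_bdd b hb a ha
  simp only [FTinv_eq]
  refine tendsto_integral_of_dominated_convergence (fun ξ => K * ‖F ξ‖) (fun m => ?_) (hF.norm.const_mul K)
    (fun m => ae_of_all _ fun ξ => ?_) (ae_of_all _ fun ξ => ?_)
  · exact (continuous_ch.comp (by fun_prop)).aestronglyMeasurable.mul
      (integrable_parM b a _ u F hF).aestronglyMeasurable
  · rw [norm_mul, norm_mul, norm_ch, one_mul]
    refine mul_le_mul_of_nonneg_right ((norm_sum_le _ _).trans (h _ u ξ)) (norm_nonneg _)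
  · refine Tendsto.const_mul _ (Tendsto.mul_const _ ?_)
    have hs : Summable fun j : ℤ => a (dil b j u ξ) :=
      Summable.of_norm (summable_of_sum_le (fun j => norm_nonneg _) fun J => h J u ξ)
    exact hs.hasSum.comp tendsto_Icc_neg_atTop

lemma lintegral_ofReal_abs_rpow (f : ℝ × ℝ → ℝ) (p : ℝ) (hp : 1 < p) :
    (∫⁻ x, ENNReal.ofReal (|f x| ^ p)) ^ (1/p) = eLpNorm f (eN p) volume := by
  have hp0 : 0 < p := by linarith
  rw [eN, eLpNorm_eq_lintegral_rpow_enorm_toReal (ENNReal.ofReal_pos.2 hp0).ne' ENNReal.ofReal_ne_top,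
    ENNReal.toReal_ofReal hp0.le]
  congr 1
  refine lintegral_congr fun x => ?_
  rw [← ofReal_norm, ENNReal.ofReal_rpow_of_nonneg (norm_nonneg _) hp0.le, Real.norm_eq_abs]

lemma two_mul_add_rpow_le (x y : ℝ≥0∞) (p : ℝ) (hp : 1 ≤ p) : 2 * (x^p + y^p) ≤ (2 * (x + y))^p := by
  rw [ENNReal.mul_rpow_of_nonneg _ _ (by linarith)]
  refine mul_le_mul ?_ (ENNReal.add_rpow_le_rpow_add _ _ hp) (by simp) (by simp)
  exact ENNReal.le_rpow_self_of_one_le (by norm_num) hp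

lemma exists_lpN_maximal_le (b : ℝ) (hb : 1 < b) (a : SchwartzMap (ℝ × ℝ) ℂ) (ha : a 0 = 0) :
    ∃ C, 0 < C ∧ ∀ p, 1 < p → p ≤ 2 → ∀ S : Set ℤ, S.Finite → S.Nonempty → ∀ U : Set ℝ,
      (∀ u ∈ U, ∃ n ∈ S, ∃ s ∈ Icc (1:ℝ) 2, u = (2:ℝ)^n * s) → ∀ (f : ℝ × ℝ → ℝ) (F : ℝ × ℝ → ℂ),
      Integrable F → (∀ x, FTinv F x = (f x : ℂ)) →
      lpN (fun x => ⨆ u : U, ‖FTinv (fun ξ => (∑' j : ℤ, a (dil b j u ξ)) * F ξ) x‖ₑ) p ≤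
        ENNReal.ofReal (C * (p-1)^(-3:ℝ) * √(Real.log (1 + S.ncard))) * eLpNorm f (eN p) volume := by
  obtain ⟨a', ha'⟩ := exists_euler_deriv a
  have ha'0 : a' 0 = 0 := by simp [ha']
  obtain ⟨C1, hC1, h1⟩ := max_finite b hb a ha
  obtain ⟨C2, hC2, h2⟩ := max_finite b hb a' ha'0
  refine ⟨2 * (C1 + C2), by positivity, fun p hp hp2 S hSf hSn U hU f F hF hFf => ?_⟩
  have hp0 : 0 < p := by linarith
  have hp1 : 0 ≤ (p-1)^(-3:ℝ) := Real.rpow_nonneg (by linarith) _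
  have : Fintype S := hSf.fintype
  have : Nonempty S := hSn.to_subtype
  have hcard : (Fintype.card S : ℝ) = S.ncard := by
    rw [← Nat.card_eq_fintype_card, Nat.card_coe_set_eq]
  set I : ℝ≥0∞ := ∫⁻ x, ENNReal.ofReal (|f x| ^ p) with hI
  set L : ℝ := (p-1)^(-3:ℝ) * √(Real.log (1 + S.ncard)) with hL
  have hL0 : 0 ≤ L := by positivity
  set G : ℕ → ℝ × ℝ → ℝ≥0∞ := fun m => majG b a a' S p F (Finset.Icc (-(m:ℤ)) m) with hG
  have hGI : ∀ m, ∫⁻ x, G m x ≤ ENNReal.ofReal (2 * (C1 + C2) * L) ^ p * I := fun m => by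
    refine (lintegral_majG_le b a a' S p F hF _ (ENNReal.ofReal (C1 * L) ^ p * I)
      (ENNReal.ofReal (C2 * L) ^ p * I) ?_ fun σ hσ => ?_).trans ?_
    · have := h1 p hp hp2 (ν := S) (fun n => (2:ℝ)^(n:ℤ)) (fun n => by positivity) (Finset.Icc (-(m:ℤ)) m) F hF f hFf
      rwa [hcard, mul_assoc C1] at this
    · have := h2 p hp hp2 (ν := S) (fun n => (2:ℝ)^(n:ℤ) * σ) (fun n => mul_pos (by positivity) (by linarith [hσ.1]))
        (Finset.Icc (-(m:ℤ)) m) F hF f hFf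
      rwa [hcard, mul_assoc C2] at this
    · rw [← add_mul, ← mul_assoc]
      refine mul_le_mul ?_ le_rfl (by simp) (by simp)
      refine (two_mul_add_rpow_le _ _ p hp.le).trans (le_of_eq ?_)
      rw [← ENNReal.ofReal_add (by positivity) (by positivity), mul_assoc 2, ENNReal.ofReal_mul (p := 2) (by norm_num),
        add_mul, ENNReal.ofReal_ofNat]
  have hpt : ∀ x, (⨆ u : U, ‖FTinv (fun ξ => (∑' j : ℤ, a (dil b j u ξ)) * F ξ) x‖ₑ) ^ p ≤
      liminf (fun m => G m x) atTop := fun x => by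
    rw [← ENNReal.le_rpow_inv_iff hp0]
    refine iSup_le fun u => ?_
    rw [ENNReal.le_rpow_inv_iff hp0]
    obtain ⟨n, hn, s, hs, hu⟩ := hU u u.2
    have ht := (ENNReal.continuous_rpow_const (y := p)).tendsto _ |>.comp
      (tendsto_FTinv_parM b hb a ha F hF u x).enorm
    rw [← ht.liminf_eq]
    refine liminf_le_liminf (Eventually.of_forall fun m => ?_)
    rw [hu]
    exact le_majG b a a' ha' _ F hF p hp hp2 S n hn s hs x
  have hfin : ∫⁻ x, (⨆ u : U, ‖FTinv (fun ξ => (∑' j : ℤ, a (dil b j u ξ)) * F ξ) x‖ₑ) ^ p ≤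
      ENNReal.ofReal (2 * (C1 + C2) * L) ^ p * I := by
    refine (lintegral_mono hpt).trans ((lintegral_liminf_le fun m => measurable_majG b a a' S p F hF _).trans ?_)
    refine (liminf_le_liminf (Eventually.of_forall hGI)).trans ?_
    rw [liminf_const]
  rw [lpN]
  refine (ENNReal.rpow_le_rpow hfin (by positivity)).trans (le_of_eq ?_)
  rw [ENNReal.mul_rpow_of_nonneg _ _ (by positivity), ← ENNReal.rpow_mul, mul_one_div_cancel hp0.ne',
    ENNReal.rpow_one, hI, lintegral_ofReal_abs_rpow f p hp, hL, mul_assoc (2 * (C1 + C2))]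

lemma lpN_Sop_zero (b cp cm : ℝ) (χ : ℝ → ℝ) (η : ℝ × ℝ → ℝ) (ςp ςm : ℝ → ℝ) (U : Set ℝ) (p : ℝ)
    (hp : 0 < p) : lpN (fun x => ⨆ u : U, ((‖Sop b cp cm χ η ςp ςm (u : ℝ) (fun _ => 0) x‖₊ : ℝ≥0∞))) p = 0 := by
  have : ∀ (u : ℝ) x, Sop b cp cm χ η ςp ςm u (fun _ => 0) x = 0 := fun u x => by
    simp [Sop, FT, FTinv]
  simp [this, lpN, hp]

end

theorem statement16 (b cp cm : ℝ) (hb : 1 < b) (hcp : cp ≠ 0) (hcm : cm ≠ 0)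
    (χp : ℝ → ℝ) (hχsm : ContDiff ℝ (⊤ : ℕ∞) χp)
    (hχsupp : ∀ t : ℝ, t ∉ Ioo (1/2 : ℝ) 2 → χp t = 0)
    (hχsum : ∀ t : ℝ, 0 < t → HasSum (fun j : ℤ => χp ((2:ℝ) ^ j * t)) 1)
    (η : ℝ × ℝ → ℝ) (hηsm : ContDiff ℝ (⊤ : ℕ∞) η)
    (hηsupp : ∀ ξ : ℝ × ℝ, (100:ℝ)^2 < ξ.1^2 + ξ.2^2 → η ξ = 0)
    (hηone : ∀ ξ : ℝ × ℝ, ξ.1^2 + ξ.2^2 ≤ (50:ℝ)^2 → η ξ = 1)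
    (ςp : ℝ → ℝ) (hςpsm : ContDiff ℝ (⊤ : ℕ∞) ςp)
    (hςpsupp : ∀ v : ℝ, v ∉ Ioo (b * (4:ℝ)⁻¹ ^ (b-1)) (b * (4:ℝ) ^ (b-1)) → ςp v = 0)
    (hςpone : ∀ v ∈ Icc (b * ((2:ℝ)/7) ^ (b-1)) (b * ((7:ℝ)/2) ^ (b-1)), ςp v = 1)
    (ςm : ℝ → ℝ) (hςmsm : ContDiff ℝ (⊤ : ℕ∞) ςm)
    (hςmsupp : ∀ v : ℝ, v ∉ Ioo (-(b * (4:ℝ) ^ (b-1))) (-(b * (4:ℝ)⁻¹ ^ (b-1))) → ςm v = 0)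
    (hςmone : ∀ v ∈ Icc (-(b * ((7:ℝ)/2) ^ (b-1))) (-(b * ((2:ℝ)/7) ^ (b-1))), ςm v = 1) :
    ∃ C : ℝ, ∀ p : ℝ, 1 < p → p ≤ 2 → ∀ U : Set ℝ, U.Nonempty → U ⊆ Ioi (0:ℝ) →
      ∀ f : SchwartzMap (ℝ × ℝ) ℝ,
        lpN (fun x => ⨆ u : U,
            ((‖Sop b cp cm χp η ςp ςm (u : ℝ) ⇑f x‖₊ : ℝ≥0∞))) p
          ≤ ENNReal.ofReal (C * (p - 1) ^ (-(7:ℝ))) * sqrtLogN U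
              * eLpNorm ⇑f (eN p) volume := by

  obtain ⟨a, ha, ha0⟩ := exists_phiHatSigma b cp cm hb hcp hcm χp hχsm hχsupp η hηsm hηsupp hηone ςp hςpsm hςpsupp
    hςpone ςm hςmsm hςmsupp hςmone
  obtain ⟨C, hC, hmax⟩ := exists_lpN_maximal_le b hb a ha0
  refine ⟨C, fun p hp hp2 U hU hU0 f => ?_⟩
  have hp0 : 0 < p := by linarith
  have hp1 : 0 < p - 1 := by linarith
  set S : Set ℤ := {n:ℤ | (Icc ((2:ℝ)^n) ((2:ℝ)^(n+1)) ∩ U).Nonempty} with hS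
  have hN : frakN U = 1 + S.encard := rfl
  have hcov : ∀ u ∈ U, ∃ n ∈ S, ∃ s ∈ Icc (1:ℝ) 2, u = (2:ℝ)^n * s := fun u hu => by
    obtain ⟨n, hn⟩ := exists_mem_Ico_zpow (hU0 hu : (0:ℝ) < u) (by norm_num : (1:ℝ) < 2)
    have h2 : (0:ℝ) < 2^n := by positivity
    rw [zpow_add_one₀ two_ne_zero] at hn
    refine ⟨n, ⟨u, ⟨hn.1, ?_⟩, hu⟩, u / 2^n, ⟨(one_le_div₀ h2).2 hn.1, (div_le_iff₀ h2).2 ?_⟩, ?_⟩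
    · rw [zpow_add_one₀ two_ne_zero]; exact hn.2.le
    · linarith [hn.2]
    · field_simp
  have hSn : S.Nonempty := by
    obtain ⟨u, hu⟩ := hU
    obtain ⟨n, hn, -⟩ := hcov u hu
    exact ⟨n, hn⟩
  rcases S.finite_or_infinite with hfin | hinf
  · obtain ⟨F, hF1, hF2⟩ := exists_FTinv_eq (SchwartzMap.postcompCLM Complex.ofRealCLM f)
    have hfc : ⇑(SchwartzMap.postcompCLM Complex.ofRealCLM f) = fun x => ((f x : ℝ) : ℂ) := by
      ext x; simp [SchwartzMap.postcompCLM_apply]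
    rw [hfc] at hF1 hF2
    have key := hmax p hp hp2 S hfin hSn U hcov f F F.integrable fun x => congrFun hF2 x
    have hcard : frakN U = ((1 + S.ncard : ℕ) : ℕ∞) := by
      rw [hN, ← hfin.cast_ncard_eq]; push_cast; rfl
    have hL : sqrtLogN U = ENNReal.ofReal √(Real.log (1 + S.ncard)) := by
      rw [sqrtLogN, hcard, if_neg (ENat.natCast_ne_top _), ENat.toNat_natCast]; push_cast; rfl
    simp only [Sop, hF1, ← ha]
    refine key.trans ?_
    rw [hL, ENNReal.ofReal_mul (mul_nonneg hC.le (Real.rpow_nonneg hp1.le _))]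
    refine mul_le_mul (mul_le_mul (ENNReal.ofReal_le_ofReal ?_) le_rfl (by simp) (by simp)) le_rfl (by simp) (by simp)
    exact mul_le_mul_of_nonneg_left
      (Real.rpow_le_rpow_of_exponent_ge hp1 (by linarith) (by norm_num)) hC.le
  · have hL : sqrtLogN U = ⊤ := by
      rw [sqrtLogN, if_pos]
      rw [hN, encard_eq_top_iff.2 hinf]; rfl
    rcases eq_or_ne (eLpNorm ⇑f (eN p) volume) 0 with h0 | h0
    · rw [eN, eLpNorm_eq_zero_iff f.continuous.aestronglyMeasurable (ENNReal.ofReal_pos.2 hp0).ne'] at h0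
      have hf : ⇑f = fun _ => 0 := (f.continuous.ae_eq_iff_eq volume continuous_zero).1 h0
      rw [hf, lpN_Sop_zero _ _ _ _ _ _ _ _ _ hp0]
      simp
    · rw [hL, ENNReal.mul_top (ENNReal.ofReal_pos.2 (mul_pos hC (Real.rpow_pos_of_pos hp1 _))).ne',
        ENNReal.top_mul h0]
      exact le_top

end
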